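/- Let n ≥ 1, let r = (r₁,…,rₙ) be a weight in ℝⁿ, let U ⊆ ℝ be an open interval, let φ : U → ℝⁿ be a nondegenerate analytic map, and let θ = (θ₁,…,θₙ), where each θᵢ : ℝⁿ → ℝ is Lipschitz on φ(U). Let μ be a (C,α)-Ahlfors regular Borel measure on ℝ such that U ∩ supp μ ≠ ∅. Then the set {x ∈ U : liminf over q ∈ ℤ\{0}, |q|→∞, of max_{1≤i≤n} |q·φᵢ(x) − θᵢ(φ(x))|_ℤ^{1/rᵢ} · |q| is positive} has nonempty intersection with supp μ. -/

import Mathlib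

/- STATEMENT 0: Theorem (main theorem, measure form).
Weighted inhomogeneous badly approximable vectors on a nondegenerate analytic curve
intersect the support of any Ahlfors regular measure. -/

open Filter Set MeasureTheory
open scoped ENNReal

/-- distance from `y` to the nearest integer, `|y|_ℤ`. -/
noncomputable def distInt (y : ℝ) : ℝ := |y - round y|

/-- `wpow t s = t ^ (1/s)`, with the convention `t ^ (1/0) := 0`. -/
noncomputable def wpow (t s : ℝ) : ℝ := if s = 0 then 0 else t ^ (1 / s)

/-- `liminf` over `q ∈ ℤ \ {0}`, `|q| → ∞`, of
`max_{1 ≤ i ≤ n} |q·yᵢ − θᵢ|_ℤ^{1/rᵢ} · |q|` (valued in `ℝ≥0∞`). -/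
noncomputable def badLiminf {n : ℕ} (r y θv : Fin n → ℝ) : ℝ≥0∞ :=
  Filter.liminf
    (fun q : ℤ =>
      ENNReal.ofReal ((⨆ i, wpow (distInt ((q : ℝ) * y i - θv i)) (r i)) * |(q : ℝ)|))
    (Filter.comap (fun q : ℤ => |q|) Filter.atTop)

/-- support of a measure on `ℝ`. -/
def msupport (μ : Measure ℝ) : Set ℝ := {x | ∀ ρ > 0, 0 < μ (Metric.ball x ρ)}

/-! ### Sublevel sets of functions with controlled derivatives -/

theorem exists_abs_deriv_le_of_separated {a b d ε : ℝ} (hd : 0 < d) (k : ℕ) :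
    ∀ (g : ℕ → ℝ → ℝ), (∀ j, ∀ x ∈ Icc a b, HasDerivAt (g j) (g (j + 1) x) x) →
    ∀ p : ℕ → ℝ, (∀ i < 2 ^ k, p i ∈ Icc a b) → (∀ i, i + 1 < 2 ^ k → p i + d ≤ p (i + 1)) →
    (∀ i < 2 ^ k, |g 0 (p i)| ≤ ε) → ∃ z ∈ Icc a b, |g k z| ≤ (2 / d) ^ k * ε := by
  induction k generalizing ε with
  | zero =>
    intro g _ p hp _ hε
    exact ⟨p 0, hp 0 (by simp), by simpa using hε 0 (by simp)⟩
  | succ k ih =>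
    intro g hg p hp hgap hε
    have key : ∀ i, ∃ z, i < 2 ^ k →
        z ∈ Ioo (p (2 * i)) (p (2 * i + 1)) ∧ |g 1 z| ≤ 2 / d * ε := by
      intro i
      by_cases hi : i < 2 ^ k
      swap
      · exact ⟨0, fun h => absurd h hi⟩
      have h1 : 2 * i + 1 < 2 ^ (k + 1) := by rw [pow_succ]; omega
      have h0 : 2 * i < 2 ^ (k + 1) := by omega
      have hlt := hgap (2 * i) h1
      have hin : ∀ x ∈ Icc (p (2 * i)) (p (2 * i + 1)), x ∈ Icc a b := fun x hx =>
        ⟨(hp _ h0).1.trans hx.1, hx.2.trans (hp _ h1).2⟩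
      obtain ⟨z, hz, hzeq⟩ := exists_hasDerivAt_eq_slope (g 0) (g 1)
        (show p (2 * i) < p (2 * i + 1) by linarith)
        (fun x hx => (hg 0 x (hin x hx)).continuousAt.continuousWithinAt)
        (fun x hx => hg 0 x (hin x (Ioo_subset_Icc_self hx)))
      refine ⟨z, fun _ => ⟨hz, ?_⟩⟩
      have e0 := hε _ h0
      have e1 := hε _ h1
      rw [hzeq, abs_div, abs_of_pos (show 0 < p (2 * i + 1) - p (2 * i) by linarith),
        div_le_iff₀ (by linarith)]
      have h2 : |g 0 (p (2 * i + 1)) - g 0 (p (2 * i))| ≤ 2 * ε := by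
        refine (abs_sub _ _).trans ?_
        linarith
      have hε0 : 0 ≤ ε := (abs_nonneg _).trans e0
      have : 2 * ε = 2 / d * ε * d := by field_simp
      rw [this] at h2
      refine h2.trans (mul_le_mul_of_nonneg_left (by linarith) (by positivity))
    choose z hz using key
    obtain ⟨y, hy, hyk⟩ := ih (ε := 2 / d * ε) (fun j => g (j + 1)) (fun j => hg (j + 1)) z
      (fun i hi => by
        have h1 : 2 * i + 1 < 2 ^ (k + 1) := by rw [pow_succ]; omega
        exact ⟨(hp (2 * i) (by omega)).1.trans (hz i hi).1.1.le,
          (hz i hi).1.2.le.trans (hp _ h1).2⟩)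
      (fun i hi => by
        have h1 : 2 * i + 1 + 1 < 2 ^ (k + 1) := by rw [pow_succ]; omega
        have h2 := hgap (2 * i + 1) h1
        have h3 := (hz i (by omega)).1.2
        have h4 := (hz (i + 1) hi).1.1
        rw [show 2 * (i + 1) = 2 * i + 1 + 1 by ring] at h4
        linarith)
      (fun i hi => (hz i hi).2)
    exact ⟨y, hy, hyk.trans_eq (by ring)⟩

theorem abs_le_of_separated {a b d ε A K w : ℝ} (hd : 0 < d) {k : ℕ} {g : ℕ → ℝ → ℝ}
    (hg : ∀ j, ∀ x ∈ Icc a b, HasDerivAt (g j) (g (j + 1) x) x)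
    {p : ℕ → ℝ} (hp : ∀ i < 2 ^ k, p i ∈ Icc a b)
    (hgap : ∀ i, i + 1 < 2 ^ k → p i + d ≤ p (i + 1)) (hε : ∀ i < 2 ^ k, |g 0 (p i)| ≤ ε)
    (hA : ∀ x ∈ Icc a b, A ≤ |g k x|) (hKA : ∀ x ∈ Icc a b, |g k x| ≤ K * A) (hK : 0 ≤ K)
    (hw : b - a ≤ w) (hdw : d ≤ 2 * w) :
    ∀ x ∈ Icc a b, |g 0 x| ≤ (K + k) * (2 * w / d) ^ k * ε := by
  have hε0 : 0 ≤ ε := (abs_nonneg _).trans (hε 0 (by positivity))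
  have hDw : 1 ≤ w * (2 / d) := by
    rw [mul_div_assoc', le_div_iff₀ hd]; linarith
  have hw0 : 0 < w := by linarith
  have hz : ∀ j ≤ k, ∃ z ∈ Icc a b, |g j z| ≤ (2 / d) ^ j * ε := fun j hj => by
    have h2 : 2 ^ j ≤ 2 ^ k := Nat.pow_le_pow_right (by norm_num) hj
    exact exists_abs_deriv_le_of_separated hd j g hg p (fun i hi => hp i (hi.trans_le h2))
      (fun i hi => hgap i (hi.trans_le h2)) (fun i hi => hε i (hi.trans_le h2))
  have main : ∀ i ≤ k, ∀ x ∈ Icc a b, |g (k - i) x| ≤ (K + i) * (2 / d) ^ k * w ^ i * ε := by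
    intro i
    induction i with
    | zero =>
      intro _ x hx
      obtain ⟨z, hz1, hz2⟩ := hz k le_rfl
      have := (hA z hz1).trans hz2
      calc |g (k - 0) x| ≤ K * A := hKA x hx
        _ ≤ K * ((2 / d) ^ k * ε) := by gcongr
        _ = _ := by simp; ring
    | succ i ih =>
      intro hi x hx
      obtain ⟨z, hz1, hz2⟩ := hz (k - (i + 1)) (by omega)
      have e : k - i = k - (i + 1) + 1 := by omega
      have hmv := Convex.norm_image_sub_le_of_norm_hasDerivWithin_le (𝕜 := ℝ)
        (f := g (k - (i + 1))) (f' := g (k - i)) (s := Icc a b)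
        (C := (K + i) * (2 / d) ^ k * w ^ i * ε) (x := z) (y := x)
        (fun y hy => by rw [e]; exact (hg _ y hy).hasDerivWithinAt)
        (fun y hy => ih (by omega) y hy) (convex_Icc a b) hz1 hx
      have hxz : |x - z| ≤ w := by
        rw [abs_le]; constructor <;> linarith [hx.1, hx.2, hz1.1, hz1.2]
      have h1 : |g (k - (i + 1)) x| ≤ |g (k - (i + 1)) z| +
          (K + i) * (2 / d) ^ k * w ^ i * ε * w := by
        have := abs_sub_abs_le_abs_sub (g (k - (i + 1)) x) (g (k - (i + 1)) z)
        have h3 : (K + i) * (2 / d) ^ k * w ^ i * ε * |x - z| ≤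
          (K + i) * (2 / d) ^ k * w ^ i * ε * w := by gcongr
        simp only [Real.norm_eq_abs] at hmv
        linarith
      have h2 : (2 / d) ^ (k - (i + 1)) ≤ (2 / d) ^ k * w ^ (i + 1) := by
        have : (2 / d) ^ k = (2 / d) ^ (k - (i + 1)) * (2 / d) ^ (i + 1) := by
          rw [← pow_add]; congr 1; omega
        rw [this, mul_assoc, ← mul_pow, mul_comm (2 / d) w]
        exact le_mul_of_one_le_right (by positivity) (one_le_pow₀ hDw)
      calc |g (k - (i + 1)) x| ≤ (2 / d) ^ (k - (i + 1)) * ε +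
            (K + i) * (2 / d) ^ k * w ^ i * ε * w := by linarith
        _ ≤ (2 / d) ^ k * w ^ (i + 1) * ε + (K + i) * (2 / d) ^ k * w ^ i * ε * w := by gcongr
        _ = _ := by push_cast; ring
  intro x hx
  have := main k le_rfl x hx
  rw [Nat.sub_self] at this
  refine this.trans_eq ?_
  rw [div_pow, div_pow, mul_pow]
  ring

theorem le_of_abs_deriv_ge {y ρ ε A : ℝ} (hρ : 0 < ρ) {k : ℕ} {g : ℕ → ℝ → ℝ}
    (hg : ∀ j, ∀ x ∈ Metric.closedBall y ρ, HasDerivAt (g j) (g (j + 1) x) x)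
    (hε : ∀ x ∈ Metric.closedBall y ρ, |g 0 x| ≤ ε)
    (hA : ∀ x ∈ Metric.closedBall y ρ, A ≤ |g k x|) :
    A * (ρ / 2 ^ k) ^ k ≤ ε := by
  rw [Real.closedBall_eq_Icc] at *
  have hd : 0 < 2 * ρ / 2 ^ k := by positivity
  have hmem : ∀ i : ℕ, i < 2 ^ k → y - ρ + i * (2 * ρ / 2 ^ k) ∈ Icc (y - ρ) (y + ρ) := by
    intro i hi
    have h1 : (i : ℝ) ≤ 2 ^ k := by exact_mod_cast hi.le
    have h2 : (i : ℝ) * (2 * ρ / 2 ^ k) ≤ 2 ^ k * (2 * ρ / 2 ^ k) := by gcongr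
    have h3 : (2 : ℝ) ^ k * (2 * ρ / 2 ^ k) = 2 * ρ := by field_simp
    constructor
    · have : 0 ≤ (i : ℝ) * (2 * ρ / 2 ^ k) := by positivity
      linarith
    · linarith
  obtain ⟨z, hz, hzk⟩ := exists_abs_deriv_le_of_separated (ε := ε) hd k g hg
    (fun i : ℕ => y - ρ + i * (2 * ρ / 2 ^ k)) hmem
    (fun i hi => by push_cast; linarith) (fun i hi => hε _ (hmem i hi))
  have h := (hA z hz).trans hzk
  have h1 : (2 / (2 * ρ / 2 ^ k)) ^ k * (ρ / 2 ^ k) ^ k = 1 := by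
    rw [← mul_pow, show 2 / (2 * ρ / 2 ^ k) * (ρ / 2 ^ k) = 1 by field_simp, one_pow]
  calc A * (ρ / 2 ^ k) ^ k ≤ (2 / (2 * ρ / 2 ^ k)) ^ k * ε * (ρ / 2 ^ k) ^ k := by gcongr
    _ = ε * ((2 / (2 * ρ / 2 ^ k)) ^ k * (ρ / 2 ^ k) ^ k) := by ring
    _ = ε := by rw [h1, mul_one]

/-! ### Separated subsets -/

theorem exists_separated_or_cover (Z : Set ℝ) {d : ℝ} (hd : 0 < d) (N : ℕ) :
    (∃ F : Finset ℝ, (F : Set ℝ) ⊆ Z ∧ F.card = N ∧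
      (F : Set ℝ).Pairwise fun x y => d < |x - y|) ∨
    ∃ F : Finset ℝ, (F : Set ℝ) ⊆ Z ∧ F.card < N ∧
      ((F : Set ℝ).Pairwise fun x y => d < |x - y|) ∧ ∀ z ∈ Z, ∃ x ∈ F, |z - x| ≤ d := by
  induction N with
  | zero => exact Or.inl ⟨∅, by simp⟩
  | succ N ih =>
    rcases ih with ⟨F, hF, hc, hs⟩ | ⟨F, hF, hc, hs, hcov⟩
    · by_cases h : ∀ z ∈ Z, ∃ x ∈ F, |z - x| ≤ d
      · exact Or.inr ⟨F, hF, by omega, hs, h⟩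
      · push Not at h
        obtain ⟨z, hz, hzF⟩ := h
        have hzn : z ∉ F := fun h => by simpa [hd.not_gt] using hzF z h
        refine Or.inl ⟨insert z F, ?_, by rw [Finset.card_insert_of_notMem hzn, hc], ?_⟩
        · rw [Finset.coe_insert]; exact insert_subset hz hF
        · rw [Finset.coe_insert, Set.pairwise_insert]
          exact ⟨hs, fun x hx _ => ⟨hzF x hx, by rw [abs_sub_comm]; exact hzF x hx⟩⟩
    · exact Or.inr ⟨F, hF, by omega, hs, hcov⟩

theorem exists_seq_of_separated {F : Finset ℝ} {d : ℝ}
    (hs : (F : Set ℝ).Pairwise fun x y => d < |x - y|) :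
    ∃ p : ℕ → ℝ, (∀ i < F.card, p i ∈ F) ∧ ∀ i, i + 1 < F.card → p i + d ≤ p (i + 1) := by
  refine ⟨fun i => if h : i < F.card then F.orderEmbOfFin rfl ⟨i, h⟩ else 0, ?_, ?_⟩
  · intro i hi
    simp only [hi, dif_pos]
    exact F.orderEmbOfFin_mem rfl _
  · intro i hi
    have hi' : i < F.card := by omega
    simp only [hi, hi', dif_pos]
    have hlt : F.orderEmbOfFin rfl ⟨i, hi'⟩ < F.orderEmbOfFin rfl ⟨i + 1, hi⟩ :=
      (F.orderEmbOfFin rfl).strictMono (by simp)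
    have := hs (F.orderEmbOfFin_mem rfl ⟨i + 1, hi⟩) (F.orderEmbOfFin_mem rfl ⟨i, hi'⟩) hlt.ne'
    simp only at this
    rw [abs_of_pos (by linarith)] at this
    linarith

/-! ### Finite families of analytic functions -/

/-- The `j`-th derivative of the linear combination `∑ c e • G e`. -/
noncomputable def derivComb {E : Type*} [Fintype E] (G : E → ℝ → ℝ) (c : E → ℝ) (j : ℕ)
    (x : ℝ) : ℝ := ∑ e, c e * deriv^[j] (G e) x

section derivComb
variable {E : Type*} [Fintype E] {G : E → ℝ → ℝ} {U : Set ℝ}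

theorem hasDerivAt_derivComb (hG : ∀ e, AnalyticOnNhd ℝ (G e) U) (c : E → ℝ) (j : ℕ) {x : ℝ}
    (hx : x ∈ U) : HasDerivAt (derivComb G c j) (derivComb G c (j + 1) x) x := by
  unfold derivComb
  refine HasDerivAt.fun_sum fun e _ => ?_
  rw [Function.iterate_succ_apply']
  exact (((hG e).iterated_deriv j) x hx).differentiableAt.hasDerivAt.const_mul _

theorem derivComb_add (c c' : E → ℝ) (j : ℕ) (x : ℝ) :
    derivComb G (c + c') j x = derivComb G c j x + derivComb G c' j x := by
  simp [derivComb, add_mul, Finset.sum_add_distrib]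

theorem derivComb_smul (a : ℝ) (c : E → ℝ) (j : ℕ) (x : ℝ) :
    derivComb G (a • c) j x = a * derivComb G c j x := by
  simp [derivComb, Finset.mul_sum, mul_assoc]

theorem derivComb_eq_zero (hG : ∀ e, AnalyticOnNhd ℝ (G e) U) (hU : IsOpen U) {c : E → ℝ}
    (h : ∀ x ∈ U, derivComb G c 0 x = 0) (j : ℕ) : ∀ x ∈ U, derivComb G c j x = 0 := by
  induction j with
  | zero => exact h
  | succ j ih =>
    intro x hx
    refine (hasDerivAt_derivComb hG c j hx).unique ?_
    exact (hasDerivAt_const x (0 : ℝ)).congr_of_eventuallyEq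
      (Filter.eventuallyEq_of_mem (hU.mem_nhds hx) ih)

theorem iterate_deriv_derivComb (hG : ∀ e, AnalyticOnNhd ℝ (G e) U) (hU : IsOpen U) (c : E → ℝ)
    (j : ℕ) : ∀ x ∈ U, deriv^[j] (derivComb G c 0) x = derivComb G c j x := by
  induction j with
  | zero => intro x _; rfl
  | succ j ih =>
    intro x hx
    rw [Function.iterate_succ_apply']
    rw [Filter.EventuallyEq.deriv_eq (Filter.eventuallyEq_of_mem (hU.mem_nhds hx) ih)]
    exact (hasDerivAt_derivComb hG c j hx).deriv

theorem exists_derivComb_ne_zero (hG : ∀ e, AnalyticOnNhd ℝ (G e) U) (hU : IsOpen U)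
    (hUc : IsPreconnected U) {x₀ : ℝ} (hx₀ : x₀ ∈ U) {c : E → ℝ}
    (h : ∃ x ∈ U, derivComb G c 0 x ≠ 0) : ∃ j, derivComb G c j x₀ ≠ 0 := by
  by_contra! hcon
  obtain ⟨x, hx, hne⟩ := h
  have han : AnalyticOnNhd ℝ (derivComb G c 0) U := by
    intro y hy
    unfold derivComb
    refine Finset.analyticAt_fun_sum _ fun e _ => ?_
    exact analyticAt_const.mul (hG e y hy)
  have htop : analyticOrderAt (derivComb G c 0) x₀ = ⊤ := by
    refine ENat.eq_top_iff_forall_ge.2 fun n => ?_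
    rw [natCast_le_analyticOrderAt_iff_iteratedDeriv_eq_zero (han x₀ hx₀)]
    intro i _
    rw [iteratedDeriv_eq_iterate, iterate_deriv_derivComb hG hU c i x₀ hx₀, hcon]
  have := han.eqOn_zero_of_preconnected_of_eventuallyEq_zero hUc hx₀
    (analyticOrderAt_eq_top.1 htop)
  exact hne (this hx)

theorem exists_derivComb_bounds (hG : ∀ e, AnalyticOnNhd ℝ (G e) U) (hU : IsOpen U)
    (hUc : IsPreconnected U) {x₀ : ℝ} (hx₀ : x₀ ∈ U) (N : Submodule ℝ (E → ℝ))
    (hN : ∀ c ∈ N, (∀ x ∈ U, derivComb G c 0 x = 0) → c = 0) :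
    ∃ (m : ℕ) (δ c₀ C₀ : ℝ), 0 < δ ∧ 0 < c₀ ∧ Metric.closedBall x₀ δ ⊆ U ∧
      ∀ c ∈ N, ∃ j ≤ m, ∀ x ∈ Metric.closedBall x₀ δ,
        c₀ * ‖c‖ ≤ |derivComb G c j x| ∧ |derivComb G c j x| ≤ C₀ * ‖c‖ := by
  have hK : IsCompact (Metric.sphere (0 : E → ℝ) 1 ∩ N) :=
    (isCompact_sphere _ _).inter_right N.closed_of_finiteDimensional
  have hcont : ∀ j x, Continuous fun c : E → ℝ => derivComb G c j x := by
    intro j x; unfold derivComb; fun_prop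
  obtain ⟨m, hm⟩ := hK.elim_directed_cover
    (fun m : ℕ => {c : E → ℝ | ∃ j ≤ m, 1 / ((m : ℝ) + 1) < |derivComb G c j x₀|})
    (by
      intro m
      have : {c : E → ℝ | ∃ j ≤ m, 1 / ((m : ℝ) + 1) < |derivComb G c j x₀|} =
          ⋃ j ≤ m, {c : E → ℝ | 1 / ((m : ℝ) + 1) < |derivComb G c j x₀|} := by
        ext; simp
      rw [this]
      exact isOpen_iUnion fun j => isOpen_iUnion fun _ =>
        isOpen_lt continuous_const (hcont j x₀).abs)
    (by
      rintro c ⟨hc1, hcN⟩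
      have hc0 : c ≠ 0 := by rintro rfl; simp at hc1
      have : ∃ x ∈ U, derivComb G c 0 x ≠ 0 := by
        by_contra! h; exact hc0 (hN c hcN h)
      obtain ⟨j, hj⟩ := exists_derivComb_ne_zero hG hU hUc hx₀ this
      obtain ⟨k, hk⟩ := exists_nat_one_div_lt (abs_pos.2 hj)
      refine mem_iUnion.2 ⟨max j k, j, le_max_left _ _, lt_of_le_of_lt ?_ hk⟩
      push_cast
      gcongr
      exact le_max_right _ _)
    (by
      refine directed_of_isDirected_le ?_
      intro a b hab c hc
      obtain ⟨j, hj, hlt⟩ := hc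
      refine ⟨j, hj.trans hab, lt_of_le_of_lt ?_ hlt⟩
      gcongr)
  set η : ℝ := 1 / (2 * ((m : ℝ) + 1) * (Fintype.card E + 1)) with hη
  have hη0 : 0 < η := by positivity
  have hev : ∀ᶠ x in nhds x₀, x ∈ U ∧ ∀ j ∈ Finset.range (m + 1), ∀ e,
      |deriv^[j] (G e) x - deriv^[j] (G e) x₀| < η := by
    have hUx : ∀ᶠ x in nhds x₀, x ∈ U := hU.mem_nhds hx₀
    refine hUx.and ?_
    rw [Filter.eventually_all_finset]
    intro j _
    rw [Filter.eventually_all]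
    intro e
    have : ContinuousAt (deriv^[j] (G e)) x₀ := ((hG e).iterated_deriv j x₀ hx₀).continuousAt
    have := Metric.tendsto_nhds.1 this η hη0
    simpa [Real.dist_eq] using this
  obtain ⟨δ, hδ, hball⟩ := Metric.eventually_nhds_iff_ball.1 hev
  have hsub : Metric.closedBall x₀ (δ / 2) ⊆ Metric.ball x₀ δ :=
    Metric.closedBall_subset_ball (by linarith)
  set B : ℝ := ∑ j ∈ Finset.range (m + 1), ∑ e, (|deriv^[j] (G e) x₀| + η)
  have hsumle : ∀ (c : E → ℝ) (f : E → ℝ), |∑ e, c e * f e| ≤ ‖c‖ * ∑ e, |f e| := by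
    intro c f
    rw [Finset.mul_sum]
    refine (Finset.abs_sum_le_sum_abs _ _).trans (Finset.sum_le_sum fun e _ => ?_)
    rw [abs_mul]
    exact mul_le_mul_of_nonneg_right (norm_le_pi_norm c e) (abs_nonneg _)
  have hunit : ∀ c ∈ Metric.sphere (0 : E → ℝ) 1 ∩ N, ∃ j ≤ m,
      ∀ x ∈ Metric.closedBall x₀ (δ / 2),
        1 / (2 * ((m : ℝ) + 1)) ≤ |derivComb G c j x| ∧ |derivComb G c j x| ≤ B := by
    intro c hc
    obtain ⟨j, hj, hlt⟩ := hm hc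
    have hc1 : ‖c‖ = 1 := by simpa using hc.1
    refine ⟨j, hj, fun x hx => ?_⟩
    have hjr : j ∈ Finset.range (m + 1) := Finset.mem_range.2 (by omega)
    have hclose := (hball x (hsub hx)).2 j hjr
    have hdiff : |derivComb G c j x - derivComb G c j x₀| ≤ 1 / (2 * ((m : ℝ) + 1)) := by
      unfold derivComb
      rw [← Finset.sum_sub_distrib]
      simp_rw [← mul_sub]
      refine (hsumle _ _).trans ?_
      rw [hc1, one_mul]
      calc ∑ e, |deriv^[j] (G e) x - deriv^[j] (G e) x₀| ≤ ∑ e : E, η :=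
            Finset.sum_le_sum fun e _ => (hclose e).le
        _ = Fintype.card E * η := by simp
        _ ≤ (Fintype.card E + 1) * η := by gcongr; linarith
        _ = _ := by rw [hη]; field_simp
    constructor
    · have h1 := abs_sub_abs_le_abs_sub (derivComb G c j x₀) (derivComb G c j x)
      rw [abs_sub_comm] at h1
      have h2 : 1 / ((m : ℝ) + 1) = 2 * (1 / (2 * ((m : ℝ) + 1))) := by field_simp
      linarith
    · refine (hsumle _ _).trans ?_
      rw [hc1, one_mul]
      refine le_trans (Finset.sum_le_sum fun e _ => ?_)
        (Finset.single_le_sum (f := fun j => ∑ e, (|deriv^[j] (G e) x₀| + η))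
          (fun i _ => Finset.sum_nonneg fun e _ => by positivity) hjr)
      have := abs_sub_abs_le_abs_sub (deriv^[j] (G e) x) (deriv^[j] (G e) x₀)
      linarith [hclose e]
  refine ⟨m, δ / 2, 1 / (2 * ((m : ℝ) + 1)), B, by positivity, by positivity,
    fun x hx => (hball x (hsub hx)).1, fun c hc => ?_⟩
  by_cases hc0 : c = 0
  · subst hc0
    exact ⟨0, Nat.zero_le _, fun x _ => by simp [derivComb]⟩
  have hn : 0 < ‖c‖ := norm_pos_iff.2 hc0
  obtain ⟨j, hj, hb⟩ := hunit (‖c‖⁻¹ • c)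
    ⟨by simp [norm_smul, hn.ne'], N.smul_mem _ hc⟩
  refine ⟨j, hj, fun x hx => ?_⟩
  obtain ⟨h1, h2⟩ := hb x hx
  rw [derivComb_smul, abs_mul, abs_inv, abs_of_pos hn, ← div_eq_inv_mul] at h1 h2
  rw [le_div_iff₀ hn] at h1
  rw [div_le_iff₀ hn] at h2
  exact ⟨h1, h2⟩

theorem exists_derivComb_comparable (hG : ∀ e, AnalyticOnNhd ℝ (G e) U) (hU : IsOpen U)
    (hUc : IsPreconnected U) {x₀ : ℝ} (hx₀ : x₀ ∈ U) :
    ∃ (m : ℕ) (δ K : ℝ), 0 < δ ∧ 1 ≤ K ∧ Metric.closedBall x₀ δ ⊆ U ∧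
      ∀ c : E → ℝ, ∃ (A : ℝ) (j : ℕ), j ≤ m ∧ ∀ x ∈ Metric.closedBall x₀ δ,
        A ≤ |derivComb G c j x| ∧ |derivComb G c j x| ≤ K * A := by
  let N₀ : Submodule ℝ (E → ℝ) :=
    { carrier := {c | ∀ x ∈ U, derivComb G c 0 x = 0}
      add_mem' := fun {a b} ha hb x hx => by rw [derivComb_add, ha x hx, hb x hx, add_zero]
      zero_mem' := fun x _ => by simp [derivComb]
      smul_mem' := fun a c hc x hx => by rw [derivComb_smul, hc x hx, mul_zero] }
  obtain ⟨N, hN⟩ := N₀.exists_isCompl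
  obtain ⟨m, δ, c₀, C₀, hδ, hc₀, hsub, hb⟩ := exists_derivComb_bounds hG hU hUc hx₀ N
    (fun c hc h => (Submodule.disjoint_def.1 hN.disjoint) c h hc)
  refine ⟨m, δ, max 1 (C₀ / c₀), hδ, le_max_left _ _, hsub, fun c => ?_⟩
  obtain ⟨c1, h1, c2, h2, rfl⟩ : ∃ c1 ∈ N₀, ∃ c2 ∈ N, c1 + c2 = c := by
    have : c ∈ N₀ ⊔ N := by rw [hN.sup_eq_top]; trivial
    exact Submodule.mem_sup.1 this
  obtain ⟨j, hj, hjb⟩ := hb c2 h2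
  refine ⟨c₀ * ‖c2‖, j, hj, fun x hx => ?_⟩
  rw [derivComb_add, derivComb_eq_zero hG hU h1 j x (hsub hx), zero_add]
  refine ⟨(hjb x hx).1, (hjb x hx).2.trans ?_⟩
  calc C₀ * ‖c2‖ = C₀ / c₀ * (c₀ * ‖c2‖) := by field_simp
    _ ≤ _ := by gcongr; exact le_max_right _ _

end derivComb

/-! ### Ahlfors regular measures -/

/-- `μ` is carried by the closed set `S` and is Ahlfors regular on closed balls centred in `S`. -/
structure AhlforsOn (μ : Measure ℝ) (S : Set ℝ) (α c C ρ₁ : ℝ) : Prop where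
  α_pos : 0 < α
  c_pos : 0 < c
  C_pos : 0 < C
  ρ₁_pos : 0 < ρ₁
  closed : IsClosed S
  compl : μ Sᶜ = 0
  lower : ∀ x ∈ S, ∀ ρ, 0 < ρ → ρ ≤ ρ₁ → ENNReal.ofReal (c * ρ ^ α) ≤ μ (Metric.closedBall x ρ)
  upper : ∀ x ∈ S, ∀ ρ, 0 < ρ → ρ ≤ ρ₁ → μ (Metric.closedBall x ρ) ≤ ENNReal.ofReal (C * ρ ^ α)

theorem AhlforsOn.measure_inter {μ : Measure ℝ} {S : Set ℝ} {α c C ρ₁ : ℝ}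
    (h : AhlforsOn μ S α c C ρ₁) (Z : Set ℝ) : μ (Z ∩ S) = μ Z :=
  measure_inter_conull h.compl

theorem AhlforsOn.measure_sublevel_le {μ : Measure ℝ} {S : Set ℝ} {α c C ρ₁ : ℝ}
    (h : AhlforsOn μ S α c C ρ₁) {m k : ℕ} (hm : 1 ≤ m) (hk : k ≤ m) {K : ℝ} (hK : 1 ≤ K)
    {g : ℕ → ℝ → ℝ} {y ρ ε A : ℝ} (hy : y ∈ S) (hρ : 0 < ρ) (hρ₁ : 4 * ρ ≤ ρ₁) (hε : 0 < ε)
    (hg : ∀ j, ∀ x ∈ Metric.closedBall y ρ, HasDerivAt (g j) (g (j + 1) x) x)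
    (hA : ∀ x ∈ Metric.closedBall y ρ, A ≤ |g k x| ∧ |g k x| ≤ K * A)
    (hsup : ∃ x ∈ Metric.closedBall y ρ, 1 ≤ |g 0 x|) :
    μ {x ∈ Metric.closedBall y ρ | |g 0 x| < ε} ≤
      ENNReal.ofReal (2 ^ m * C * (4 * (K + m + 1)) ^ α * ε ^ (α / m) * ρ ^ α) := by
  have hα := h.α_pos
  have hC := h.C_pos
  set H : ℝ := 4 * (K + m + 1) with hH
  have hH4 : 4 < H := by rw [hH]; have : (0 : ℝ) ≤ m := by positivity
                         linarith
  have hH0 : 0 < H := by linarith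
  have hm0 : (0 : ℝ) < m := by exact_mod_cast hm
  set η : ℝ := H * ε ^ (1 / (m : ℝ)) with hη
  have hη0 : 0 < η := by positivity
  have hηα : (η * ρ) ^ α = H ^ α * ε ^ (α / m) * ρ ^ α := by
    rw [Real.mul_rpow hη0.le hρ.le, hη, Real.mul_rpow hH0.le (by positivity), ← Real.rpow_mul hε.le]
    congr 3
    ring
  have hηm : η ^ m = H ^ m * ε := by
    rw [hη, mul_pow, ← Real.rpow_natCast (ε ^ (1 / (m : ℝ))), ← Real.rpow_mul hε.le]
    rw [one_div_mul_cancel hm0.ne', Real.rpow_one]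
  have htarget : 2 ^ m * C * H ^ α * ε ^ (α / m) * ρ ^ α = 2 ^ m * (C * (η * ρ) ^ α) := by
    rw [hηα]; ring
  rw [htarget]
  rcases le_or_gt 1 η with hbig | hsmall
  · refine (measure_mono (sep_subset _ _)).trans ((h.upper y hy ρ hρ (by linarith)).trans ?_)
    refine ENNReal.ofReal_le_ofReal ?_
    have h1 : ρ ^ α ≤ (η * ρ) ^ α :=
      Real.rpow_le_rpow hρ.le (le_mul_of_one_le_left hρ.le hbig) hα.le
    calc C * ρ ^ α ≤ 1 * (C * (η * ρ) ^ α) := by rw [one_mul]; gcongr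
      _ ≤ _ := by gcongr; exact one_le_pow₀ (by norm_num)
  · rcases exists_separated_or_cover ({x ∈ Metric.closedBall y ρ | |g 0 x| < ε} ∩ S)
      (mul_pos hη0 hρ) (2 ^ k) with ⟨F, hF, hcard, hs⟩ | ⟨F, hF, hcard, hs, hcov⟩
    · exfalso
      obtain ⟨p, hp, hgap⟩ := exists_seq_of_separated hs
      rw [hcard] at hp hgap
      rw [Real.closedBall_eq_Icc] at *
      obtain ⟨x, hx, hx1⟩ := hsup
      have := abs_le_of_separated (w := 2 * ρ) (ε := ε) (mul_pos hη0 hρ) hg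
        (fun i hi => (hF (hp i hi)).1.1) hgap (fun i hi => (hF (hp i hi)).1.2.le)
        (fun x hx => (hA x hx).1) (fun x hx => (hA x hx).2) (by linarith) (by linarith)
        (by nlinarith) x hx
      have e : 2 * (2 * ρ) / (η * ρ) = 4 / η := by field_simp; ring
      rw [e] at this
      have h1 : (4 / η) ^ k ≤ (4 / η) ^ m :=
        pow_le_pow_right₀ (by rw [le_div_iff₀ hη0]; linarith) hk
      have h2 : (4 / η) ^ m * ε = (4 / H) ^ m := by
        rw [div_pow, hηm, div_pow]; field_simp
      have h3 : (4 / H) ^ m ≤ 4 / H :=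
        pow_le_of_le_one (by positivity) ((div_le_one hH0).2 hH4.le) (by omega)
      have h4 : (K + k) * (4 / η) ^ k * ε ≤ (K + m) * (4 / H) := by
        have hkm : (k : ℝ) ≤ m := by exact_mod_cast hk
        calc (K + k) * (4 / η) ^ k * ε ≤ (K + m) * (4 / η) ^ m * ε := by gcongr
          _ = (K + m) * (4 / H) ^ m := by rw [mul_assoc, h2]
          _ ≤ _ := by gcongr
      have h5 : (K + m) * (4 / H) < 1 := by
        rw [mul_div_assoc', div_lt_one hH0, hH]; linarith
      linarith
    · rw [← h.measure_inter]
      have hsub : {x ∈ Metric.closedBall y ρ | |g 0 x| < ε} ∩ S ⊆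
          ⋃ x ∈ F, Metric.closedBall x (η * ρ) := by
        intro z hz
        obtain ⟨x, hx, hzx⟩ := hcov z hz
        exact mem_biUnion hx (by rwa [Metric.mem_closedBall, Real.dist_eq])
      refine (measure_mono hsub).trans ((measure_biUnion_finset_le _ _).trans ?_)
      have hle : η * ρ ≤ ρ₁ := by nlinarith
      refine (Finset.sum_le_sum fun x hx => h.upper x (hF hx).2 _ (mul_pos hη0 hρ) hle).trans ?_
      rw [Finset.sum_const, nsmul_eq_mul, ENNReal.ofReal_mul (p := 2 ^ m) (by positivity)]
      gcongr
      rw [ENNReal.ofReal_pow (by norm_num), ENNReal.ofReal_ofNat]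
      have : F.card ≤ 2 ^ m := hcard.le.trans (Nat.pow_le_pow_right (by norm_num) hk)
      exact_mod_cast this

/-! ### Quantitative nondivergence over a poset -/

theorem AhlforsOn.exists_covering {μ : Measure ℝ} {S : Set ℝ} {α c C ρ₁ : ℝ}
    (h : AhlforsOn μ S α c C ρ₁) {E : Set ℝ} {y ρ Q : ℝ} (hy : y ∈ S) (hρ : 0 < ρ)
    (hρ₁ : 2 * ρ ≤ ρ₁) (hQ : 0 ≤ Q) (hEy : E ⊆ Metric.closedBall y ρ)
    (hE : ∀ x ∈ E ∩ S, ∃ s, 0 < s ∧ s ≤ ρ ∧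
      μ (E ∩ Metric.closedBall x (5 * s)) ≤ ENNReal.ofReal (Q * s ^ α)) :
    μ E ≤ ENNReal.ofReal (Q * (C / c) * 2 ^ α * ρ ^ α) := by
  have hα := h.α_pos
  have hC := h.C_pos
  have hc := h.c_pos
  choose! s hs0 hsρ hsμ using hE
  obtain ⟨u, hut, hdisj, hcov⟩ := Vitali.exists_disjoint_subfamily_covering_enlargement_closedBall
    (E ∩ S) (fun x => x) s ρ hsρ 5 (by norm_num)
  have hcount : u.Countable := hdisj.countable_of_nonempty_interior fun x hx => by
    refine ⟨x, ?_⟩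
    rw [interior_closedBall _ (hs0 x (hut hx)).ne']
    exact Metric.mem_ball_self (hs0 x (hut hx))
  have hsub : E ∩ S ⊆ ⋃ x ∈ u, E ∩ Metric.closedBall x (5 * s x) := by
    intro x hx
    obtain ⟨b, hb, hxb⟩ := hcov x hx
    exact mem_biUnion hb ⟨hx.1, hxb (Metric.mem_closedBall_self (hs0 x hx).le)⟩
  have key : ∀ x : u, μ (E ∩ Metric.closedBall (x : ℝ) (5 * s x)) ≤
      ENNReal.ofReal (Q / c) * μ (Metric.closedBall (x : ℝ) (s x)) := by
    intro x
    have hx := hut x.2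
    refine (hsμ x hx).trans ?_
    have h1 := h.lower x hx.2 (s x) (hs0 x hx) (by linarith [hsρ x hx])
    refine le_trans ?_ (mul_le_mul' le_rfl h1)
    rw [← ENNReal.ofReal_mul (by positivity)]
    refine ENNReal.ofReal_le_ofReal (le_of_eq ?_)
    field_simp
  calc μ E = μ (E ∩ S) := (h.measure_inter E).symm
    _ ≤ μ (⋃ x ∈ u, E ∩ Metric.closedBall x (5 * s x)) := measure_mono hsub
    _ ≤ ∑' x : u, μ (E ∩ Metric.closedBall (x : ℝ) (5 * s x)) := measure_biUnion_le μ hcount _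
    _ ≤ ∑' x : u, ENNReal.ofReal (Q / c) * μ (Metric.closedBall (x : ℝ) (s x)) :=
        ENNReal.tsum_le_tsum key
    _ = ENNReal.ofReal (Q / c) * μ (⋃ x ∈ u, Metric.closedBall x (s x)) := by
        rw [ENNReal.tsum_mul_left, measure_biUnion hcount hdisj
          fun _ _ => Metric.isClosed_closedBall.measurableSet]
    _ ≤ ENNReal.ofReal (Q / c) * μ (Metric.closedBall y (2 * ρ)) := by
        gcongr
        refine iUnion₂_subset fun x hx => Metric.closedBall_subset_closedBall' ?_
        have h1 := hsρ x (hut hx)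
        have h2 : dist x y ≤ ρ := hEy (hut hx).1
        linarith
    _ ≤ ENNReal.ofReal (Q / c) * ENNReal.ofReal (C * (2 * ρ) ^ α) := by
        gcongr; exact h.upper y hy _ (by linarith) hρ₁
    _ = _ := by
        rw [← ENNReal.ofReal_mul (by positivity), Real.mul_rpow (by norm_num) hρ.le]
        congr 1
        field_simp

section Nondivergence

variable {P : Type*} [PartialOrder P]

/-- `V` lies outside the chain `T` and is comparable with all its members. -/
def Addable (T : Finset P) (V : P) : Prop := V ∉ T ∧ ∀ W ∈ T, V ≤ W ∨ W ≤ V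

/-- The point `x` is marked by a chain extending `T`. -/
def Marked (ψ : P → ℝ → ℝ) (ε : ℝ) (T : Finset P) (x : ℝ) : Prop :=
  ∃ T' : Finset P, T ⊆ T' ∧ IsChain (· ≤ ·) (T' : Set P) ∧
    (∀ V ∈ T', V ∉ T → ε ≤ ψ V x ∧ ψ V x < 1) ∧ ∀ V, Addable T' V → 1 ≤ ψ V x

theorem Addable.isChain_insert [DecidableEq P] {T : Finset P} {V : P} (h : Addable T V)
    (hT : IsChain (· ≤ ·) (T : Set P)) : IsChain (· ≤ ·) ((insert V T : Finset P) : Set P) := by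
  rw [Finset.coe_insert]
  exact hT.insert fun W hW _ => h.2 W hW

theorem card_le_of_isChain {rk : P → ℕ} (hrk : StrictMono rk) {k : ℕ}
    (hk : ∀ V, 1 ≤ rk V ∧ rk V ≤ k) {T : Finset P} (hT : IsChain (· ≤ ·) (T : Set P)) :
    T.card ≤ k := by
  have : T.card ≤ (Finset.Icc 1 k).card := by
    refine Finset.card_le_card_of_injOn rk (fun V _ => by simpa using hk V) ?_
    intro V hV W hW hVW
    by_contra hne
    rcases hT hV hW hne with h | h
    · exact (hrk (lt_of_le_of_ne h hne)).ne hVW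
    · exact (hrk (lt_of_le_of_ne h (Ne.symm hne))).ne' hVW
  simpa using this

/-- The constant in `measure_not_marked_le`. -/
noncomputable def nondivConst (α c C : ℝ) : ℕ → ℝ
  | 0 => 0
  | m + 1 => (1 + nondivConst α c C m) * 10 ^ α * (C / c) * 2 ^ α

theorem nondivConst_nonneg {α c C : ℝ} (hc : 0 < c) (hC : 0 < C) (m : ℕ) :
    0 ≤ nondivConst α c C m := by
  induction m with
  | zero => exact le_rfl
  | succ m ih => unfold nondivConst; positivity

theorem AhlforsOn.measure_not_marked_le [DecidableEq P] {μ : Measure ℝ} {S : Set ℝ}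
    {α c C ρ₁ : ℝ} (h : AhlforsOn μ S α c C ρ₁) {rk : P → ℕ} (hrk : StrictMono rk) {k : ℕ}
    (hk : ∀ V, 1 ≤ rk V ∧ rk V ≤ k) {ψ : P → ℝ → ℝ} {I₀ : Set ℝ}
    (hψ : ∀ V, ContinuousOn (ψ V) I₀) {ε G : ℝ} (hG : 0 ≤ G)
    (hgood : ∀ V, ∀ y ∈ S, ∀ ρ, 0 < ρ → ρ ≤ ρ₁ → Metric.closedBall y ρ ⊆ I₀ →
      (∃ x ∈ Metric.closedBall y ρ, 1 ≤ ψ V x) →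
      μ {x ∈ Metric.closedBall y ρ | ψ V x < ε} ≤ ENNReal.ofReal (G * ρ ^ α)) (m : ℕ) :
    ∀ T : Finset P, IsChain (· ≤ ·) (T : Set P) → k ≤ m + T.card → ∀ y ∈ S, ∀ ρ, 0 < ρ →
      5 ^ m * ρ ≤ ρ₁ → Metric.closedBall y (5 ^ m * ρ) ⊆ I₀ →
      (∀ V, Addable T V → ∃ x ∈ Metric.closedBall y ρ, 1 ≤ ψ V x) →
      μ {x ∈ Metric.closedBall y ρ | ¬ Marked ψ ε T x} ≤
        ENNReal.ofReal (nondivConst α c C m * G * ρ ^ α) := by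
  induction m with
  | zero =>
    intro T hT hcard y _ ρ _ _ _ _
    have : {x ∈ Metric.closedBall y ρ | ¬ Marked ψ ε T x} = ∅ := by
      refine eq_empty_of_forall_notMem fun x hx => hx.2 ⟨T, Subset.rfl, hT, ?_, ?_⟩
      · exact fun V hV hV' => absurd hV hV'
      · intro V hV
        have := card_le_of_isChain hrk hk (hV.isChain_insert hT)
        rw [Finset.card_insert_of_notMem hV.1] at this
        omega
    rw [this, measure_empty]
    exact zero_le
  | succ m ih =>
    intro T hT hcard y hy ρ hρ hρ₁ hI hsup
    have hα := h.α_pos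
    have hc := h.c_pos
    have hC := h.C_pos
    have hKm := nondivConst_nonneg (α := α) hc hC m
    have h5 : (1 : ℝ) ≤ 5 ^ m := one_le_pow₀ (by norm_num)
    have hpow : (5 : ℝ) ^ (m + 1) = 5 * 5 ^ m := by ring
    have h5ρ : ρ ≤ 5 ^ m * ρ := le_mul_of_one_le_left hρ.le h5
    rw [hpow] at hρ₁ hI
    have hQ : nondivConst α c C (m + 1) * G * ρ ^ α =
        ((1 + nondivConst α c C m) * 10 ^ α * G) * (C / c) * 2 ^ α * ρ ^ α := by
      rw [nondivConst]; ring
    rw [hQ]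
    refine h.exists_covering hy hρ (by linarith) (by positivity) (sep_subset _ _) ?_
    rintro x ⟨⟨hxy, hxm⟩, hxS⟩
    have hxy' : |x - y| ≤ ρ := by rwa [Metric.mem_closedBall, Real.dist_eq] at hxy
    let R : Set ℝ := {s | 0 < s ∧ ∃ V, Addable T V ∧ ∀ z ∈ Metric.closedBall x (5 * s), ψ V z < 1}
    have hRne : R.Nonempty := by
      have : ∃ V, Addable T V ∧ ψ V x < 1 := by
        by_contra! hcon
        exact hxm ⟨T, Subset.rfl, hT, fun V hV hV' => absurd hV hV', hcon⟩
      obtain ⟨V, hV, hlt⟩ := this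
      have hxI : I₀ ∈ nhds x := by
        refine Filter.mem_of_superset (Metric.ball_mem_nhds x hρ) (Subset.trans ?_ hI)
        intro z hz
        have : dist z y ≤ dist z x + dist x y := dist_triangle _ _ _
        have h1 : dist z x < ρ := hz
        have h2 : dist x y ≤ ρ := hxy
        rw [Metric.mem_closedBall]; linarith
      have hcx : ContinuousAt (ψ V) x := (hψ V).continuousAt hxI
      have hev : ∀ᶠ z in nhds x, ψ V z < 1 := hcx.eventually (gt_mem_nhds hlt)
      obtain ⟨δ, hδ, hb⟩ := Metric.eventually_nhds_iff_ball.1 hev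
      refine ⟨δ / 10, by positivity, V, hV, fun z hz => hb z ?_⟩
      exact Metric.closedBall_subset_ball (by linarith) hz
    have hRle : ∀ s ∈ R, 5 * s < 2 * ρ := by
      rintro s ⟨hs, V, hV, hlt⟩
      by_contra! hcon
      obtain ⟨z, hz, hz1⟩ := hsup V hV
      refine absurd hz1 (not_le.2 (hlt z ?_))
      have : dist z x ≤ dist z y + dist y x := dist_triangle _ _ _
      have h1 : dist z y ≤ ρ := hz
      have h2 : dist y x ≤ ρ := by rw [dist_comm]; exact hxy
      rw [Metric.mem_closedBall]; linarith
    have hbdd : BddAbove R := ⟨ρ, fun s hs => by have := hRle s hs; linarith⟩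
    obtain ⟨s₀, hs₀⟩ := hRne
    have hsSup : 0 < sSup R := hs₀.1.trans_le (le_csSup hbdd hs₀)
    obtain ⟨s, hsR, hs⟩ := exists_lt_of_lt_csSup ⟨s₀, hs₀⟩ (half_lt_self hsSup)
    have hs_double : 2 * s ∉ R := fun hmem => by linarith [le_csSup hbdd hmem]
    have hsle := hRle s hsR
    obtain ⟨hs0, V, hV, hVlt⟩ := hsR
    have hup : ∀ W, Addable T W → ∃ z ∈ Metric.closedBall x (10 * s), 1 ≤ ψ W z := by
      intro W hW
      by_contra! hcon
      refine hs_double ⟨by linarith, W, hW, fun z hz => hcon z ?_⟩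
      rwa [show 5 * (2 * s) = 10 * s by ring] at hz
    refine ⟨s, hs0, by linarith, ?_⟩
    have h10 : 5 ^ m * (10 * s) ≤ 4 * (5 ^ m * ρ) := by nlinarith
    have hbig : Metric.closedBall x (5 ^ m * (10 * s)) ⊆ I₀ := by
      refine Subset.trans (Metric.closedBall_subset_closedBall' ?_) hI
      have h2 : dist x y ≤ ρ := hxy
      linarith
    have h10' : 10 * s ≤ 5 ^ m * (10 * s) := le_mul_of_one_le_left (by positivity) h5
    have hsub : {x ∈ Metric.closedBall y ρ | ¬ Marked ψ ε T x} ∩ Metric.closedBall x (5 * s) ⊆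
        {z ∈ Metric.closedBall x (10 * s) | ¬ Marked ψ ε (insert V T) z} ∪
          {z ∈ Metric.closedBall x (10 * s) | ψ V z < ε} := by
      rintro z ⟨⟨_, hzm⟩, hzx⟩
      have hz10 : z ∈ Metric.closedBall x (10 * s) :=
        Metric.closedBall_subset_closedBall (by linarith) hzx
      by_cases hzε : ψ V z < ε
      · exact Or.inr ⟨hz10, hzε⟩
      refine Or.inl ⟨hz10, fun hmk => hzm ?_⟩
      obtain ⟨T', hTT', hT', hT'1, hT'2⟩ := hmk
      refine ⟨T', (Finset.subset_insert _ _).trans hTT', hT', fun W hW hWT => ?_, hT'2⟩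
      by_cases hWV : W = V
      · subst hWV; exact ⟨not_lt.1 hzε, hVlt z hzx⟩
      · exact hT'1 W hW (by simp [hWV, hWT])
    refine (measure_mono hsub).trans ((measure_union_le _ _).trans ?_)
    have e1 := ih (insert V T) (hV.isChain_insert hT)
      (by rw [Finset.card_insert_of_notMem hV.1]; omega) x hxS (10 * s) (by linarith)
      (by linarith) hbig
      (fun W hW => hup W ⟨fun hWT => hW.1 (Finset.mem_insert_of_mem hWT),
        fun W' hW' => hW.2 W' (Finset.mem_insert_of_mem hW')⟩)
    have e2 := hgood V x hxS (10 * s) (by linarith) (by linarith)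
      ((Metric.closedBall_subset_closedBall h10').trans hbig) (hup V hV)
    refine (add_le_add e1 e2).trans_eq ?_
    rw [← ENNReal.ofReal_add (by positivity) (by positivity),
      Real.mul_rpow (by norm_num) hs0.le]
    congr 1
    ring

end Nondivergence

/-! ### Minors of rectangular matrices -/

section Minors

variable {ι : Type*} {j : ℕ} {R : Type*} [CommRing R]

/-- The `j × j` minor of `W` with rows `f`. -/
def mnr (W : Matrix ι (Fin j) R) (f : Fin j → ι) : R := (W.submatrix f id).det

theorem mnr_row_congr {W W' : Matrix ι (Fin j) R} {f f' : Fin j → ι}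
    (h : ∀ a, W (f a) = W' (f' a)) : mnr W f = mnr W' f' := by
  unfold mnr
  congr 1
  ext a b
  exact congrFun (h a) b

theorem mnr_update_row (W : Matrix ι (Fin j) R) (f : Fin j → ι) (a : Fin j) (o : ι) :
    mnr W (Function.update f a o) = ((W.submatrix f id).updateRow a (W o)).det := by
  unfold mnr
  congr 1
  ext a' b
  rw [Matrix.updateRow_apply]
  by_cases h : a' = a
  · subst h; simp
  · simp [h]

theorem mnr_eq_zero_of_not_injective (W : Matrix ι (Fin j) R) {f : Fin j → ι}
    (hf : ¬ Function.Injective f) : mnr W f = 0 := by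
  rw [Function.Injective] at hf
  push Not at hf
  obtain ⟨a, b, hab, hne⟩ := hf
  exact Matrix.det_zero_of_row_eq hne (by ext c; simp [hab])

theorem det_updateRow_finset_sum {n κ : Type*} [Fintype n] [DecidableEq n] (A : Matrix n n R)
    (a : n) (s : Finset κ) (c : κ → R) (w : κ → n → R) :
    (A.updateRow a (∑ o ∈ s, c o • w o)).det = ∑ o ∈ s, c o * (A.updateRow a (w o)).det := by
  have h := (Matrix.detRowAlternating : (n → R) [⋀^n]→ₗ[R] R).toMultilinearMap.map_update_sum s a
    (fun o => c o • w o) A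
  refine h.trans (Finset.sum_congr rfl fun o _ => ?_)
  exact Matrix.det_updateRow_smul A a (c o) (w o)

theorem mnr_update_of_row_eq_sum [Fintype ι] {W N : Matrix ι (Fin j) R} {f : Fin j → ι}
    {a : Fin j} {o : ι} {c : ι → R} (ho : W o = ∑ p, c p • N p) (hf : ∀ b ≠ a, W (f b) = N (f b)) :
    mnr W (Function.update f a o) = ∑ p, c p * mnr N (Function.update f a p) := by
  rw [mnr_update_row, ho]
  simp_rw [mnr_update_row]
  refine Eq.trans ?_ (det_updateRow_finset_sum (N.submatrix f id) a Finset.univ c fun p => N p)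
  congr 1
  ext b d
  rw [Matrix.updateRow_apply, Matrix.updateRow_apply]
  split_ifs with h
  · rfl
  · exact congrFun (hf b h) d

/-- Plücker relation. -/
theorem mnr_mul_mnr (W : Matrix ι (Fin j) R) (f g : Fin j → ι) (a₀ : Fin j) :
    mnr W f * mnr W g =
      ∑ a, mnr W (Function.update g a (f a₀)) * mnr W (Function.update f a₀ (g a)) := by
  have hcr := Matrix.mulVec_cramer (W.submatrix g id).transpose (W (f a₀))
  have hrow : (W.submatrix g id).det • W (f a₀) =
      ∑ a, mnr W (Function.update g a (f a₀)) • W (g a) := by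
    rw [← Matrix.det_transpose, ← hcr]
    ext b
    simp only [Matrix.mulVec, dotProduct, Finset.sum_apply, Pi.smul_apply, smul_eq_mul]
    refine Finset.sum_congr rfl fun a _ => ?_
    rw [Matrix.cramer_transpose_apply, mnr_update_row, mul_comm]
    rfl
  have h1 : ((W.submatrix f id).updateRow a₀ ((W.submatrix g id).det • W (f a₀))).det =
      mnr W f * mnr W g := by
    rw [Matrix.det_updateRow_smul, ← mnr_update_row, Function.update_eq_self, mul_comm]
    rfl
  rw [← h1, hrow, det_updateRow_finset_sum]
  simp_rw [mnr_update_row]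

theorem mnr_mul [Fintype ι] (M : Matrix ι ι R) (N : Matrix ι (Fin j) R) (f : Fin j → ι) :
    mnr (M * N) f = ∑ h : Fin j → ι, (∏ a, M (f a) (h a)) * mnr N h := by
  have h1 : mnr (M * N) f =
      (Matrix.detRowAlternating : (Fin j → R) [⋀^Fin j]→ₗ[R] R).toMultilinearMap
      (fun a => ∑ o, M (f a) o • N o) := by
    unfold mnr
    change _ = Matrix.det _
    congr 1
    ext a b
    simp [Matrix.mul_apply, Finset.sum_apply]
  classical
  rw [h1, MultilinearMap.map_sum]
  refine Finset.sum_congr rfl fun h _ => ?_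
  rw [MultilinearMap.map_smul_univ, smul_eq_mul]
  rfl

theorem mnr_mul_right (N : Matrix ι (Fin j) R) (G : Matrix (Fin j) (Fin j) R)
    (f : Fin j → ι) : mnr (N * G) f = mnr N f * G.det := by
  unfold mnr
  rw [← Matrix.det_mul]
  congr 1

theorem mnr_diagonal_mul [Fintype ι] [DecidableEq ι] (d : ι → R) (N : Matrix ι (Fin j) R)
    (f : Fin j → ι) : mnr (Matrix.diagonal d * N) f = (∏ a, d (f a)) * mnr N f := by
  unfold mnr
  rw [← Matrix.det_mul_column]
  congr 1
  ext a b
  simp [Matrix.diagonal_mul]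

theorem exists_mnr_mul_ne_zero [Fintype ι] [DecidableEq ι] {M : Matrix ι ι R} (hM : IsUnit M.det)
    {N : Matrix ι (Fin j) R} (h : ∃ f, mnr N f ≠ 0) : ∃ f, mnr (M * N) f ≠ 0 := by
  by_contra! hcon
  obtain ⟨f, hf⟩ := h
  refine hf ?_
  rw [← Matrix.one_mul N, ← Matrix.nonsing_inv_mul M hM, Matrix.mul_assoc, mnr_mul]
  simp [hcon]

end Minors

theorem abs_mnr_mul_le {ι : Type*} {j : ℕ} (W : Matrix ι (Fin j) ℝ) (f g : Fin j → ι)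
    (a₀ : Fin j) : |mnr W f| * |mnr W g| ≤
      ∑ a, |mnr W (Function.update g a (f a₀))| * |mnr W (Function.update f a₀ (g a))| := by
  rw [← abs_mul, mnr_mul_mnr W f g a₀]
  refine (Finset.abs_sum_le_sum_abs _ _).trans_eq ?_
  simp_rw [abs_mul]

/-! ### Integer points -/

theorem exists_int_mulVec_lt_of_det_lt {j : ℕ} (Y : Matrix (Fin j) (Fin j) ℝ)
    (hY : Y.det ≠ 0) {δ : ℝ} (hδ : 0 < δ) (h : |Y.det| < δ ^ j) :
    ∃ c : Fin j → ℤ, c ≠ 0 ∧ ∀ a, |(Y.mulVec fun b => (c b : ℝ)) a| < δ := by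
  let b := Pi.basisFun ℝ (Fin j)
  let f := Matrix.toLin' Y
  have hdet : LinearMap.det f = Y.det := LinearMap.det_toLin' Y
  have hvol : volume (ZSpan.fundamentalDomain b) * 2 ^ Module.finrank ℝ (Fin j → ℝ) <
      volume (f ⁻¹' Metric.ball 0 δ) := by
    rw [Measure.addHaar_preimage_linearMap _ (by rwa [hdet]), hdet, Real.volume_pi_ball _ hδ,
      ZSpan.volume_fundamentalDomain]
    have hb : (Matrix.of b).det = 1 := by
      have : (Matrix.of b : Matrix (Fin j) (Fin j) ℝ) = 1 := by
        ext p q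
        simp [b, Matrix.one_apply, Pi.single_apply, eq_comm]
      rw [this, Matrix.det_one]
    rw [hb, abs_one, ENNReal.ofReal_one, one_mul, Module.finrank_fin_fun, Fintype.card_fin,
      ← ENNReal.ofReal_mul (abs_nonneg _)]
    rw [show (2 : ℝ≥0∞) ^ j = ENNReal.ofReal (2 ^ j) by
      rw [ENNReal.ofReal_pow (by norm_num), ENNReal.ofReal_ofNat]]
    have hpos : 0 < |Y.det| := abs_pos.2 hY
    refine (ENNReal.ofReal_lt_ofReal_iff (by positivity)).2 ?_
    rw [abs_inv, mul_pow, inv_mul_eq_div, lt_div_iff₀ hpos]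
    exact mul_lt_mul_of_pos_left h (by positivity)
  have : Countable (Submodule.span ℤ (range b)).toAddSubgroup :=
    inferInstanceAs (Countable (Submodule.span ℤ (range b)))
  obtain ⟨x, hx0, hx⟩ := exists_ne_zero_mem_lattice_of_measure_mul_two_pow_lt_measure
    (L := (Submodule.span ℤ (range b)).toAddSubgroup) (ZSpan.isAddFundamentalDomain b volume)
    (s := f ⁻¹' Metric.ball 0 δ)
    (fun x hx => by simpa using hx) ((convex_ball 0 δ).linear_preimage f) hvol
  obtain ⟨c, hc⟩ := (Submodule.mem_span_range_iff_exists_fun ℤ).1 x.2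
  have hcx : (fun b => (c b : ℝ)) = (x : Fin j → ℝ) := by
    rw [← hc]
    ext p
    simp [b, Finset.sum_apply, Pi.single_apply]
  refine ⟨c, ?_, fun a => ?_⟩
  · rintro rfl
    refine hx0 (Subtype.ext ?_)
    rw [← hcx]
    ext; simp
  · rw [hcx]
    have : ‖f x‖ < δ := by simpa using hx
    exact (norm_le_pi_norm (f x) a).trans_lt this

/-- The real matrix whose columns are the integer vectors `v b`. -/
def intMat {ι : Type*} {j : ℕ} (v : Fin j → ι → ℤ) : Matrix ι (Fin j) ℝ :=
  Matrix.of fun o b => (v b o : ℝ)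

theorem exists_int_mulVec_lt_of_mnr_lt {ι : Type*} [Finite ι] {j : ℕ} (W : Matrix ι (Fin j) ℝ)
    (hW : ∃ f, mnr W f ≠ 0) (hlt : ∀ f, |mnr W f| < (1 / (j : ℝ)) ^ j) :
    ∃ c : Fin j → ℤ, c ≠ 0 ∧ ∀ o, |(W.mulVec fun b => (c b : ℝ)) o| < 1 := by
  obtain ⟨f₁, hf₁⟩ := hW
  have : Nonempty (Fin j → ι) := ⟨f₁⟩
  obtain ⟨f, hf⟩ := Finite.exists_max fun f : Fin j → ι => |mnr W f|
  have hj : 0 < j := by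
    rcases Nat.eq_zero_or_pos j with rfl | h
    · have := hlt f₁; simp [mnr] at this
    · exact h
  have hj0 : (0 : ℝ) < j := by exact_mod_cast hj
  have hf0 : 0 < |mnr W f| := (abs_pos.2 hf₁).trans_le (hf f₁)
  obtain ⟨c, hc, hlt⟩ := exists_int_mulVec_lt_of_det_lt (W.submatrix f id) (abs_pos.1 hf0)
    (show (0 : ℝ) < 1 / j by positivity) (hlt f)
  refine ⟨c, hc, fun o => ?_⟩
  set z : Fin j → ℝ := fun b => (c b : ℝ)
  have hrow : (W.submatrix f id).det • W o =
      ∑ a, mnr W (Function.update f a o) • W (f a) := by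
    have hcr := Matrix.mulVec_cramer (W.submatrix f id).transpose (W o)
    rw [← Matrix.det_transpose, ← hcr]
    ext b
    simp only [Matrix.mulVec, dotProduct, Finset.sum_apply, Pi.smul_apply, smul_eq_mul]
    refine Finset.sum_congr rfl fun a _ => ?_
    rw [Matrix.cramer_transpose_apply, mnr_update_row, mul_comm]
    rfl
  have h1 : mnr W f * W.mulVec z o = ∑ a, mnr W (Function.update f a o) * W.mulVec z (f a) := by
    have := congrArg (fun w => w ⬝ᵥ z) hrow
    simp only [smul_dotProduct, sum_dotProduct, smul_eq_mul] at this
    exact this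
  have h2 : |mnr W f| * |W.mulVec z o| < |mnr W f| * 1 := by
    rw [← abs_mul, h1]
    calc |∑ a, mnr W (Function.update f a o) * W.mulVec z (f a)|
        ≤ ∑ a, |mnr W (Function.update f a o) * W.mulVec z (f a)| := Finset.abs_sum_le_sum_abs _ _
      _ < ∑ a : Fin j, |mnr W f| * (1 / j) := by
          refine Finset.sum_lt_sum_of_nonempty ⟨⟨0, hj⟩, Finset.mem_univ _⟩ fun a _ => ?_
          rw [abs_mul]
          exact mul_lt_mul' (hf _) (hlt a) (abs_nonneg _) hf0
      _ = |mnr W f| * 1 := by simp; field_simp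
  exact lt_of_mul_lt_mul_left h2 hf0.le

/-- Minkowski's theorem for the lattice generated by independent integer vectors. -/
theorem exists_int_mul_lt {ι : Type*} [Fintype ι] {j : ℕ} (M : Matrix ι ι ℝ)
    (v : Fin j → ι → ℤ) (hW : ∃ f, mnr (M * intMat v) f ≠ 0)
    (hlt : ∀ f, |mnr (M * intMat v) f| < (1 / (j : ℝ)) ^ j) :
    ∃ a : ι → ℤ, a ≠ 0 ∧ ∀ o, |(M.mulVec fun p => (a p : ℝ)) o| < 1 := by
  obtain ⟨c, hc, h⟩ := exists_int_mulVec_lt_of_mnr_lt _ hW hlt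
  have hcast : (fun p => ((∑ b, c b * v b p : ℤ) : ℝ)) = (intMat v).mulVec fun b => (c b : ℝ) := by
    ext p
    simp [intMat, Matrix.mulVec, dotProduct, mul_comm]
  refine ⟨fun p => ∑ b, c b * v b p, ?_, fun o => ?_⟩
  · intro h0
    obtain ⟨f, hf⟩ := hW
    have hz : (intMat v).mulVec (fun b => (c b : ℝ)) = 0 := by
      rw [← hcast]
      ext p
      have := congrFun h0 p
      simp only [Pi.zero_apply] at this ⊢
      rw [this, Int.cast_zero]
    have hY : ((M * intMat v).submatrix f id).mulVec (fun b => (c b : ℝ)) = 0 := by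
      have h2 : (M * intMat v).mulVec (fun b => (c b : ℝ)) = 0 := by
        rw [← Matrix.mulVec_mulVec, hz, Matrix.mulVec_zero]
      ext a
      exact congrFun h2 (f a)
    have := Matrix.eq_zero_of_mulVec_eq_zero hf hY
    refine hc (funext fun b => ?_)
    simpa using congrFun this b
  · rw [hcast, Matrix.mulVec_mulVec]
    exact h o

/-! ### Minimal integer families of rational subspaces -/

section Families

variable {ι : Type*} {j : ℕ}

theorem mnr_map {R R' : Type*} [CommRing R] [CommRing R'] (φ : R →+* R') (W : Matrix ι (Fin j) R)
    (f : Fin j → ι) : mnr (W.map φ) f = φ (mnr W f) := by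
  unfold mnr
  rw [RingHom.map_det]
  rfl

/-- The vectors `v b` with rational coordinates. -/
def ratVec (v : Fin j → ι → ℤ) : Fin j → ι → ℚ := fun b o => (v b o : ℚ)

theorem exists_mnr_ne_zero_of_linearIndependent [Finite ι] {v : Fin j → ι → ℚ}
    (hv : LinearIndependent ℚ v) : ∃ f, mnr (Matrix.of fun o b => v b o) f ≠ 0 := by
  have := Fintype.ofFinite ι
  set W : Matrix ι (Fin j) ℚ := Matrix.of fun o b => v b o with hW
  have hrank : W.rank = j := by
    rw [← Matrix.rank_transpose]
    have : LinearIndependent ℚ W.transpose.row := hv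
    rw [this.rank_matrix, Fintype.card_fin]
  rw [Matrix.rank_eq_finrank_span_row] at hrank
  have h := Submodule.exists_fun_fin_finrank_span_eq ℚ (range W.row)
  rw [hrank] at h
  obtain ⟨g, hg, -, hli⟩ := h
  choose f hf using hg
  refine ⟨f, ?_⟩
  have hrow : (W.submatrix f id).row = g := by
    ext a b
    exact congrFun (hf a) b
  have : LinearIndependent ℚ (W.submatrix f id).row := by
    rw [hrow]
    exact hli
  exact ((Matrix.isUnit_iff_isUnit_det _).1
    (Matrix.linearIndependent_rows_iff_isUnit.1 this)).ne_zero

theorem mnr_intMat (v : Fin j → ι → ℤ) (f : Fin j → ι) :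
    mnr (intMat v) f = ((mnr (Matrix.of fun o b => v b o) f : ℤ) : ℝ) :=
  mnr_map (Int.castRingHom ℝ) (Matrix.of fun o b => v b o) f

theorem mnr_intMat_rat (v : Fin j → ι → ℤ) (f : Fin j → ι) :
    mnr (intMat v) f = ((mnr (Matrix.of fun o b => ratVec v b o) f : ℚ) : ℝ) := by
  have := mnr_map (Rat.castHom ℝ) (Matrix.of fun o b => ratVec v b o) f
  rw [Rat.coe_castHom] at this
  rw [← this]
  congr 1

/-- `v` is a family of integer vectors forming a basis of `V`. -/
def IsFamily (V : Submodule ℚ (ι → ℚ)) (v : Fin j → ι → ℤ) : Prop :=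
  Submodule.span ℚ (range (ratVec v)) = V

theorem IsFamily.exists_mnr_ne_zero [Finite ι] {V : Submodule ℚ (ι → ℚ)} {v : Fin j → ι → ℤ}
    (h : IsFamily V v) (hj : j = Module.finrank ℚ V) : ∃ f, mnr (intMat v) f ≠ 0 := by
  have hli : LinearIndependent ℚ (ratVec v) := by
    rw [linearIndependent_iff_card_eq_finrank_span, Set.finrank, h, Fintype.card_fin, hj]
  obtain ⟨f, hf⟩ := exists_mnr_ne_zero_of_linearIndependent hli
  refine ⟨f, ?_⟩
  rw [mnr_intMat_rat]
  exact_mod_cast hf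

theorem IsFamily.exists_mul {V : Submodule ℚ (ι → ℚ)} {u v : Fin j → ι → ℤ}
    (hu : IsFamily V u) (hv : IsFamily V v) :
    ∃ G : Matrix (Fin j) (Fin j) ℝ, intMat u = intMat v * G := by
  have hmem : ∀ b, ratVec u b ∈ Submodule.span ℚ (range (ratVec v)) := by
    intro b
    rw [hv, ← hu]
    exact Submodule.subset_span (mem_range_self b)
  choose c hc using fun b => (Submodule.mem_span_range_iff_exists_fun ℚ).1 (hmem b)
  refine ⟨Matrix.of fun b' b => (c b b' : ℝ), ?_⟩
  ext o b
  have := congrFun (hc b) o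
  simp only [Finset.sum_apply, Pi.smul_apply, smul_eq_mul, ratVec] at this
  simp only [intMat, Matrix.mul_apply, Matrix.of_apply]
  have h2 : ((u b o : ℚ) : ℝ) = ∑ x, (c b x : ℝ) * ((v x o : ℚ) : ℝ) := by
    rw [← this]; push_cast; rfl
  simp only [Rat.cast_intCast] at h2
  rw [h2]
  exact Finset.sum_congr rfl fun x _ => mul_comm _ _

theorem exists_isFamily [Finite ι] (V : Submodule ℚ (ι → ℚ)) :
    ∃ v : Fin (Module.finrank ℚ V) → ι → ℤ, IsFamily V v := by
  have := Fintype.ofFinite ι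
  let s : Set (ι → ℚ) := {w | w ∈ V ∧ ∃ z : ι → ℤ, ∀ o, w o = z o}
  have hs : Submodule.span ℚ s = V := by
    refine le_antisymm (Submodule.span_le.2 fun w hw => hw.1) fun w hw => ?_
    set N : ℕ := ∏ o, (w o).den with hN
    have hN0 : (N : ℚ) ≠ 0 := by
      rw [hN]; push_cast
      exact Finset.prod_ne_zero_iff.2 fun o _ => by exact_mod_cast (w o).den_nz
    have hmem : (N : ℚ) • w ∈ s := by
      refine ⟨V.smul_mem _ hw, fun o => ((N / (w o).den : ℕ) : ℤ) * (w o).num, fun o => ?_⟩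
      have hdvd : (w o).den ∣ N := Finset.dvd_prod_of_mem _ (Finset.mem_univ o)
      obtain ⟨t, ht⟩ := hdvd
      have hd : ((w o).den : ℚ) ≠ 0 := by exact_mod_cast (w o).den_nz
      have hd' : 0 < (w o).den := (w o).den_pos
      change (N : ℚ) * w o = ((((N / (w o).den : ℕ) : ℤ) * (w o).num : ℤ) : ℚ)
      rw [ht, Nat.mul_div_cancel_left _ hd']
      push_cast
      rw [mul_right_comm, Rat.den_mul_eq_num, mul_comm]
    have := (Submodule.span ℚ s).smul_mem ((N : ℚ)⁻¹) (Submodule.subset_span hmem)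
    rwa [smul_smul, inv_mul_cancel₀ hN0, one_smul] at this
  have h := Submodule.exists_fun_fin_finrank_span_eq ℚ s
  rw [hs] at h
  obtain ⟨f, hf, hspan, -⟩ := h
  choose z hz using fun i => (hf i).2
  refine ⟨z, ?_⟩
  have : ratVec z = f := by ext i o; exact (hz i o).symm
  rw [IsFamily, this, hspan]

theorem IsFamily.cons {V : Submodule ℚ (ι → ℚ)} {v : Fin j → ι → ℤ} (h : IsFamily V v)
    (a : ι → ℤ) : IsFamily (V ⊔ Submodule.span ℚ {fun o => (a o : ℚ)})
      (Fin.cons a v : Fin (j + 1) → ι → ℤ) := by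
  have : ratVec (Fin.cons a v : Fin (j + 1) → ι → ℤ) =
      (Fin.cons (fun o => (a o : ℚ)) (ratVec v) : Fin (j + 1) → ι → ℚ) := by
    ext b o
    refine Fin.cases ?_ (fun b => ?_) b <;> simp [ratVec]
  rw [IsFamily, this, Fin.range_cons, Submodule.span_insert, sup_comm, h]

variable [Fintype ι]

/-- Sup norm of the minors of `M` times the family `v`. -/
noncomputable def mnrNorm (M : Matrix ι ι ℝ) (v : Fin j → ι → ℤ) : ℝ :=
  ‖fun f : Fin j → ι => mnr (M * intMat v) f‖

theorem exists_minimal_isFamily (V : Submodule ℚ (ι → ℚ)) :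
    ∃ v : Fin (Module.finrank ℚ V) → ι → ℤ, IsFamily V v ∧
      ∀ (i : ℕ) (u : Fin i → ι → ℤ), i = Module.finrank ℚ V → IsFamily V u →
        ∀ M : Matrix ι ι ℝ, mnrNorm M v ≤ mnrNorm M u := by
  let size : (Fin (Module.finrank ℚ V) → ι → ℤ) → ℕ := fun v =>
    ∑ f : Fin (Module.finrank ℚ V) → ι, (mnr (Matrix.of fun o b => v b o) f).natAbs
  have hsize : ∀ v, (size v : ℝ) = ∑ f, |mnr (intMat v) f| := by
    intro v
    simp only [size, Nat.cast_sum, mnr_intMat, Nat.cast_natAbs, Int.cast_abs]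
  have hex : ∃ n v, IsFamily V v ∧ size v = n := by
    obtain ⟨v, hv⟩ := exists_isFamily V
    exact ⟨_, v, hv, rfl⟩
  classical
  obtain ⟨v, hv, hvn⟩ := Nat.find_spec hex
  refine ⟨v, hv, fun i u hi hu M => ?_⟩
  subst hi
  have hle : size v ≤ size u := hvn.trans_le (Nat.find_min' hex ⟨u, hu, rfl⟩)
  obtain ⟨G, hG⟩ := hu.exists_mul hv
  have hpos : (0 : ℝ) < size v := by
    obtain ⟨f, hf⟩ := hv.exists_mnr_ne_zero rfl
    rw [hsize]
    exact Finset.sum_pos' (fun _ _ => abs_nonneg _) ⟨f, Finset.mem_univ f, abs_pos.2 hf⟩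
  have hdet : 1 ≤ |G.det| := by
    have h1 : (size u : ℝ) = size v * |G.det| := by
      rw [hsize, hsize, hG, Finset.sum_mul]
      simp_rw [mnr_mul_right, abs_mul]
    have h2 : (size v : ℝ) ≤ size u := by exact_mod_cast hle
    rw [h1] at h2
    exact le_of_mul_le_mul_left (by linarith) hpos
  unfold mnrNorm
  refine (pi_norm_le_iff_of_nonneg (norm_nonneg _)).2 fun f => ?_
  refine le_trans ?_ (norm_le_pi_norm _ f)
  simp only [Real.norm_eq_abs]
  rw [hG, ← Matrix.mul_assoc, mnr_mul_right, abs_mul]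
  exact le_mul_of_one_le_right (abs_nonneg _) hdet

theorem mnrNorm_cons_le (M : Matrix ι ι ℝ) (a : ι → ℤ) (v : Fin j → ι → ℤ) {η : ℝ}
    (ha : ∀ o, |M.mulVec (fun p => (a p : ℝ)) o| ≤ η) (hη : 0 ≤ η) :
    mnrNorm M (Fin.cons a v : Fin (j + 1) → ι → ℤ) ≤ (j + 1) * (η * mnrNorm M v) := by
  have hn : 0 ≤ mnrNorm M v := norm_nonneg _
  rw [mnrNorm, pi_norm_le_iff_of_nonneg (by positivity)]
  intro f
  rw [mnr, Matrix.det_succ_column_zero, Real.norm_eq_abs]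
  refine (Finset.abs_sum_le_sum_abs _ _).trans ?_
  have hterm : ∀ i ∈ (Finset.univ : Finset (Fin (j + 1))),
      |(-1) ^ (i : ℕ) * ((M * intMat (Fin.cons a v : Fin (j + 1) → ι → ℤ)).submatrix f id) i 0 *
        (((M * intMat (Fin.cons a v : Fin (j + 1) → ι → ℤ)).submatrix f id).submatrix
          i.succAbove Fin.succ).det| ≤ η * mnrNorm M v := by
    intro i _
    rw [abs_mul, abs_mul, abs_pow, abs_neg, abs_one, one_pow, one_mul]
    have h1 : ((M * intMat (Fin.cons a v : Fin (j + 1) → ι → ℤ)).submatrix f id) i 0 =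
        M.mulVec (fun p => (a p : ℝ)) (f i) := by
      simp [Matrix.mul_apply, intMat, Matrix.mulVec, dotProduct]
    have h2 : (((M * intMat (Fin.cons a v : Fin (j + 1) → ι → ℤ)).submatrix f id).submatrix
          i.succAbove Fin.succ).det = mnr (M * intMat v) (fun b => f (i.succAbove b)) := by
      rw [mnr]
      congr 1
    rw [h1, h2]
    exact mul_le_mul (ha _) (norm_le_pi_norm (fun f => mnr (M * intMat v) f) _) (abs_nonneg _) hη
  refine (Finset.sum_le_sum hterm).trans_eq ?_
  simp

end Families

/-! ### Nondivergence for lattices -/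

theorem AhlforsOn.measure_small_vector_le {ι : Type*} [Fintype ι] [DecidableEq ι] {μ : Measure ℝ}
    {S : Set ℝ} {α c C ρ₁ : ℝ} (h : AhlforsOn μ S α c C ρ₁) {M : ℝ → Matrix ι ι ℝ} {I₀ : Set ℝ}
    (hM : ∀ a b, ContinuousOn (fun x => M x a b) I₀) {ε G : ℝ} (hε : 0 < ε) (hε1 : ε ≤ 1)
    (hG : 0 ≤ G)
    (hgood : ∀ (j : ℕ) (v : Fin j → ι → ℤ) (f : Fin j → ι), ∀ y ∈ S, ∀ ρ, 0 < ρ → ρ ≤ ρ₁ →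
      Metric.closedBall y ρ ⊆ I₀ →
      (∃ x ∈ Metric.closedBall y ρ, 1 ≤ |mnr (M x * intMat v) f|) →
      μ {x ∈ Metric.closedBall y ρ | |mnr (M x * intMat v) f| < ε} ≤ ENNReal.ofReal (G * ρ ^ α))
    {y ρ : ℝ} (hy : y ∈ S) (hρ : 0 < ρ) (hρ₁ : 5 ^ Fintype.card ι * ρ ≤ ρ₁)
    (hI : Metric.closedBall y (5 ^ Fintype.card ι * ρ) ⊆ I₀)
    (hsup : ∀ (j : ℕ) (v : Fin j → ι → ℤ), 1 ≤ j → (∃ f, mnr (intMat v) f ≠ 0) →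
      ∃ x ∈ Metric.closedBall y ρ, ∃ f, 1 ≤ |mnr (M x * intMat v) f|) :
    μ {x ∈ Metric.closedBall y ρ | ∃ a : ι → ℤ, a ≠ 0 ∧
        ∀ o, |(M x).mulVec (fun p => (a p : ℝ)) o| < ε / Fintype.card ι} ≤
      ENNReal.ofReal (nondivConst α c C (Fintype.card ι) * G * ρ ^ α) := by
  classical
  choose fam hfam hmin using exists_minimal_isFamily (ι := ι)
  let P := {V : Submodule ℚ (ι → ℚ) // V ≠ ⊥}
  let ψ : P → ℝ → ℝ := fun V x => mnrNorm (M x) (fam V.1)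
  have hexists : ∀ (x : ℝ) (V : P), 1 ≤ ψ V x → ∃ f, 1 ≤ |mnr (M x * intMat (fam V.1)) f| := by
    intro x V hx
    by_contra! hcon
    refine absurd hx (not_le.2 ?_)
    exact (pi_norm_lt_iff zero_lt_one).2 hcon
  have hψcont : ∀ V, ContinuousOn (ψ V) I₀ := by
    intro V
    refine ContinuousOn.norm (continuousOn_pi.2 fun f => ?_)
    unfold mnr
    refine (continuous_id.matrix_det).comp_continuousOn ?_
    refine continuousOn_pi.2 fun a => continuousOn_pi.2 fun b => ?_
    simp only [Matrix.mul_apply]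
    exact continuousOn_finsetSum _ fun o _ => (hM _ _).mul continuousOn_const
  have hmain := h.measure_not_marked_le (P := P) (rk := fun V => Module.finrank ℚ V.1)
    (fun V W hVW => Submodule.finrank_lt_finrank_of_lt hVW) (k := Fintype.card ι)
    (fun V => ⟨Submodule.one_le_finrank_iff.2 V.2,
      (Submodule.finrank_le V.1).trans_eq (Module.finrank_fintype_fun_eq_card ℚ)⟩)
    (ψ := ψ) hψcont (ε := ε) hG
    (by
      intro V y hy ρ hρ hρ₁ hI hsup
      obtain ⟨x, hx, hx1⟩ := hsup
      obtain ⟨f, hf⟩ := hexists x V hx1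
      refine (measure_mono ?_).trans (hgood _ (fam V.1) f y hy ρ hρ hρ₁ hI ⟨x, hx, hf⟩)
      rintro z ⟨hz, hzε⟩
      exact ⟨hz, (norm_le_pi_norm (fun f => mnr (M z * intMat (fam V.1)) f) f).trans_lt hzε⟩)
    (Fintype.card ι) ∅ (by simp) (by simp) y hy ρ hρ hρ₁ hI
    (by
      intro V _
      obtain ⟨x, hx, f, hf⟩ := hsup _ (fam V.1) (Submodule.one_le_finrank_iff.2 V.2)
        ((hfam V.1).exists_mnr_ne_zero rfl)
      exact ⟨x, hx, hf.trans (norm_le_pi_norm (fun f => mnr (M x * intMat (fam V.1)) f) f)⟩)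
  refine (measure_mono ?_).trans hmain
  rintro x ⟨hx, a, ha, hsmall⟩
  refine ⟨hx, ?_⟩
  rintro ⟨T, -, hT, hT1, hT2⟩
  set w : ι → ℚ := fun o => (a o : ℚ) with hw
  have hw0 : w ≠ 0 := by
    intro h0
    refine ha (funext fun o => ?_)
    have := congrFun h0 o
    simpa [hw] using this
  -- the largest member of the flag not containing `w`
  let Q : Finset (Submodule ℚ (ι → ℚ)) := insert ⊥ ((T.image Subtype.val).filter fun V => w ∉ V)
  have hQne : Q.Nonempty := ⟨⊥, Finset.mem_insert_self _ _⟩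
  obtain ⟨V, hVQ, hVmax⟩ := Q.exists_maximal hQne
  have hwV : w ∉ V := by
    rcases Finset.mem_insert.1 hVQ with rfl | hV
    · simpa using hw0
    · exact (Finset.mem_filter.1 hV).2
  have hVle : mnrNorm (M x) (fam V) ≤ 1 := by
    rcases Finset.mem_insert.1 hVQ with rfl | hV
    · refine (pi_norm_le_iff_of_nonneg zero_le_one).2 fun f => ?_
      have : IsEmpty (Fin (Module.finrank ℚ (⊥ : Submodule ℚ (ι → ℚ)))) := by
        rw [finrank_bot]; infer_instance
      rw [mnr, Matrix.det_isEmpty, norm_one]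
    · obtain ⟨hV, -⟩ := Finset.mem_filter.1 hV
      obtain ⟨V', hV', rfl⟩ := Finset.mem_image.1 hV
      exact (hT1 V' hV' (by simp)).2.le
  set L : Submodule ℚ (ι → ℚ) := Submodule.span ℚ {w} with hL
  have hwL : w ∈ V ⊔ L := Submodule.mem_sup_right (Submodule.mem_span_singleton_self w)
  have hlt : V < V ⊔ L := lt_of_le_of_ne le_sup_left fun he => hwV (he ▸ hwL)
  have hrank : Module.finrank ℚ V + 1 = Module.finrank ℚ (V ⊔ L : Submodule ℚ (ι → ℚ)) := by
    refine le_antisymm (Submodule.finrank_lt_finrank_of_lt hlt) ?_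
    refine (Submodule.finrank_add_le_finrank_add_finrank V L).trans ?_
    rw [finrank_span_singleton hw0]
  have hcard : Module.finrank ℚ V + 1 ≤ Fintype.card ι := by
    rw [hrank]
    exact (Submodule.finrank_le _).trans_eq (Module.finrank_fintype_fun_eq_card ℚ)
  have hcard0 : (0 : ℝ) < Fintype.card ι := by
    have : 0 < Fintype.card ι := by omega
    exact_mod_cast this
  have hnorm : mnrNorm (M x) (fam (V ⊔ L)) < ε := by
    have hι : Nonempty ι := Fintype.card_pos_iff.1 (by omega)
    obtain ⟨o₁, ho₁⟩ := Finite.exists_max fun o => |(M x).mulVec (fun p => (a p : ℝ)) o|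
    have h1 := (hmin (V ⊔ L) _ _ hrank ((hfam V).cons a) (M x)).trans
      (mnrNorm_cons_le (M x) a (fam V) ho₁ (abs_nonneg _))
    have h2 := hsmall o₁
    set η := |(M x).mulVec (fun p => (a p : ℝ)) o₁|
    have hη : 0 ≤ η := abs_nonneg _
    have h3 : ((Module.finrank ℚ V : ℝ) + 1) ≤ Fintype.card ι := by exact_mod_cast hcard
    refine h1.trans_lt ?_
    calc ((Module.finrank ℚ V : ℝ) + 1) * (η * mnrNorm (M x) (fam V))
        ≤ Fintype.card ι * (η * 1) := by
          have : 0 ≤ mnrNorm (M x) (fam V) := norm_nonneg _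
          gcongr
      _ < Fintype.card ι * (ε / Fintype.card ι * 1) := by gcongr
      _ = ε := by field_simp
  have hne : V ⊔ L ≠ ⊥ := fun h0 => by
    rw [h0] at hlt; exact not_lt_bot hlt
  by_cases hmem : (⟨V ⊔ L, hne⟩ : P) ∈ T
  · exact absurd (hT1 _ hmem (by simp)).1 (not_le.2 hnorm)
  · refine absurd (hT2 ⟨V ⊔ L, hne⟩ ⟨hmem, fun W hW => ?_⟩) (not_le.2 (hnorm.trans_le hε1))
    by_cases hwW : w ∈ W.1
    · left
      change V ⊔ L ≤ W.1
      refine sup_le ?_ ((Submodule.span_singleton_le_iff_mem w W.1).2 hwW)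
      rcases Finset.mem_insert.1 hVQ with hV | hV
      · rw [hV]
        exact bot_le
      · obtain ⟨hV, -⟩ := Finset.mem_filter.1 hV
        obtain ⟨V', hV', rfl⟩ := Finset.mem_image.1 hV
        by_cases he : V' = W
        · rw [he]
        rcases hT hV' hW he with h1 | h1
        · exact h1
        · exact absurd (h1 hwW) hwV
    · right
      change W.1 ≤ V ⊔ L
      have hWQ : W.1 ∈ Q := Finset.mem_insert_of_mem
        (Finset.mem_filter.2 ⟨Finset.mem_image_of_mem _ hW, hwW⟩)
      rcases Finset.mem_insert.1 hVQ with hV | hV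
      · have := hVmax hWQ (hV.trans_le bot_le)
        exact this.trans le_sup_left
      · obtain ⟨hV, -⟩ := Finset.mem_filter.1 hV
        obtain ⟨V', hV', rfl⟩ := Finset.mem_image.1 hV
        by_cases he : V' = W
        · rw [he]; exact le_sup_left
        rcases hT hV' hW he with h1 | h1
        · exact (hVmax hWQ h1).trans le_sup_left
        · exact le_trans h1 le_sup_left

/-! ### The matrix of the curve and its minors -/

section Curve

variable {I : Type*}

/-- The coordinates `1, φ₁, …, φₙ`. -/
def hatFun (φ : I → ℝ → ℝ) : Option I → ℝ → ℝ := fun o => o.elim (fun _ => 1) φ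

/-- The weights `-1, r₁, …, rₙ`. -/
def wt (r : I → ℝ) : Option I → ℝ := fun o => o.elim (-1) r

theorem wt_none (r : I → ℝ) : wt r none = -1 := rfl

theorem wt_some (r : I → ℝ) (i : I) : wt r (some i) = r i := rfl

theorem deriv_hatFun_none {φ : I → ℝ → ℝ} {x : ℝ} : deriv (hatFun φ none) x = 0 := by
  simp [hatFun]

theorem analyticOnNhd_hatFun {φ : I → ℝ → ℝ} {U : Set ℝ} (hφ : ∀ i, AnalyticOnNhd ℝ (φ i) U)
    (o : Option I) : AnalyticOnNhd ℝ (hatFun φ o) U := by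
  cases o with
  | none => exact analyticOnNhd_const
  | some i => exact hφ i

variable [DecidableEq I]

/-- The matrix with rows `(φ̂)`, `(φ̂')` and the unit vectors `eᵢ`, `i ≠ i₀`. -/
noncomputable def curveMat (φ : I → ℝ → ℝ) (i₀ : I) (x : ℝ) : Matrix (Option I) (Option I) ℝ :=
  Matrix.of fun o => o.elim (fun p => hatFun φ p x)
    (fun i => if i = i₀ then fun p => deriv (hatFun φ p) x else Pi.single (some i) 1)

variable {φ : I → ℝ → ℝ} {i₀ : I} {x : ℝ}

theorem curveMat_none : curveMat φ i₀ x none = fun p => hatFun φ p x := rfl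

theorem curveMat_self : curveMat φ i₀ x (some i₀) = fun p => deriv (hatFun φ p) x :=
  if_pos rfl

theorem curveMat_other {o : Option I} (h0 : o ≠ none) (h1 : o ≠ some i₀) :
    curveMat φ i₀ x o = Pi.single o 1 := by
  obtain ⟨i, rfl⟩ := Option.ne_none_iff_exists'.1 h0
  exact if_neg fun h => h1 (by rw [h])

theorem analyticOnNhd_curveMat {U : Set ℝ} (hφ : ∀ i, AnalyticOnNhd ℝ (φ i) U)
    (o p : Option I) : AnalyticOnNhd ℝ (fun x => curveMat φ i₀ x o p) U := by
  by_cases h0 : o = none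
  · simp only [h0, curveMat_none]
    exact analyticOnNhd_hatFun hφ p
  by_cases h1 : o = some i₀
  · simp only [h1, curveMat_self]
    exact (analyticOnNhd_hatFun hφ p).deriv
  · simp only [curveMat_other h0 h1]
    exact analyticOnNhd_const

variable [Fintype I]

theorem isUnit_det_curveMat (h : deriv (φ i₀) x ≠ 0) : IsUnit (curveMat φ i₀ x).det := by
  rw [← Matrix.isUnit_iff_isUnit_det, ← Matrix.mulVec_injective_iff_isUnit]
  refine (injective_iff_map_eq_zero (curveMat φ i₀ x).mulVecLin).2 fun a ha => ?_
  have ha : ∀ o, ∑ p, curveMat φ i₀ x o p * a p = 0 := fun o => congrFun ha o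
  have h1 : ∀ o, o ≠ none → o ≠ some i₀ → a o = 0 := by
    intro o ho ho'
    have := ha o
    rw [curveMat_other ho ho'] at this
    simpa [Pi.single_apply] using this
  have h2 : a (some i₀) = 0 := by
    have := ha (some i₀)
    rw [curveMat_self, Finset.sum_eq_single (some i₀)] at this
    · exact (mul_eq_zero.1 this).resolve_left h
    · intro o _ ho
      by_cases h0 : o = none
      · simp only [h0, deriv_hatFun_none, zero_mul]
      · rw [h1 o h0 ho, mul_zero]
    · simp
  have h3 : a none = 0 := by
    have := ha none
    rw [curveMat_none, Finset.sum_eq_single none] at this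
    · simpa [hatFun] using this
    · intro o _ ho
      by_cases h0 : o = some i₀
      · rw [h0, h2, mul_zero]
      · rw [h1 o ho h0, mul_zero]
    · simp
  ext o
  by_cases ho : o = none
  · rw [ho, h3]; rfl
  by_cases ho' : o = some i₀
  · rw [ho', h2]; rfl
  exact h1 o ho ho'

variable {j : ℕ}

theorem curveMat_mul_row (N : Matrix (Option I) (Fin j) ℝ) (o : Option I) :
    (curveMat φ i₀ x * N) o = ∑ p, curveMat φ i₀ x o p • N p := by
  ext b
  simp [Matrix.mul_apply]

theorem curveMat_mul_other (N : Matrix (Option I) (Fin j) ℝ) {o : Option I}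
    (h0 : o ≠ none) (h1 : o ≠ some i₀) : (curveMat φ i₀ x * N) o = N o := by
  rw [curveMat_mul_row, curveMat_other h0 h1, Finset.sum_eq_single o]
  · simp
  · intro p _ hp
    rw [Pi.single_eq_of_ne hp, zero_smul]
  · simp

theorem mnr_curveMat_pure (N : Matrix (Option I) (Fin j) ℝ) {f : Fin j → Option I}
    (h0 : ∀ a, f a ≠ none) (h1 : ∀ a, f a ≠ some i₀) :
    mnr (curveMat φ i₀ x * N) f = mnr N f :=
  mnr_row_congr fun a => curveMat_mul_other N (h0 a) (h1 a)

theorem mnr_curveMat_update_none (N : Matrix (Option I) (Fin j) ℝ) {f : Fin j → Option I}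
    {a : Fin j} (hf : ∀ b ≠ a, f b ≠ none ∧ f b ≠ some i₀) :
    mnr (curveMat φ i₀ x * N) (Function.update f a none) =
      ∑ p, hatFun φ p x * mnr N (Function.update f a p) :=
  mnr_update_of_row_eq_sum (curveMat_mul_row N none)
    fun b hb => curveMat_mul_other N (hf b hb).1 (hf b hb).2

theorem mnr_curveMat_update_self (N : Matrix (Option I) (Fin j) ℝ) {f : Fin j → Option I}
    {a : Fin j} (hf : ∀ b ≠ a, f b ≠ none ∧ f b ≠ some i₀) :
    mnr (curveMat φ i₀ x * N) (Function.update f a (some i₀)) =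
      ∑ p, deriv (hatFun φ p) x * mnr N (Function.update f a p) := by
  refine mnr_update_of_row_eq_sum ?_ fun b hb => curveMat_mul_other N (hf b hb).1 (hf b hb).2
  rw [curveMat_mul_row, curveMat_self]

theorem mnr_curveMat_both {N : Matrix (Option I) (Fin j) ℝ}
    (hN : ∀ f, mnr N f ≠ 0 → (∃ a, f a = none) ∧ ∃ a, f a = some i₀) {f : Fin j → Option I}
    (hf : mnr N f ≠ 0) :
    mnr (curveMat φ i₀ x * N) f = deriv (φ i₀) x * mnr N f := by
  have hinj : Function.Injective f := by
    by_contra h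
    exact hf (mnr_eq_zero_of_not_injective N h)
  obtain ⟨⟨a₀, ha₀⟩, a₁, ha₁⟩ := hN f hf
  have hother : ∀ b, b ≠ a₀ → b ≠ a₁ → f b ≠ none ∧ f b ≠ some i₀ := fun b h0 h1 =>
    ⟨fun h => h0 (hinj (h.trans ha₀.symm)), fun h => h1 (hinj (h.trans ha₁.symm))⟩
  rw [mnr_mul, Finset.sum_eq_single f]
  · congr 1
    rw [Finset.prod_eq_single a₁]
    · rw [ha₁, curveMat_self]
      rfl
    · intro b _ hb
      by_cases hb0 : b = a₀
      · rw [hb0, ha₀, curveMat_none]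
        rfl
      · rw [curveMat_other (hother b hb0 hb).1 (hother b hb0 hb).2]
        simp
    · simp
  · intro h _ hne
    by_contra hcon
    have hP : mnr N h ≠ 0 := fun h0 => hcon (by rw [h0, mul_zero])
    have hprod : ∀ a, curveMat φ i₀ x (f a) (h a) ≠ 0 := fun a =>
      Finset.prod_ne_zero_iff.1 (fun h0 => hcon (by rw [h0, zero_mul])) a (Finset.mem_univ a)
    have hoff : ∀ b, b ≠ a₀ → b ≠ a₁ → h b = f b := by
      intro b h0 h1
      by_contra hb
      refine hprod b ?_
      rw [curveMat_other (hother b h0 h1).1 (hother b h0 h1).2, Pi.single_eq_of_ne hb]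
    have h1 : h a₁ ≠ none := by
      intro h1
      refine hprod a₁ ?_
      rw [ha₁, curveMat_self, h1]
      exact deriv_hatFun_none
    obtain ⟨⟨b₀, hb₀⟩, b₁, hb₁⟩ := hN h hP
    have e0 : h a₀ = none := by
      by_cases hb : b₀ = a₀
      · rw [← hb, hb₀]
      · have hb' : b₀ ≠ a₁ := fun hb' => h1 (hb' ▸ hb₀)
        exact absurd ((hoff b₀ hb hb').symm.trans hb₀) (hother b₀ hb hb').1
    have e1 : h a₁ = some i₀ := by
      by_cases hb : b₁ = a₁
      · rw [← hb, hb₁]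
      · have hb' : b₁ ≠ a₀ := fun hb' => by rw [hb', e0] at hb₁; cases hb₁
        exact absurd ((hoff b₁ hb' hb).symm.trans hb₁) (hother b₁ hb' hb).2
    refine hne (funext fun b => ?_)
    by_cases h0 : b = a₀
    · rw [h0, e0, ha₀]
    by_cases h1 : b = a₁
    · rw [h1, e1, ha₁]
    exact hoff b h0 h1
  · simp

/-! ### Comparability of the minors with their derivatives -/

theorem exists_minor_comparable {U : Set ℝ} (hφ : ∀ i, AnalyticOnNhd ℝ (φ i) U)
    (hU : IsOpen U) (hUc : IsPreconnected U) {x₀ : ℝ} (hx₀ : x₀ ∈ U) (i₀ : I) :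
    ∃ (m : ℕ) (δ K : ℝ), 0 < δ ∧ 1 ≤ K ∧ Metric.closedBall x₀ δ ⊆ U ∧
      ∀ (d : Option I → ℝ) (j : ℕ) (v : Fin j → Option I → ℤ) (f : Fin j → Option I),
        ∃ g : ℕ → ℝ → ℝ,
          (∀ x, g 0 x = mnr (Matrix.diagonal d * curveMat φ i₀ x * intMat v) f) ∧
          (∀ i, ∀ x ∈ Metric.closedBall x₀ δ, HasDerivAt (g i) (g (i + 1) x) x) ∧
          ∃ (A : ℝ) (k : ℕ), k ≤ m ∧ ∀ x ∈ Metric.closedBall x₀ δ,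
            A ≤ |g k x| ∧ |g k x| ≤ K * A := by
  let Q := Σ j : Fin (Fintype.card (Option I) + 1), (Fin j → Option I)
  let G : (Σ q : Q, Fin q.1 → Option I) → ℝ → ℝ := fun e x =>
    ∏ a, curveMat φ i₀ x (e.1.2 a) (e.2 a)
  have hG : ∀ e, AnalyticOnNhd ℝ (G e) U := by
    intro e
    exact Finset.analyticOnNhd_fun_prod _ fun a _ => analyticOnNhd_curveMat hφ _ _
  obtain ⟨m, δ, K, hδ, hK, hsub, hmain⟩ := exists_derivComb_comparable hG hU hUc hx₀
  refine ⟨m, δ, K, hδ, hK, hsub, fun d j v f => ?_⟩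
  by_cases hf : Function.Injective f
  · have hj : j < Fintype.card (Option I) + 1 := by
      have := Fintype.card_le_of_injective f hf
      rw [Fintype.card_fin] at this
      omega
    let q₀ : Q := ⟨⟨j, hj⟩, f⟩
    let c : (Σ q : Q, Fin q.1 → Option I) → ℝ := fun e =>
      (Pi.single q₀ (fun h => (∏ a, d (f a)) * mnr (intMat v) h) :
        ∀ q : Q, (Fin q.1 → Option I) → ℝ) e.1 e.2
    refine ⟨derivComb G c, fun x => ?_, fun i x hx => hasDerivAt_derivComb hG c i (hsub hx),
      hmain c⟩
    rw [derivComb, Fintype.sum_sigma, Finset.sum_eq_single q₀]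
    · rw [Matrix.mul_assoc, mnr_diagonal_mul, mnr_mul, Finset.mul_sum]
      refine Finset.sum_congr rfl fun h _ => ?_
      simp only [c, Pi.single_eq_same, Function.iterate_zero, id]
      ring
    · intro q _ hq
      refine Finset.sum_eq_zero fun h _ => ?_
      simp only [c, Pi.single_eq_of_ne hq, Pi.zero_apply, zero_mul]
    · simp
  · refine ⟨fun _ _ => 0, fun x => (mnr_eq_zero_of_not_injective _ hf).symm,
      fun i x _ => hasDerivAt_const _ _, 0, 0, Nat.zero_le _, fun x _ => by simp⟩

end Curve

/-! ### Sums of weights -/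

section Weights

variable {I : Type*} {r : I → ℝ} {j : ℕ} {f : Fin j → Option I}

theorem sum_wt_le (hpos : ∀ i, 0 < r i) (hf : Function.Injective f)
    {B : Finset (Option I)} (hB : ∀ a, f a ∈ B) (hnone : none ∈ B → ∃ a, f a = none) :
    ∑ a, wt r (f a) ≤ ∑ o ∈ B, wt r o := by
  classical
  rw [← Finset.sum_image (s := Finset.univ) (g := f) (f := fun o => wt r o) (fun a _ b _ h => hf h)]
  refine Finset.sum_le_sum_of_subset_of_nonneg (fun o ho => ?_) fun o ho hno => ?_
  · obtain ⟨a, -, rfl⟩ := Finset.mem_image.1 ho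
    exact hB a
  · cases o with
    | none =>
      obtain ⟨a, ha⟩ := hnone ho
      exact absurd (Finset.mem_image.2 ⟨a, Finset.mem_univ a, ha⟩) hno
    | some i => exact (hpos i).le

variable [Fintype I]

theorem sum_wt (hr : ∑ i, r i = 1) : ∑ o, wt r o = 0 := by
  rw [Fintype.sum_option]
  simp only [wt_none, wt_some, hr]
  norm_num

theorem sum_wt_le_of_hits (hpos : ∀ i, 0 < r i) (hr : ∑ i, r i = 1) (hf : Function.Injective f)
    (h0 : ∃ a, f a = none) : ∑ a, wt r (f a) ≤ 0 :=
  (sum_wt_le hpos hf (B := Finset.univ) (fun _ => Finset.mem_univ _) fun _ => h0).trans_eq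
    (sum_wt hr)

variable [DecidableEq I] {i₀ : I}

theorem sum_wt_le_neg_of_hits (hpos : ∀ i, 0 < r i) (hr : ∑ i, r i = 1)
    (hf : Function.Injective f) (h0 : ∃ a, f a = none) {i : I} (hi : ∀ a, f a ≠ some i) :
    ∑ a, wt r (f a) ≤ -r i := by
  refine (sum_wt_le hpos hf (B := Finset.univ.erase (some i))
    (fun a => Finset.mem_erase.2 ⟨hi a, Finset.mem_univ _⟩) fun _ => h0).trans_eq ?_
  have := Finset.add_sum_erase Finset.univ (wt r) (Finset.mem_univ (some i))
  rw [sum_wt hr, wt_some] at this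
  linarith

theorem sum_wt_le_one (hpos : ∀ i, 0 < r i) (hr : ∑ i, r i = 1)
    (hf : Function.Injective f) (h0 : ∀ a, f a ≠ none) :
    ∑ a, wt r (f a) ≤ 1 := by
  refine (sum_wt_le hpos hf (B := Finset.univ.erase none)
    (fun a => Finset.mem_erase.2 ⟨h0 a, Finset.mem_univ _⟩) (by simp)).trans_eq ?_
  have := Finset.add_sum_erase Finset.univ (wt r) (Finset.mem_univ none)
  rw [sum_wt hr, wt_none] at this
  linarith

theorem sum_wt_le_one_sub (hpos : ∀ i, 0 < r i) (hr : ∑ i, r i = 1)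
    (hf : Function.Injective f) (h0 : ∀ a, f a ≠ none) {i : I} (hi : ∀ a, f a ≠ some i) :
    ∑ a, wt r (f a) ≤ 1 - r i := by
  refine (sum_wt_le hpos hf (B := (Finset.univ.erase none).erase (some i))
    (fun a => Finset.mem_erase.2 ⟨hi a, Finset.mem_erase.2 ⟨h0 a, Finset.mem_univ _⟩⟩)
    (by simp)).trans_eq ?_
  have := Finset.add_sum_erase Finset.univ (wt r) (Finset.mem_univ none)
  rw [sum_wt hr, wt_none] at this
  have h2 := Finset.add_sum_erase (Finset.univ.erase none) (wt r) (a := some i) (by simp)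
  rw [wt_some] at h2
  linarith

theorem exists_missing (hj : j ≤ Fintype.card I)
    (h0 : ∃ a, f a = none) : ∃ i : I, ∀ a, f a ≠ some i := by
  by_contra! hcon
  have hsurj : Function.Surjective f := by
    intro o
    cases o with
    | none => exact h0
    | some i => exact hcon i
  have := Fintype.card_le_of_surjective f hsurj
  rw [Fintype.card_option, Fintype.card_fin] at this
  omega

/-- The combinatorial core of the local estimate: the weights of the minors of a lattice cannot
be small simultaneously with all the lower bounds provided by Minkowski's theorem. -/
theorem minor_weights_contradiction (hpos : ∀ i, 0 < r i) (hr : ∑ i, r i = 1)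
    (hj : j ≤ Fintype.card I) {ν : ℝ} (hνr : ∀ i, ν ≤ r i)
    {σ τ l c C₁ : ℝ} {N : ℕ} (hσ : 0 ≤ σ) (hτ : 0 ≤ τ) (hc : 0 < c) (hC₁ : 1 ≤ C₁)
    (hσν : j * σ * 2 ≤ ν) (hl : l = N * (1 + r i₀) * τ)
    {W : (Fin j → Option I) → ℝ} (hW : ∀ f, 0 ≤ W f)
    (hup : ∀ f, W f ≤ Real.exp (3 / 2 * (j * σ * l)))
    (hup' : ∀ f, (∃ a, f a = some i₀) → W f ≤ Real.exp (3 / 2 * (j * σ * l) - l))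
    (hup₁ : ∀ f, (∃ a, f a = some i₀) → (∀ a, f a ≠ none) →
      W f ≤ C₁ * Real.exp (3 / 2 * (j * σ * l) - 2 * l))
    (hpl : ∀ f g a₀, W f * W g ≤
      ∑ a, W (Function.update g a (f a₀)) * W (Function.update f a₀ (g a)))
    (hlow : ∀ β ≤ N, ∃ f, Function.Injective f ∧
      c * Real.exp (j * σ * (2 * l - (1 + r i₀) * (β * τ)) - (∑ a, wt r (f a)) * (β * τ) -
        if ∃ a, f a = some i₀ then 2 * l - (1 + r i₀) * (β * τ) else 0) ≤ W f)
    (hbig₁ : C₁ < c * Real.exp (j * σ * l / 2))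
    (hbig₂ : j * C₁ * Real.exp (2 * τ) < c ^ 2 * Real.exp (j * σ * l)) : False := by
  have hr0 := hpos i₀
  have hr1 : r i₀ ≤ 1 := by
    rw [← hr]
    exact Finset.single_le_sum (fun i _ => (hpos i).le) (Finset.mem_univ i₀)
  set q := (j : ℝ) * σ with hq
  have hq0 : 0 ≤ q := by positivity
  have hqr : q * (1 + r i₀) ≤ ν := by nlinarith
  have hνr₀ := hνr i₀
  -- the two absurd comparisons
  have habs : ∀ A B : ℝ, 2 * (q * l) ≤ A → B ≤ 3 / 2 * (q * l) → ∀ s, ∀ w : ℝ,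
      c * Real.exp (A - s) ≤ w → w ≤ C₁ * Real.exp (B - s) → False := by
    intro A B hA hB s w h1 h2
    have h3 : c * Real.exp (A - s) ≤ C₁ * Real.exp (B - s) := h1.trans h2
    have h4 : c * Real.exp (q * l / 2) * Real.exp (3 / 2 * (q * l) - s) ≤ c * Real.exp (A - s) := by
      rw [mul_assoc, ← Real.exp_add]
      gcongr
      linarith
    have h5 : C₁ * Real.exp (B - s) ≤ C₁ * Real.exp (3 / 2 * (q * l) - s) := by gcongr
    have h6 := (h4.trans h3).trans h5
    exact absurd (le_of_mul_le_mul_right h6 (Real.exp_pos _)) (not_le.2 hbig₁)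
  have hC₁up : ∀ e : ℝ, Real.exp e ≤ C₁ * Real.exp e := fun e =>
    le_mul_of_one_le_left (Real.exp_pos _).le hC₁
  have hkey : ∀ β : ℕ, 2 * (q * l) ≤ q * (2 * l - (1 + r i₀) * (β * τ)) + ν * (β * τ) := by
    intro β
    have : 0 ≤ (β : ℝ) * τ := by positivity
    nlinarith
  -- every minor from Minkowski's theorem is of pure or of mixed type
  have htype : ∀ β ≤ N, ∀ f, Function.Injective f →
      c * Real.exp (q * (2 * l - (1 + r i₀) * (β * τ)) - (∑ a, wt r (f a)) * (β * τ) -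
        if ∃ a, f a = some i₀ then 2 * l - (1 + r i₀) * (β * τ) else 0) ≤ W f →
      ((∃ a, f a = none) ↔ ∃ a, f a = some i₀) := by
    intro β hβ f hf hle
    have hb : 0 ≤ (β : ℝ) * τ := by positivity
    constructor
    · intro h0
      by_contra h1
      rw [if_neg h1] at hle
      have hS := sum_wt_le_neg_of_hits hpos hr hf h0 (i := i₀) (fun a ha => h1 ⟨a, ha⟩)
      refine habs _ _ ?_ le_rfl 0 _ hle (by rw [sub_zero]; exact (hup f).trans (hC₁up _))
      nlinarith [hkey β]
    · intro h1
      by_contra h0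
      rw [if_pos h1] at hle
      have h0' : ∀ a, f a ≠ none := fun a ha => h0 ⟨a, ha⟩
      have hS := sum_wt_le_one hpos hr hf h0'
      refine habs (q * (2 * l - (1 + r i₀) * (β * τ)) - (∑ a, wt r (f a)) * (β * τ) +
        (1 + r i₀) * (β * τ)) _ ?_ le_rfl (2 * l) _ (le_trans (le_of_eq ?_) hle) (hup₁ f h1 h0')
      · nlinarith [hkey β]
      · congr 2
        ring
  have hind : ∀ β ≤ N, ∃ f, Function.Injective f ∧ (∃ a, f a = none) ∧ (∃ a, f a = some i₀) ∧
      c * Real.exp (q * (2 * l - (1 + r i₀) * (β * τ)) - (∑ a, wt r (f a)) * (β * τ) -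
        (2 * l - (1 + r i₀) * (β * τ))) ≤ W f := by
    intro β
    induction β with
    | zero =>
      intro _
      obtain ⟨f, hf, hle⟩ := hlow 0 (Nat.zero_le _)
      have ht := htype 0 (Nat.zero_le _) f hf hle
      by_cases h1 : ∃ a, f a = some i₀
      · rw [if_pos h1] at hle
        exact ⟨f, hf, ht.2 h1, h1, hle⟩
      · exfalso
        rw [if_neg h1] at hle
        refine habs _ _ ?_ le_rfl 0 _ hle (by rw [sub_zero]; exact (hup f).trans (hC₁up _))
        simp
        linarith
    | succ β ih =>
      intro hβ
      obtain ⟨f, hf, ⟨a₀, ha₀⟩, hf1, hfle⟩ := ih (by omega)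
      obtain ⟨g, hg, hgle⟩ := hlow (β + 1) hβ
      have ht := htype _ hβ g hg hgle
      by_cases h1 : ∃ a, g a = some i₀
      · rw [if_pos h1] at hgle
        exact ⟨g, hg, ht.2 h1, h1, hgle⟩
      exfalso
      rw [if_neg h1] at hgle
      have hg0 : ∀ a, g a ≠ none := fun a ha => h1 (ht.1 ⟨a, ha⟩)
      have hg1 : ∀ a, g a ≠ some i₀ := fun a ha => h1 ⟨a, ha⟩
      have hSf := sum_wt_le_of_hits hpos hr hf ⟨a₀, ha₀⟩
      have hSg := sum_wt_le_one_sub hpos hr hg hg0 hg1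
      have hb : 0 ≤ (β : ℝ) * τ := by positivity
      have hterm : ∀ a ∈ (Finset.univ : Finset (Fin j)),
          W (Function.update g a (f a₀)) * W (Function.update f a₀ (g a)) ≤
            C₁ * Real.exp (3 * (q * l) - 2 * l) := by
        intro a _
        have hf' : ∀ b, Function.update f a₀ (g a) b ≠ none := by
          intro b
          by_cases hb : b = a₀
          · rw [hb, Function.update_self]
            exact hg0 a
          · rw [Function.update_of_ne hb]
            exact fun h => hb (hf (h.trans ha₀.symm))
        have hf1' : ∃ b, Function.update f a₀ (g a) b = some i₀ := by
          obtain ⟨b, hb⟩ := hf1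
          refine ⟨b, ?_⟩
          rw [Function.update_of_ne, hb]
          rintro rfl
          rw [ha₀] at hb
          cases hb
        calc _ ≤ Real.exp (3 / 2 * (q * l)) * (C₁ * Real.exp (3 / 2 * (q * l) - 2 * l)) :=
              mul_le_mul (hup _) (hup₁ _ hf1' hf') (hW _) (Real.exp_pos _).le
          _ = _ := by
              rw [mul_left_comm, ← Real.exp_add]
              congr 2
              ring
      have hsum := (hpl f g a₀).trans (Finset.sum_le_sum hterm)
      rw [Finset.sum_const, Finset.card_univ, Fintype.card_fin, nsmul_eq_mul] at hsum
      have hprod := (mul_le_mul hfle hgle (by positivity) (hW f)).trans hsum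
      have hexp : c ^ 2 * Real.exp (4 * (q * l) - 2 * l - 2 * τ) ≤ _ * _ := le_trans (by
        rw [pow_two, mul_mul_mul_comm, ← Real.exp_add]
        gcongr
        push_cast
        have e1 : (∑ a, wt r (g a)) * ((β + 1) * τ) ≤ (1 - r i₀) * ((β + 1) * τ) := by
          gcongr
        have e2 : (∑ a, wt r (f a)) * (β * τ) ≤ 0 := mul_nonpos_of_nonpos_of_nonneg hSf hb
        have e3 : q * (1 + r i₀) * (β * τ) ≤ r i₀ * (β * τ) := by
          gcongr
          linarith
        have e4 : q * (1 + r i₀) * τ ≤ 1 * τ := by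
          gcongr
          linarith
        have e5 : 0 ≤ r i₀ * τ := by positivity
        nlinarith) hprod
      have h4 : j * (C₁ * Real.exp (3 * (q * l) - 2 * l)) <
          c ^ 2 * Real.exp (4 * (q * l) - 2 * l - 2 * τ) := by
        have := mul_lt_mul_of_pos_right hbig₂ (Real.exp_pos (3 * (q * l) - 2 * l - 2 * τ))
        rw [mul_assoc (j * C₁), mul_assoc (c ^ 2), ← Real.exp_add, ← Real.exp_add,
          mul_assoc (j : ℝ)] at this
        have e1 : 2 * τ + (3 * (q * l) - 2 * l - 2 * τ) = 3 * (q * l) - 2 * l := by ring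
        have e2 : q * l + (3 * (q * l) - 2 * l - 2 * τ) = 4 * (q * l) - 2 * l - 2 * τ := by ring
        rwa [e1, e2] at this
      exact absurd hexp (not_le.2 h4)
  obtain ⟨f, hf, h0, h1, hle⟩ := hind N le_rfl
  obtain ⟨i, hi⟩ := exists_missing hj h0
  have hS := sum_wt_le_neg_of_hits hpos hr hf h0 hi
  have hb : 0 ≤ (N : ℝ) * τ := by positivity
  refine habs (q * (2 * l - (1 + r i₀) * (N * τ)) - (∑ a, wt r (f a)) * (N * τ)) _ ?_ le_rfl l _
    (le_trans (le_of_eq ?_) hle) ((hup' f h1).trans (hC₁up _))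
  · nlinarith [hkey N, hνr i]
  · congr 2
    rw [hl]
    ring

end Weights

/-! ### Quantitative bounds for the curve -/

section CurveBounds

variable {I : Type*}

/-- Weights, ordered so that `r i₀` is the largest one, together with bounds for the derivatives
of the curve on `I₀`. -/
structure CurveBounds (r : I → ℝ) (i₀ : I) (φ : I → ℝ → ℝ) (I₀ : Set ℝ) (B b ν : ℝ) : Prop where
  r_le : ∀ i, r i ≤ r i₀
  ν_pos : 0 < ν
  le_r : ∀ i, ν ≤ r i
  one_le_B : 1 ≤ B
  b_pos : 0 < b
  differentiable : ∀ i, ∀ x ∈ I₀, DifferentiableAt ℝ (φ i) x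
  deriv_le : ∀ i, ∀ x ∈ I₀, |deriv (φ i) x| ≤ B
  deriv_lip : ∀ i, ∀ x ∈ I₀, ∀ y ∈ I₀, |deriv (φ i) x - deriv (φ i) y| ≤ B * |x - y|
  lower : ∀ x ∈ I₀, b ≤ |deriv (φ i₀) x|

variable {r : I → ℝ} {i₀ : I} {φ : I → ℝ → ℝ} {I₀ : Set ℝ} {B b ν : ℝ}

theorem CurveBounds.r_pos (h : CurveBounds r i₀ φ I₀ B b ν) (i : I) : 0 < r i :=
  h.ν_pos.trans_le (h.le_r i)

theorem CurveBounds.differentiableAt_hatFun (h : CurveBounds r i₀ φ I₀ B b ν) (p : Option I)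
    {x : ℝ} (hx : x ∈ I₀) : DifferentiableAt ℝ (hatFun φ p) x := by
  cases p with
  | none => exact differentiableAt_const _
  | some i => exact h.differentiable i x hx

theorem CurveBounds.deriv_hatFun_le (h : CurveBounds r i₀ φ I₀ B b ν) (p : Option I)
    {x : ℝ} (hx : x ∈ I₀) : |deriv (hatFun φ p) x| ≤ B := by
  cases p with
  | none => rw [deriv_hatFun_none, abs_zero]; linarith [h.one_le_B]
  | some i => exact h.deriv_le i x hx

theorem CurveBounds.deriv_hatFun_lip (h : CurveBounds r i₀ φ I₀ B b ν) (p : Option I)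
    {x y : ℝ} (hx : x ∈ I₀) (hy : y ∈ I₀) :
    |deriv (hatFun φ p) x - deriv (hatFun φ p) y| ≤ B * |x - y| := by
  cases p with
  | none =>
    rw [deriv_hatFun_none, deriv_hatFun_none, sub_zero, abs_zero]
    have := h.one_le_B
    positivity
  | some i => exact h.deriv_lip i x hx y hy

variable [Fintype I]

/-- The bound for the coefficients of a combination in terms of its derivative. -/
noncomputable def coeffConst (I : Type*) [Fintype I] (B b : ℝ) : ℝ :=
  (1 + Fintype.card (Option I) * B) / b + 1

theorem CurveBounds.one_le_coeffConst (h : CurveBounds r i₀ φ I₀ B b ν) :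
    1 ≤ coeffConst I B b := by
  have := h.one_le_B
  have := h.b_pos
  unfold coeffConst
  have : 0 ≤ (1 + Fintype.card (Option I) * B) / b := by positivity
  linarith

/-- The combination `∑ cₚ φ̂ₚ`. -/
noncomputable def hatComb (φ : I → ℝ → ℝ) (c : Option I → ℝ) (x : ℝ) : ℝ :=
  ∑ p, hatFun φ p x * c p

/-- The derivative of `∑ cₚ φ̂ₚ`. -/
noncomputable def hatComb' (φ : I → ℝ → ℝ) (c : Option I → ℝ) (x : ℝ) : ℝ :=
  ∑ p, deriv (hatFun φ p) x * c p

theorem CurveBounds.hasDerivAt_hatComb (h : CurveBounds r i₀ φ I₀ B b ν) (c : Option I → ℝ)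
    {x : ℝ} (hx : x ∈ I₀) : HasDerivAt (hatComb φ c) (hatComb' φ c x) x :=
  HasDerivAt.fun_sum fun p _ => (h.differentiableAt_hatFun p hx).hasDerivAt.mul_const _

theorem CurveBounds.hatComb_lip (h : CurveBounds r i₀ φ I₀ B b ν) (c : Option I → ℝ)
    {y ρ A : ℝ} (hy : Metric.closedBall y ρ ⊆ I₀)
    (hA : ∀ x ∈ Metric.closedBall y ρ, |hatComb' φ c x| ≤ A) {x x' : ℝ}
    (hx : x ∈ Metric.closedBall y ρ) (hx' : x' ∈ Metric.closedBall y ρ) :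
    |hatComb φ c x' - hatComb φ c x| ≤ A * |x' - x| :=
  (convex_closedBall y ρ).norm_image_sub_le_of_norm_hasDerivWithin_le
    (fun _ hz => (h.hasDerivAt_hatComb c (hy hz)).hasDerivWithinAt) hA hx hx'

theorem CurveBounds.hatComb'_lip (h : CurveBounds r i₀ φ I₀ B b ν) {c : Option I → ℝ} {A : ℝ}
    (hA : 0 ≤ A) (hc : ∀ p, p ≠ none → |c p| ≤ A) {x y : ℝ} (hx : x ∈ I₀) (hy : y ∈ I₀) :
    |hatComb' φ c x - hatComb' φ c y| ≤ Fintype.card (Option I) * B * A * |x - y| := by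
  have hB := h.one_le_B
  unfold hatComb'
  rw [← Finset.sum_sub_distrib]
  refine (Finset.abs_sum_le_sum_abs _ _).trans ?_
  have : ∀ p ∈ (Finset.univ : Finset (Option I)),
      |deriv (hatFun φ p) x * c p - deriv (hatFun φ p) y * c p| ≤ B * A * |x - y| := by
    intro p _
    by_cases hp : p = none
    · rw [hp, deriv_hatFun_none, deriv_hatFun_none]
      simp only [zero_mul, sub_zero, abs_zero]
      positivity
    rw [← sub_mul, abs_mul]
    calc _ ≤ B * |x - y| * A :=
          mul_le_mul (h.deriv_hatFun_lip p hx hy) (hc p hp) (abs_nonneg _) (by positivity)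
      _ = _ := by ring
  refine (Finset.sum_le_sum this).trans_eq ?_
  rw [Finset.sum_const, Finset.card_univ, nsmul_eq_mul]
  ring

theorem CurveBounds.coeff_le [DecidableEq I] (h : CurveBounds r i₀ φ I₀ B b ν) {c : Option I → ℝ}
    {x A : ℝ} (hx : x ∈ I₀) (h1 : |hatComb' φ c x| ≤ A)
    (h2 : ∀ p, p ≠ none → p ≠ some i₀ → |c p| ≤ A) {p : Option I} (hp : p ≠ none) :
    |c p| ≤ coeffConst I B b * A := by
  have hB := h.one_le_B
  have hb := h.b_pos
  have hA : 0 ≤ A := (abs_nonneg _).trans h1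
  by_cases hp' : p = some i₀
  swap
  · exact (h2 p hp hp').trans (le_mul_of_one_le_left hA h.one_le_coeffConst)
  rw [hp']
  have hsplit : deriv (φ i₀) x * c (some i₀) = hatComb' φ c x -
      ∑ p ∈ Finset.univ.erase (some i₀), deriv (hatFun φ p) x * c p := by
    rw [hatComb', ← Finset.add_sum_erase _ _ (Finset.mem_univ (some i₀))]
    simp [hatFun]
  have hrest : |∑ p ∈ Finset.univ.erase (some i₀), deriv (hatFun φ p) x * c p| ≤
      Fintype.card (Option I) * (B * A) := by
    refine (Finset.abs_sum_le_sum_abs _ _).trans ?_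
    have : ∀ p ∈ Finset.univ.erase (some i₀), |deriv (hatFun φ p) x * c p| ≤ B * A := by
      intro p hp
      by_cases h0 : p = none
      · rw [h0, deriv_hatFun_none, zero_mul, abs_zero]
        positivity
      · rw [abs_mul]
        exact mul_le_mul (h.deriv_hatFun_le p hx) (h2 p h0 (Finset.mem_erase.1 hp).1)
          (abs_nonneg _) (by positivity)
    refine (Finset.sum_le_card_nsmul _ _ _ this).trans ?_
    rw [nsmul_eq_mul]
    gcongr
    exact_mod_cast Finset.card_le_univ _
  have h3 : b * |c (some i₀)| ≤ (1 + Fintype.card (Option I) * B) * A := by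
    calc b * |c (some i₀)| ≤ |deriv (φ i₀) x| * |c (some i₀)| := by
          gcongr
          exact h.lower x hx
      _ = |hatComb' φ c x -
          ∑ p ∈ Finset.univ.erase (some i₀), deriv (hatFun φ p) x * c p| := by
          rw [← abs_mul, hsplit]
      _ ≤ A + Fintype.card (Option I) * (B * A) :=
          (abs_sub _ _).trans (add_le_add h1 hrest)
      _ = _ := by ring
  calc |c (some i₀)| ≤ (1 + Fintype.card (Option I) * B) * A / b := by
        rw [le_div_iff₀ hb]
        linarith
    _ = (1 + Fintype.card (Option I) * B) / b * A := by ring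
    _ ≤ _ := by
        unfold coeffConst
        gcongr
        linarith

/-- A point where the derivative is controlled by the size of the function. -/
theorem CurveBounds.exists_hatComb'_le (h : CurveBounds r i₀ φ I₀ B b ν) (c : Option I → ℝ)
    {y ρ A : ℝ} (hρ : 0 < ρ) (hy : Metric.closedBall y ρ ⊆ I₀)
    (hA : ∀ x ∈ Metric.closedBall y ρ, |hatComb φ c x| ≤ A) :
    ∃ ξ ∈ Metric.closedBall y ρ, |hatComb' φ c ξ| ≤ 2 * A / ρ := by
  have hIcc : Icc y (y + ρ) ⊆ Metric.closedBall y ρ := by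
    rw [Real.closedBall_eq_Icc]
    exact Icc_subset_Icc (by linarith) le_rfl
  obtain ⟨ξ, hξ, he⟩ := exists_hasDerivAt_eq_slope (hatComb φ c) (hatComb' φ c)
    (show y < y + ρ by linarith)
    (fun x hx => (h.hasDerivAt_hatComb c (hy (hIcc hx))).continuousAt.continuousWithinAt)
    (fun x hx => h.hasDerivAt_hatComb c (hy (hIcc (Ioo_subset_Icc_self hx))))
  refine ⟨ξ, hIcc (Ioo_subset_Icc_self hξ), ?_⟩
  rw [he, abs_div, add_sub_cancel_left, abs_of_pos hρ]
  gcongr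
  refine (abs_sub _ _).trans ?_
  have h1 := hA (y + ρ) (hIcc (right_mem_Icc.2 (by linarith)))
  have h2 := hA y (hIcc (left_mem_Icc.2 (by linarith)))
  linarith

/-! ### Enlarging the dangerous sets -/

variable [DecidableEq I]

/-- The exponents of the box defining the dangerous sets. -/
noncomputable def bnd (r : I → ℝ) (i₀ : I) (σ t l : ℝ) (o : Option I) : ℝ :=
  σ * l + wt r o * t - if o = some i₀ then l else 0

/-- The dangerous condition at `x`: the curve lattice has a nonzero vector in the box. -/
def Danger (φ : I → ℝ → ℝ) (r : I → ℝ) (i₀ : I) (σ ε t l x : ℝ) : Prop :=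
  ∃ a : Option I → ℤ, a ≠ 0 ∧ ∀ o, |(curveMat φ i₀ x).mulVec (fun p => (a p : ℝ)) o| <
    ε * Real.exp (bnd r i₀ σ t l o)

/-- The constant in the enlargement of dangerous sets. -/
noncomputable def enlargeConst (I : Type*) [Fintype I] (B b : ℝ) : ℝ :=
  3 + 4 * Fintype.card (Option I) * B * coeffConst I B b

theorem mulVec_curveMat_none (a : Option I → ℝ) (x : ℝ) :
    (curveMat φ i₀ x).mulVec a none = hatComb φ a x := rfl

theorem mulVec_curveMat_self (a : Option I → ℝ) (x : ℝ) :
    (curveMat φ i₀ x).mulVec a (some i₀) = hatComb' φ a x := by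
  rw [Matrix.mulVec, curveMat_self]
  rfl

theorem mulVec_curveMat_other (a : Option I → ℝ) (x : ℝ) {o : Option I} (h0 : o ≠ none)
    (h1 : o ≠ some i₀) : (curveMat φ i₀ x).mulVec a o = a o := by
  rw [Matrix.mulVec, curveMat_other h0 h1]
  simp

theorem CurveBounds.enlarge (h : CurveBounds r i₀ φ I₀ B b ν) {σ ε t l y ρ : ℝ}
    (hε : 0 < ε) (ht : 0 ≤ t) (hl : 0 ≤ l) (hlt : 2 * l ≤ (1 + r i₀) * t)
    (hy : Metric.closedBall y ρ ⊆ I₀) (hρ : ρ ≤ Real.exp (-(1 + r i₀) * t + l)) {x x' : ℝ}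
    (hx : x ∈ Metric.closedBall y ρ) (hx' : x' ∈ Metric.closedBall y ρ) {a : Option I → ℝ}
    (ha : ∀ o, |(curveMat φ i₀ x).mulVec a o| ≤ ε * Real.exp (bnd r i₀ σ t l o)) (o : Option I) :
    |(curveMat φ i₀ x').mulVec a o| ≤
      enlargeConst I B b * (ε * Real.exp (bnd r i₀ σ t l o)) := by
  have hB := h.one_le_B
  have hcc := h.one_le_coeffConst
  have hr0 := h.r_pos i₀
  set X := ε * Real.exp (σ * l) with hX
  have hX0 : 0 < X := by positivity
  have hbnone : ε * Real.exp (bnd r i₀ σ t l none) = X * Real.exp (-t) := by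
    rw [hX, mul_assoc, ← Real.exp_add]
    simp [bnd, wt_none]
  have hbself : ε * Real.exp (bnd r i₀ σ t l (some i₀)) = X * Real.exp (r i₀ * t - l) := by
    rw [hX, mul_assoc, ← Real.exp_add]
    congr 2
    simp only [bnd, wt_some, if_true]
    ring
  have hC : 1 ≤ enlargeConst I B b := by
    unfold enlargeConst
    have : 0 ≤ 4 * Fintype.card (Option I) * B * coeffConst I B b := by positivity
    linarith
  have hxx : ∀ z ∈ Metric.closedBall y ρ, |z - x| ≤ 2 * Real.exp (-(1 + r i₀) * t + l) := by
    intro z hz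
    rw [Metric.mem_closedBall, Real.dist_eq, abs_le] at hz hx
    rw [abs_le]
    constructor <;> linarith
  have hF := ha none
  have hF' := ha (some i₀)
  rw [mulVec_curveMat_none, hbnone] at hF
  rw [mulVec_curveMat_self, hbself] at hF'
  set K : ℝ := (Fintype.card (Option I) : ℝ) with hK
  have hK0 : 0 ≤ K := Nat.cast_nonneg _
  have hcoef : ∀ p, p ≠ none → |a p| ≤ coeffConst I B b * (X * Real.exp (r i₀ * t)) := by
    intro p hp
    refine h.coeff_le (hy hx) (hF'.trans ?_) (fun q hq hq' => ?_) hp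
    · gcongr
      linarith
    · have h1 := ha q
      rw [mulVec_curveMat_other a x hq hq'] at h1
      refine h1.trans ?_
      rw [hX, mul_assoc, ← Real.exp_add]
      obtain ⟨i, rfl⟩ := Option.ne_none_iff_exists'.1 hq
      have := mul_le_mul_of_nonneg_right (h.r_le i) ht
      rw [bnd, if_neg hq', wt_some]
      gcongr
      linarith
  have hF'z : ∀ z ∈ Metric.closedBall y ρ, |hatComb' φ a z| ≤
      (1 + 2 * K * B * coeffConst I B b) * (X * Real.exp (r i₀ * t - l)) := by
    intro z hz
    have h1 := h.hatComb'_lip (c := a) (A := coeffConst I B b * (X * Real.exp (r i₀ * t)))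
      (by positivity) hcoef (hy hz) (hy hx)
    have h2 : K * B * (coeffConst I B b * (X * Real.exp (r i₀ * t))) * |z - x| ≤
        2 * K * B * coeffConst I B b * (X * Real.exp (r i₀ * t - l)) := by
      calc _ ≤ K * B * (coeffConst I B b * (X * Real.exp (r i₀ * t))) *
            (2 * Real.exp (-(1 + r i₀) * t + l)) := by
            gcongr
            exact hxx z hz
        _ = 2 * K * B * coeffConst I B b *
            (X * (Real.exp (r i₀ * t) * Real.exp (-(1 + r i₀) * t + l))) := by ring
        _ ≤ _ := by
            rw [← Real.exp_add]
            gcongr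
            linarith
    calc |hatComb' φ a z| = |hatComb' φ a x + (hatComb' φ a z - hatComb' φ a x)| := by ring_nf
      _ ≤ _ := abs_add_le _ _
      _ ≤ X * Real.exp (r i₀ * t - l) +
          2 * K * B * coeffConst I B b * (X * Real.exp (r i₀ * t - l)) :=
          add_le_add hF' (h1.trans h2)
      _ = _ := by ring
  by_cases h0 : o = none
  · rw [h0, mulVec_curveMat_none, hbnone]
    have h1 := h.hatComb_lip a hy hF'z hx hx'
    have h2 : (1 + 2 * K * B * coeffConst I B b) * (X * Real.exp (r i₀ * t - l)) * |x' - x| ≤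
        (2 + 4 * K * B * coeffConst I B b) * (X * Real.exp (-t)) := by
      calc _ ≤ (1 + 2 * K * B * coeffConst I B b) * (X * Real.exp (r i₀ * t - l)) *
            (2 * Real.exp (-(1 + r i₀) * t + l)) := by
            gcongr
            exact hxx x' hx'
        _ = (2 + 4 * K * B * coeffConst I B b) *
            (X * (Real.exp (r i₀ * t - l) * Real.exp (-(1 + r i₀) * t + l))) := by ring
        _ = _ := by
            rw [← Real.exp_add]
            ring_nf
    calc |hatComb φ a x'| = |hatComb φ a x + (hatComb φ a x' - hatComb φ a x)| := by ring_nf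
      _ ≤ _ := abs_add_le _ _
      _ ≤ X * Real.exp (-t) + (2 + 4 * K * B * coeffConst I B b) * (X * Real.exp (-t)) :=
          add_le_add hF (h1.trans h2)
      _ = _ := by rw [enlargeConst]; ring
  by_cases h1 : o = some i₀
  · rw [h1, mulVec_curveMat_self, hbself]
    refine (hF'z x' hx').trans ?_
    gcongr
    rw [enlargeConst]
    have : 0 ≤ K * B * coeffConst I B b := by positivity
    linarith
  · have h2 := ha o
    rw [mulVec_curveMat_other a x h0 h1] at h2
    rw [mulVec_curveMat_other a x' h0 h1]
    exact h2.trans (le_mul_of_one_le_left (by positivity) hC)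

end CurveBounds

/-! ### Lower bounds for the minors on balls -/

section Scaled

variable {I : Type*} [Fintype I] [DecidableEq I] {r : I → ℝ} {i₀ : I} {φ : I → ℝ → ℝ}
  {I₀ : Set ℝ} {B b ν : ℝ} {j : ℕ}

/-- The curve matrix, rescaled by the box of the dangerous sets. -/
noncomputable def scaled (φ : I → ℝ → ℝ) (r : I → ℝ) (i₀ : I) (σ ε t l s x : ℝ) :
    Matrix (Option I) (Option I) ℝ :=
  Matrix.diagonal (fun o => ε⁻¹ * Real.exp (-bnd r i₀ σ t l o - s)) * curveMat φ i₀ x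

theorem sum_bnd {J : Type*} [DecidableEq J] {r : J → ℝ} {i₀ : J} {f : Fin j → Option J}
    (hf : Function.Injective f) (σ t l : ℝ) :
    ∑ a, bnd r i₀ σ t l (f a) = j * σ * l + (∑ a, wt r (f a)) * t -
      if ∃ a, f a = some i₀ then l else 0 := by
  unfold bnd
  rw [Finset.sum_sub_distrib, Finset.sum_add_distrib, Finset.sum_const,
    Finset.card_univ, Fintype.card_fin, nsmul_eq_mul, ← Finset.sum_mul, ← mul_assoc]
  refine congrArg₂ _ rfl ?_
  split_ifs with h
  · obtain ⟨a, ha⟩ := h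
    rw [Finset.sum_eq_single a]
    · rw [if_pos ha]
    · intro a' _ hne
      exact if_neg fun h => hne (hf (h.trans ha.symm))
    · simp
  · exact Finset.sum_eq_zero fun a _ => if_neg fun h' => h ⟨a, h'⟩

theorem abs_mnr_scaled {σ ε t l s x : ℝ} (hε : 0 < ε) (N : Matrix (Option I) (Fin j) ℝ)
    (f : Fin j → Option I) :
    |mnr (scaled φ r i₀ σ ε t l s x * N) f| =
      (ε ^ j)⁻¹ * Real.exp (-∑ a, bnd r i₀ σ t l (f a) - j * s) *
        |mnr (curveMat φ i₀ x * N) f| := by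
  rw [scaled, Matrix.mul_assoc, mnr_diagonal_mul, abs_mul, Finset.prod_mul_distrib,
    ← Real.exp_sum, abs_of_pos]
  · congr 2
    · simp
    · simp [Finset.sum_sub_distrib]
  · exact mul_pos (Finset.prod_pos fun _ _ => inv_pos.2 hε) (Real.exp_pos _)

theorem abs_mnr_lt_of_scaled_lt {σ ε t l x : ℝ} (hε : 0 < ε) {N : Matrix (Option I) (Fin j) ℝ}
    {f : Fin j → Option I} (hf : Function.Injective f)
    (h : |mnr (scaled φ r i₀ σ ε t l (σ * l / 2) x * N) f| < 1) :
    |mnr (curveMat φ i₀ x * N) f| < ε ^ j * Real.exp (3 / 2 * (j * σ * l) +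
      (∑ a, wt r (f a)) * t - if ∃ a, f a = some i₀ then l else 0) := by
  rw [abs_mnr_scaled hε, sum_bnd hf] at h
  set w : ℝ := if ∃ a, f a = some i₀ then l else 0
  have e : -(j * σ * l + (∑ a, wt r (f a)) * t - w) - j * (σ * l / 2) =
      -(3 / 2 * (j * σ * l) + (∑ a, wt r (f a)) * t - w) := by ring
  rw [e, Real.exp_neg, ← mul_inv, inv_mul_lt_iff₀ (by positivity), mul_one] at h
  exact h

theorem exists_one_le_of_both (h : CurveBounds r i₀ φ I₀ B b ν) (hr : ∑ i, r i = 1)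
    {σ ε t l x : ℝ} (hε : 0 < ε) (hε1 : ε ≤ 1) (hεb : ε ≤ b) (ht : 0 ≤ t)
    (hσl : 3 / 2 * (j * σ * l) ≤ l) (hj : 1 ≤ j) (hx : x ∈ I₀) {v : Fin j → Option I → ℤ}
    (hv : ∃ f, mnr (intMat v) f ≠ 0)
    (hboth : ∀ f, mnr (intMat v) f ≠ 0 → (∃ a, f a = none) ∧ ∃ a, f a = some i₀) :
    ∃ f, 1 ≤ |mnr (scaled φ r i₀ σ ε t l (σ * l / 2) x * intMat v) f| := by
  by_contra! hcon
  obtain ⟨f, hf⟩ := hv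
  have hinj : Function.Injective f := by
    by_contra h'
    exact hf (mnr_eq_zero_of_not_injective _ h')
  obtain ⟨h0, h1⟩ := hboth f hf
  have h2 := abs_mnr_lt_of_scaled_lt hε hinj (hcon f)
  rw [mnr_curveMat_both hboth hf, if_pos h1, abs_mul] at h2
  have h3 : 1 ≤ |mnr (intMat v) f| := by
    rw [mnr_intMat] at hf ⊢
    exact_mod_cast Int.one_le_abs (by exact_mod_cast hf)
  have h4 : Real.exp (3 / 2 * (j * σ * l) + (∑ a, wt r (f a)) * t - l) ≤ 1 := by
    rw [Real.exp_le_one_iff]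
    have := mul_nonpos_of_nonpos_of_nonneg (sum_wt_le_of_hits h.r_pos hr hinj h0) ht
    linarith
  have h5 : ε ^ j ≤ ε := pow_le_of_le_one hε.le hε1 (by omega)
  have h6 : b * 1 ≤ |deriv (φ i₀) x| * |mnr (intMat v) f| :=
    mul_le_mul (h.lower x hx) h3 zero_le_one (abs_nonneg _)
  have h7 : ε ^ j * Real.exp (3 / 2 * (j * σ * l) + (∑ a, wt r (f a)) * t - l) ≤ ε * 1 :=
    mul_le_mul h5 h4 (Real.exp_pos _).le hε.le
  linarith

theorem le_card_option {J : Type*} [Fintype J] {v : Fin j → Option J → ℤ}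
    (hv : ∃ f, mnr (intMat v) f ≠ 0) : j ≤ Fintype.card (Option J) := by
  obtain ⟨f, hf⟩ := hv
  have hinj : Function.Injective f := by
    by_contra h'
    exact hf (mnr_eq_zero_of_not_injective _ h')
  simpa using Fintype.card_le_of_injective f hinj

/-- Nondivergence condition on a large ball. -/
theorem exists_one_le_scaled_of_lower (h : CurveBounds r i₀ φ I₀ B b ν) (hr : ∑ i, r i = 1)
    {c₁ : ℝ} {m : ℕ} {y ρ : ℝ}
    (hlow : ∀ c : Option I → ℝ, (∃ p, 1 ≤ |c p|) →
      ∃ x ∈ Metric.closedBall y ρ, c₁ * ρ ^ m ≤ |hatComb φ c x|)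
    {σ ε t l : ℝ} (hε : 0 < ε) (hε1 : ε ≤ 1) (hεb : ε ≤ b) (ht : 0 ≤ t) (hl : 0 ≤ l) (hσ : 0 ≤ σ)
    (hσl : 3 / 2 * (Fintype.card (Option I) * σ * l) ≤ l)
    (hσt : 3 / 2 * (Fintype.card (Option I) * σ * l) ≤ r i₀ * t / 2)
    (hρ : 0 < ρ) (hy : Metric.closedBall y ρ ⊆ I₀)
    (hεc : ε * Real.exp (-(r i₀ * t / 2)) ≤ c₁ * ρ ^ m) (hj : 1 ≤ j) {v : Fin j → Option I → ℤ}
    (hv : ∃ f, mnr (intMat v) f ≠ 0) :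
    ∃ x ∈ Metric.closedBall y ρ,
      ∃ f, 1 ≤ |mnr (scaled φ r i₀ σ ε t l (σ * l / 2) x * intMat v) f| := by
  have hjle : (j : ℝ) ≤ Fintype.card (Option I) := by exact_mod_cast le_card_option hv
  have hjσ : 3 / 2 * (j * σ * l) ≤ 3 / 2 * (Fintype.card (Option I) * σ * l) := by gcongr
  by_cases hboth : ∀ f, mnr (intMat v) f ≠ 0 → (∃ a, f a = none) ∧ ∃ a, f a = some i₀
  · have hyy : y ∈ Metric.closedBall y ρ := Metric.mem_closedBall_self hρ.le
    exact ⟨y, hyy, exists_one_le_of_both h hr hε hε1 hεb ht (hjσ.trans hσl) hj (hy hyy) hv hboth⟩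
  push Not at hboth
  obtain ⟨f, hf, hnot⟩ := hboth
  have hinj : Function.Injective f := by
    by_contra h'
    exact hf (mnr_eq_zero_of_not_injective _ h')
  obtain ⟨a₀, ha₀⟩ : ∃ a₀, ∀ c ≠ a₀, f c ≠ none ∧ f c ≠ some i₀ := by
    by_cases h0 : ∃ a, f a = none
    · obtain ⟨a, ha⟩ := h0
      exact ⟨a, fun c hc => ⟨fun h' => hc (hinj (h'.trans ha.symm)), hnot ⟨a, ha⟩ c⟩⟩
    · push Not at h0
      by_cases h1 : ∃ a, f a = some i₀
      · obtain ⟨a, ha⟩ := h1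
        exact ⟨a, fun c hc => ⟨h0 c, fun h' => hc (hinj (h'.trans ha.symm))⟩⟩
      · push Not at h1
        exact ⟨⟨0, hj⟩, fun c _ => ⟨h0 c, h1 c⟩⟩
  obtain ⟨x, hx, hxle⟩ := hlow (fun p => mnr (intMat v) (Function.update f a₀ p)) ⟨f a₀, by
    rw [Function.update_eq_self]
    rw [mnr_intMat] at hf ⊢
    exact_mod_cast Int.one_le_abs (by exact_mod_cast hf)⟩
  refine ⟨x, hx, Function.update f a₀ none, ?_⟩
  by_contra! hlt
  have hmin : mnr (curveMat φ i₀ x * intMat v) (Function.update f a₀ none) =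
      hatComb φ (fun p => mnr (intMat v) (Function.update f a₀ p)) x :=
    mnr_curveMat_update_none _ ha₀
  have hpos : 0 < c₁ * ρ ^ m := lt_of_lt_of_le (by positivity) hεc
  have hinj' : Function.Injective (Function.update f a₀ none) := by
    by_contra h'
    rw [mnr_eq_zero_of_not_injective _ h'] at hmin
    rw [← hmin, abs_zero] at hxle
    linarith
  have hnot' : ∀ a, Function.update f a₀ none a ≠ some i₀ := by
    intro a
    by_cases ha : a = a₀
    · rw [ha, Function.update_self]
      simp
    · rw [Function.update_of_ne ha]
      exact (ha₀ a ha).2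
  have h2 := abs_mnr_lt_of_scaled_lt hε hinj' hlt
  rw [hmin, if_neg (by push Not; exact hnot'), sub_zero] at h2
  have hS := sum_wt_le_neg_of_hits h.r_pos hr hinj' ⟨a₀, Function.update_self _ _ _⟩ hnot'
  have h5 : ε ^ j ≤ ε := pow_le_of_le_one hε.le hε1 (by omega)
  have h6 : ε ^ j * Real.exp (3 / 2 * (j * σ * l) +
      (∑ a, wt r (Function.update f a₀ none a)) * t) ≤ ε * Real.exp (-(r i₀ * t / 2)) := by
    have := mul_le_mul_of_nonneg_right hS ht
    gcongr
    linarith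
  linarith

/-- The constant in the bound for the minors involving the derivative. -/
noncomputable def localConst (I : Type*) [Fintype I] (B b ℓ₀ : ℝ) : ℝ :=
  2 / ℓ₀ * (1 + Fintype.card (Option I) * B * coeffConst I B b)

/-- Bound for the minors involving the derivative row but not the row of the curve. -/
theorem CurveBounds.hatComb'_center_le (h : CurveBounds r i₀ φ I₀ B b ν) {c : Option I → ℝ}
    {y ρ ℓ₀ Y e l : ℝ} (hℓ : 0 < ℓ₀) (hℓ1 : ℓ₀ ≤ 1) (hY : 0 ≤ Y)
    (hρ : ρ = ℓ₀ * Real.exp (2 * l - e))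
    (he : 4 * l ≤ e) (hl : 0 ≤ l) (hy : Metric.closedBall y ρ ⊆ I₀)
    (h1 : ∀ x ∈ Metric.closedBall y ρ, |hatComb φ c x| ≤ Y * Real.exp (-e))
    (h2 : ∀ p, p ≠ none → p ≠ some i₀ → |c p| ≤ Y) :
    |hatComb' φ c y| ≤ localConst I B b ℓ₀ * (Y * Real.exp (-(2 * l))) := by
  have hB := h.one_le_B
  have hcc := h.one_le_coeffConst
  have hρ0 : 0 < ρ := by rw [hρ]; positivity
  obtain ⟨ξ, hξ, hle⟩ := h.exists_hatComb'_le c hρ0 hy h1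
  have hle' : |hatComb' φ c ξ| ≤ 2 / ℓ₀ * (Y * Real.exp (-(2 * l))) := by
    refine hle.trans_eq ?_
    have e1 : Real.exp (-e) = Real.exp (2 * l - e) * Real.exp (-(2 * l)) := by
      rw [← Real.exp_add]
      ring_nf
    rw [e1, hρ]
    field_simp
  have h2ℓ : 1 ≤ 2 / ℓ₀ := by
    rw [le_div_iff₀ hℓ]
    linarith
  have hcoef : ∀ p, p ≠ none → |c p| ≤ coeffConst I B b * (2 / ℓ₀ * Y) := by
    intro p hp
    refine h.coeff_le (hy hξ) (hle'.trans ?_) (fun q hq hq' => (h2 q hq hq').trans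
      (le_mul_of_one_le_left hY h2ℓ)) hp
    gcongr
    refine mul_le_of_le_one_right hY ?_
    rw [Real.exp_le_one_iff]
    linarith
  have hyy : y ∈ Metric.closedBall y ρ := Metric.mem_closedBall_self hρ0.le
  have h3 := h.hatComb'_lip (by positivity) hcoef (hy hyy) (hy hξ)
  have h4 : |y - ξ| ≤ Real.exp (-(2 * l)) := by
    rw [Metric.mem_closedBall, Real.dist_eq, abs_sub_comm, hρ] at hξ
    refine hξ.trans ((mul_le_of_le_one_left (Real.exp_pos _).le hℓ1).trans ?_)
    gcongr
    linarith
  set K : ℝ := (Fintype.card (Option I) : ℝ) with hK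
  have hK0 : 0 ≤ K := Nat.cast_nonneg _
  have h5 : K * B * (coeffConst I B b * (2 / ℓ₀ * Y)) * |y - ξ| ≤
      K * B * (coeffConst I B b * (2 / ℓ₀ * Y)) * Real.exp (-(2 * l)) := by gcongr
  calc |hatComb' φ c y| = |hatComb' φ c ξ + (hatComb' φ c y - hatComb' φ c ξ)| := by ring_nf
    _ ≤ _ := abs_add_le _ _
    _ ≤ 2 / ℓ₀ * (Y * Real.exp (-(2 * l))) +
        K * B * (coeffConst I B b * (2 / ℓ₀ * Y)) * Real.exp (-(2 * l)) :=
        add_le_add hle' (h3.trans h5)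
    _ = _ := by
        rw [localConst]
        ring

/-- Nondivergence condition on a small ball whose center avoids the dangerous sets of the
same level. -/
theorem exists_one_le_scaled_of_local (h : CurveBounds r i₀ φ I₀ B b ν) (hr : ∑ i, r i = 1)
    {σ ε τ t l ℓ₀ y ρ : ℝ} {N : ℕ} (hε : 0 < ε) (hε1 : ε ≤ 1) (hεb : ε ≤ b) (hσ : 0 ≤ σ)
    (hτ : 0 ≤ τ) (hσν : Fintype.card (Option I) * σ * 2 ≤ ν) (hl : l = N * (1 + r i₀) * τ)
    (hℓ : 0 < ℓ₀) (hℓ1 : ℓ₀ ≤ 1)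
    (hρ : ρ = ℓ₀ * Real.exp (2 * l - (1 + r i₀) * t)) (hlt : 4 * l ≤ (1 + r i₀) * t)
    (hy : Metric.closedBall y ρ ⊆ I₀)
    (hsafe : ∀ β ≤ N, ¬ Danger φ r i₀ σ ε (t - β * τ) (2 * l - (1 + r i₀) * (β * τ)) y)
    {c : ℝ} (hc : c = (1 / (Fintype.card (Option I) : ℝ)) ^ Fintype.card (Option I))
    (hbig₁ : localConst I B b ℓ₀ < c * Real.exp (σ * l / 2))
    (hbig₂ : Fintype.card (Option I) * localConst I B b ℓ₀ * Real.exp (2 * τ) <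
      c ^ 2 * Real.exp (σ * l))
    (hj : 1 ≤ j) {v : Fin j → Option I → ℤ} (hv : ∃ f, mnr (intMat v) f ≠ 0) :
    ∃ x ∈ Metric.closedBall y ρ,
      ∃ f, 1 ≤ |mnr (scaled φ r i₀ σ ε t l (σ * l / 2) x * intMat v) f| := by
  have hr0 := h.r_pos i₀
  have hB := h.one_le_B
  have hcc := h.one_le_coeffConst
  have hl0 : 0 ≤ l := by rw [hl]; positivity
  have ht0 : 0 ≤ t := by
    have : 0 ≤ (1 + r i₀) * t := by linarith
    exact nonneg_of_mul_nonneg_right this (by linarith)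
  have hρ0 : 0 < ρ := by rw [hρ]; positivity
  have hyy : y ∈ Metric.closedBall y ρ := Metric.mem_closedBall_self hρ0.le
  have hjκ := le_card_option hv
  have hjle : (j : ℝ) ≤ Fintype.card (Option I) := by exact_mod_cast hjκ
  have hj1 : (1 : ℝ) ≤ j := by exact_mod_cast hj
  have hjσ : j * σ * 2 ≤ ν := le_trans (by gcongr) hσν
  have hν1 : ν ≤ 1 := by
    refine (h.le_r i₀).trans ?_
    rw [← hr]
    exact Finset.single_le_sum (fun i _ => (h.r_pos i).le) (Finset.mem_univ i₀)
  by_contra! hcon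
  have hup : ∀ f, Function.Injective f → ∀ x ∈ Metric.closedBall y ρ,
      |mnr (curveMat φ i₀ x * intMat v) f| < ε ^ j * Real.exp (3 / 2 * (j * σ * l) +
        (∑ a, wt r (f a)) * t - if ∃ a, f a = some i₀ then l else 0) :=
    fun f hf x hx => abs_mnr_lt_of_scaled_lt hε hf (hcon x hx f)
  by_cases hjn : j ≤ Fintype.card I
  swap
  · obtain ⟨f, hf⟩ := exists_one_le_of_both (σ := σ) (l := l) h hr hε hε1 hεb ht0
      (by nlinarith) hj (hy hyy) hv (fun f hf => by
        have hinj : Function.Injective f := by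
          by_contra h'
          exact hf (mnr_eq_zero_of_not_injective _ h')
        have hsurj : Function.Surjective f :=
          ((Fintype.bijective_iff_injective_and_card f).2 ⟨hinj, by
            rw [Fintype.card_option] at hjκ ⊢
            rw [Fintype.card_fin]
            omega⟩).2
        exact ⟨hsurj _, hsurj _⟩)
    exact absurd (hcon y hyy f) (not_lt.2 hf)
  set m := fun f : Fin j → Option I => mnr (curveMat φ i₀ y * intMat v) f with hm
  set W := fun f : Fin j → Option I => (ε ^ j)⁻¹ * Real.exp (-((∑ a, wt r (f a)) * t)) * |m f|
    with hWdef
  have hWle : ∀ f e, |m f| ≤ ε ^ j * (Real.exp ((∑ a, wt r (f a)) * t) * e) → W f ≤ e := by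
    intro f e hle
    have : W f ≤ (ε ^ j)⁻¹ * Real.exp (-((∑ a, wt r (f a)) * t)) *
        (ε ^ j * (Real.exp ((∑ a, wt r (f a)) * t) * e)) := by
      simp only [hWdef]
      gcongr
    refine this.trans_eq ?_
    rw [Real.exp_neg]
    field_simp
  have hWinj : ∀ f, ¬ Function.Injective f → W f = 0 := by
    intro f hf
    simp only [hWdef, hm, mnr_eq_zero_of_not_injective _ hf, abs_zero, mul_zero]
  have hC₁ : 1 ≤ localConst I B b ℓ₀ := by
    have h2 : 1 ≤ 2 / ℓ₀ := by
      rw [le_div_iff₀ hℓ]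
      linarith
    have h3 : 0 ≤ Fintype.card (Option I) * B * coeffConst I B b := by positivity
    unfold localConst
    nlinarith
  have hc0 : 0 < c := by
    rw [hc]
    have : 0 < Fintype.card (Option I) := by omega
    positivity
  have hupW' : ∀ f, W f ≤ Real.exp (3 / 2 * (j * σ * l) -
      if ∃ a, f a = some i₀ then l else 0) := by
    intro f
    by_cases hf : Function.Injective f
    · refine hWle f _ ((hup f hf y hyy).le.trans_eq ?_)
      rw [← Real.exp_add]
      ring_nf
    · rw [hWinj f hf]
      positivity
  refine minor_weights_contradiction (i₀ := i₀) (N := N) (W := W) h.r_pos hr hjn h.le_r hσ hτ hc0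
    hC₁ hjσ hl (fun f => by positivity) ?_ ?_ ?_ ?_ ?_ ?_ ?_
  · intro f
    refine (hupW' f).trans ?_
    gcongr
    rw [sub_le_self_iff]
    split_ifs <;> linarith
  · intro f hf
    have := hupW' f
    rwa [if_pos hf] at this
  · intro f ⟨a₁, ha₁⟩ h0
    by_cases hf : Function.Injective f
    swap
    · rw [hWinj f hf]
      positivity
    have hoth : ∀ b ≠ a₁, f b ≠ none ∧ f b ≠ some i₀ := fun b hb =>
      ⟨h0 b, fun h' => hb (hf (h'.trans ha₁.symm))⟩
    have hsum : ∀ p, ∑ a, wt r (Function.update f a₁ p a) =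
        (∑ a, wt r (f a)) - r i₀ + wt r p := by
      intro p
      rw [← Finset.add_sum_erase _ _ (Finset.mem_univ a₁),
        ← Finset.add_sum_erase _ (fun a => wt r (f a)) (Finset.mem_univ a₁), ha₁, wt_some,
        Function.update_self]
      have : ∑ a ∈ Finset.univ.erase a₁, wt r (Function.update f a₁ p a) =
          ∑ a ∈ Finset.univ.erase a₁, wt r (f a) :=
        Finset.sum_congr rfl fun a ha => by
          rw [Function.update_of_ne (Finset.ne_of_mem_erase ha)]
      rw [this]
      ring
    have hnoi : ∀ p, p ≠ some i₀ → ¬ ∃ a, Function.update f a₁ p a = some i₀ := by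
      rintro p hp ⟨a, ha⟩
      by_cases haa : a = a₁
      · rw [haa, Function.update_self] at ha
        exact hp ha
      · rw [Function.update_of_ne haa] at ha
        exact (hoth a haa).2 ha
    set Y := ε ^ j * Real.exp (3 / 2 * (j * σ * l) + (∑ a, wt r (f a)) * t) with hY
    have hY0 : 0 ≤ Y := by positivity
    have hmf : m f = hatComb' φ (fun p => mnr (intMat v) (Function.update f a₁ p)) y := by
      simp only [hm]
      conv_lhs => rw [← Function.update_eq_self a₁ f, ha₁]
      exact mnr_curveMat_update_self _ hoth
    refine hWle f _ ?_
    rw [hmf]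
    refine (h.hatComb'_center_le hℓ hℓ1 hY0 hρ hlt hl0 hy (fun x hx => ?_)
      fun p hp hp' => ?_).trans_eq ?_
    · have hg : hatComb φ (fun p => mnr (intMat v) (Function.update f a₁ p)) x =
          mnr (curveMat φ i₀ x * intMat v) (Function.update f a₁ none) :=
        (mnr_curveMat_update_none _ hoth).symm
      rw [hg]
      by_cases hinj : Function.Injective (Function.update f a₁ none)
      · refine (hup _ hinj x hx).le.trans_eq ?_
        rw [if_neg (hnoi none (by simp)), hsum, wt_none, hY, mul_assoc (ε ^ j), ← Real.exp_add]
        ring_nf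
      · rw [mnr_eq_zero_of_not_injective _ hinj, abs_zero]
        positivity
    · by_cases hinj : Function.Injective (Function.update f a₁ p)
      · rw [← mnr_curveMat_pure (φ := φ) (i₀ := i₀) (x := y)]
        · refine (hup _ hinj y hyy).le.trans ?_
          rw [if_neg (hnoi p hp'), hsum, hY]
          obtain ⟨i, rfl⟩ := Option.ne_none_iff_exists'.1 hp
          have := mul_le_mul_of_nonneg_right (h.r_le i) ht0
          rw [wt_some]
          gcongr
          linarith
        · intro a
          by_cases haa : a = a₁
          · rw [haa, Function.update_self]
            exact hp
          · rw [Function.update_of_ne haa]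
            exact (hoth a haa).1
        · exact fun a ha => hnoi p hp' ⟨a, ha⟩
      · rw [mnr_eq_zero_of_not_injective _ hinj, abs_zero]
        exact hY0
    · rw [hY, Real.exp_add, sub_eq_add_neg, Real.exp_add]
      ring
  · intro f g a₀
    have hS : ∀ a, (∑ b, wt r (Function.update g a (f a₀) b)) +
        ∑ b, wt r (Function.update f a₀ (g a) b) = (∑ b, wt r (f b)) + ∑ b, wt r (g b) := by
      intro a
      have e : ∀ (f : Fin j → Option I) a o, ∑ b, wt r (Function.update f a o b) =
          (∑ b, wt r (f b)) - wt r (f a) + wt r o := by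
        intro f a o
        rw [← Finset.add_sum_erase _ _ (Finset.mem_univ a),
          ← Finset.add_sum_erase _ (fun a => wt r (f a)) (Finset.mem_univ a),
          Function.update_self]
        have : ∑ b ∈ Finset.univ.erase a, wt r (Function.update f a o b) =
            ∑ b ∈ Finset.univ.erase a, wt r (f b) :=
          Finset.sum_congr rfl fun b hb => by
            rw [Function.update_of_ne (Finset.ne_of_mem_erase hb)]
        rw [this]
        ring
      rw [e, e]
      ring
    have hprod : ∀ f g : Fin j → Option I, W f * W g = (ε ^ j)⁻¹ * (ε ^ j)⁻¹ *
        Real.exp (-((∑ a, wt r (f a)) + ∑ a, wt r (g a)) * t) * (|m f| * |m g|) := by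
      intro f g
      have : Real.exp (-((∑ a, wt r (f a)) + ∑ a, wt r (g a)) * t) =
          Real.exp (-((∑ a, wt r (f a)) * t)) * Real.exp (-((∑ a, wt r (g a)) * t)) := by
        rw [← Real.exp_add]
        ring_nf
      rw [this]
      simp only [hWdef]
      ring
    rw [hprod]
    refine (mul_le_mul_of_nonneg_left (abs_mnr_mul_le (curveMat φ i₀ y * intMat v) f g a₀)
      (by positivity)).trans_eq ?_
    rw [Finset.mul_sum]
    refine Finset.sum_congr rfl fun a _ => ?_
    rw [hprod, hS]
  · intro β hβ
    have hs := hsafe β hβ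
    set t' := t - β * τ with ht'
    set l' := 2 * l - (1 + r i₀) * (β * τ) with hl'
    have hM : ∃ f, mnr (scaled φ r i₀ σ ε t' l' 0 y * intMat v) f ≠ 0 := by
      have hd : deriv (φ i₀) y ≠ 0 := by
        intro h0
        have := h.lower y (hy hyy)
        rw [h0, abs_zero] at this
        linarith [h.b_pos]
      obtain ⟨f, hf⟩ := exists_mnr_mul_ne_zero (isUnit_det_curveMat (φ := φ) (i₀ := i₀) hd) hv
      refine ⟨f, ?_⟩
      rw [← abs_pos, abs_mnr_scaled hε]
      have := abs_pos.2 hf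
      positivity
    have hex : ∃ f, (1 / (j : ℝ)) ^ j ≤ |mnr (scaled φ r i₀ σ ε t' l' 0 y * intMat v) f| := by
      by_contra! hlt'
      obtain ⟨a, ha, hlt''⟩ := exists_int_mul_lt _ v hM hlt'
      refine hs ⟨a, ha, fun o => ?_⟩
      have := hlt'' o
      rw [scaled, ← Matrix.mulVec_mulVec, Matrix.mulVec_diagonal, abs_mul, sub_zero,
        abs_of_pos (by positivity), Real.exp_neg, ← mul_inv, inv_mul_lt_iff₀ (by positivity),
        mul_one] at this
      exact this
    obtain ⟨f, hf⟩ := hex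
    have hcj : c ≤ (1 / (j : ℝ)) ^ j := by
      rw [hc]
      calc (1 / (Fintype.card (Option I) : ℝ)) ^ Fintype.card (Option I)
          ≤ (1 / (Fintype.card (Option I) : ℝ)) ^ j := by
            refine pow_le_pow_of_le_one (by positivity) ?_ hjκ
            rw [div_le_one (by linarith)]
            linarith
        _ ≤ _ := by gcongr
    have hinj : Function.Injective f := by
      by_contra h'
      rw [mnr_eq_zero_of_not_injective _ h', abs_zero] at hf
      linarith
    refine ⟨f, hinj, ?_⟩
    have h1 := hcj.trans hf
    rw [abs_mnr_scaled hε, sum_bnd hinj, mul_zero, sub_zero] at h1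
    set w : ℝ := if ∃ a, f a = some i₀ then l' else 0
    calc _ ≤ (ε ^ j)⁻¹ * Real.exp (-(j * σ * l' + (∑ a, wt r (f a)) * t' - w)) * |m f| *
          Real.exp (j * σ * l' - (∑ a, wt r (f a)) * (β * τ) - w) := by gcongr
      _ = (ε ^ j)⁻¹ * (Real.exp (-(j * σ * l' + (∑ a, wt r (f a)) * t' - w)) *
          Real.exp (j * σ * l' - (∑ a, wt r (f a)) * (β * τ) - w)) * |m f| := by ring
      _ = W f := by
          rw [← Real.exp_add]
          simp only [hWdef]
          congr 3
          rw [ht']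
          ring
  · refine hbig₁.trans_le ?_
    gcongr
    have : 0 ≤ σ * l := by positivity
    nlinarith
  · refine lt_of_le_of_lt ?_ (hbig₂.trans_le ?_)
    · gcongr
    · gcongr
      have : 0 ≤ σ * l := by positivity
      nlinarith

end Scaled

/-! ### Measure of the dangerous sets -/

section Measure

variable {I : Type*} [Fintype I] {φ : I → ℝ → ℝ}

theorem exists_hatComb_lower {U : Set ℝ} (hφ : ∀ i, AnalyticOnNhd ℝ (φ i) U) (hU : IsOpen U)
    (hUc : IsPreconnected U) {x₀ : ℝ} (hx₀ : x₀ ∈ U)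
    (hnd : ∀ c : Option I → ℝ, (∀ x ∈ U, hatComb φ c x = 0) → c = 0) :
    ∃ (m : ℕ) (δ c₁ : ℝ), 0 < δ ∧ 0 < c₁ ∧ Metric.closedBall x₀ δ ⊆ U ∧
      ∀ c : Option I → ℝ, (∃ p, 1 ≤ |c p|) → ∀ y ρ : ℝ, 0 < ρ → ρ ≤ 1 →
        Metric.closedBall y ρ ⊆ Metric.closedBall x₀ δ →
        ∃ x ∈ Metric.closedBall y ρ, c₁ * ρ ^ m ≤ |hatComb φ c x| := by
  have hcomb : ∀ c, derivComb (hatFun φ) c 0 = hatComb φ c := by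
    intro c
    funext x
    simp [derivComb, hatComb, mul_comm]
  obtain ⟨m, δ, c₀, C₀, hδ, hc₀, hsub, hb⟩ := exists_derivComb_bounds
    (analyticOnNhd_hatFun hφ) hU hUc hx₀ ⊤ (fun c _ h => hnd c fun x hx => by
      rw [← hcomb]
      exact h x hx)
  refine ⟨m, δ, c₀ / 2 ^ (m * m) / 2, hδ, by positivity, hsub, ?_⟩
  rintro c ⟨p, hp⟩ y ρ hρ hρ1 hy
  by_contra! hcon
  obtain ⟨j, hj, hjb⟩ := hb c trivial
  have hc1 : 1 ≤ ‖c‖ := hp.trans (norm_le_pi_norm c p)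
  have h1 := le_of_abs_deriv_ge (g := derivComb (hatFun φ) c) (A := c₀)
    (ε := c₀ / 2 ^ (m * m) / 2 * ρ ^ m) (k := j) hρ
    (fun i x hx => hasDerivAt_derivComb (analyticOnNhd_hatFun hφ) c i (hsub (hy hx)))
    (fun x hx => by
      rw [hcomb]
      exact (hcon x hx).le)
    (fun x hx => le_trans (by nlinarith) (hjb x (hy hx)).1)
  have h2 : ρ ^ m / 2 ^ (m * m) ≤ (ρ / 2 ^ j) ^ j := by
    rw [div_pow, ← pow_mul]
    have : ρ ^ m ≤ ρ ^ j := pow_le_pow_of_le_one hρ.le hρ1 hj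
    have : (2 : ℝ) ^ (j * j) ≤ 2 ^ (m * m) :=
      pow_le_pow_right₀ one_le_two (Nat.mul_le_mul hj hj)
    gcongr
  have h3 : 0 < c₀ * (ρ ^ m / 2 ^ (m * m)) := by positivity
  have h4 : c₀ * (ρ ^ m / 2 ^ (m * m)) ≤ c₀ * (ρ / 2 ^ j) ^ j := by gcongr
  have h5 : c₀ / 2 ^ (m * m) / 2 * ρ ^ m = c₀ * (ρ ^ m / 2 ^ (m * m)) / 2 := by ring
  linarith

/-- The constant in the measure bound for the dangerous sets. -/
noncomputable def dangerConst (I : Type*) [Fintype I] (α c C : ℝ) (m : ℕ) (K E : ℝ) : ℝ :=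
  nondivConst α c C (Fintype.card (Option I)) *
    (2 ^ m * C * (4 * (K + m + 1)) ^ α * (2 * Fintype.card (Option I) * E) ^ (α / m))

theorem dangerConst_nonneg {α c C : ℝ} {m : ℕ} {K E : ℝ} (hc : 0 < c) (hC : 0 < C) (hK : 1 ≤ K)
    (hE : 0 ≤ E) : 0 ≤ dangerConst I α c C m K E := by
  have := nondivConst_nonneg (α := α) hc hC (Fintype.card (Option I))
  unfold dangerConst
  positivity

variable [DecidableEq I] {r : I → ℝ} {i₀ : I}

/-- Every minor of a rescaled curve matrix has a derivative of bounded order which is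
comparable to a constant on `I₀`. -/
def MinorsComparable (φ : I → ℝ → ℝ) (i₀ : I) (m : ℕ) (K : ℝ) (I₀ : Set ℝ) : Prop :=
  ∀ (d : Option I → ℝ) (j : ℕ) (v : Fin j → Option I → ℤ) (f : Fin j → Option I),
    ∃ g : ℕ → ℝ → ℝ,
      (∀ x, g 0 x = mnr (Matrix.diagonal d * curveMat φ i₀ x * intMat v) f) ∧
      (∀ i, ∀ x ∈ I₀, HasDerivAt (g i) (g (i + 1) x) x) ∧
      ∃ (A : ℝ) (k : ℕ), k ≤ m ∧ ∀ x ∈ I₀, A ≤ |g k x| ∧ |g k x| ≤ K * A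

theorem AhlforsOn.measure_enlarged_danger_le {μ : Measure ℝ} {S : Set ℝ} {α c C ρ₁ : ℝ}
    (h : AhlforsOn μ S α c C ρ₁) {m : ℕ} (hm : 1 ≤ m) {K : ℝ} (hK : 1 ≤ K) {I₀ : Set ℝ}
    (hmin : MinorsComparable φ i₀ m K I₀)
    (hcont : ∀ o p, ContinuousOn (fun x => curveMat φ i₀ x o p) I₀)
    {σ ε t l E : ℝ} (hε : 0 < ε) (hE : 1 ≤ E)
    (hEl : 2 * Fintype.card (Option I) * E * Real.exp (-(σ * l / 2)) ≤ 1)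
    {y ρ : ℝ} (hy : y ∈ S) (hρ : 0 < ρ) (hρ₁ : 4 * (5 ^ Fintype.card (Option I) * ρ) ≤ ρ₁)
    (hI : Metric.closedBall y (5 ^ Fintype.card (Option I) * ρ) ⊆ I₀)
    (hsup : ∀ (j : ℕ) (v : Fin j → Option I → ℤ), 1 ≤ j → (∃ f, mnr (intMat v) f ≠ 0) →
      ∃ x ∈ Metric.closedBall y ρ,
        ∃ f, 1 ≤ |mnr (scaled φ r i₀ σ ε t l (σ * l / 2) x * intMat v) f|) :
    μ {x ∈ Metric.closedBall y ρ | ∃ a : Option I → ℤ, a ≠ 0 ∧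
        ∀ o, |(curveMat φ i₀ x).mulVec (fun p => (a p : ℝ)) o| ≤
          E * (ε * Real.exp (bnd r i₀ σ t l o))} ≤
      ENNReal.ofReal (dangerConst I α c C m K E * Real.exp (-(α / m * (σ * l / 2))) * ρ ^ α) := by
  have hα := h.α_pos
  have hC := h.C_pos
  have hκ : 0 < (Fintype.card (Option I) : ℝ) := by exact_mod_cast Fintype.card_pos
  have h1 : AhlforsOn μ S α c C (ρ₁ / 4) :=
    { h with
      ρ₁_pos := by linarith [h.ρ₁_pos]
      lower := fun x hx ρ h0 h1 => h.lower x hx ρ h0 (by linarith [h.ρ₁_pos])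
      upper := fun x hx ρ h0 h1 => h.upper x hx ρ h0 (by linarith [h.ρ₁_pos]) }
  set s := σ * l / 2 with hs
  set η := 2 * Fintype.card (Option I) * E * Real.exp (-s) with hη
  have hη0 : 0 < η := by positivity
  refine (measure_mono ?_).trans ((h1.measure_small_vector_le
    (M := fun x => scaled φ r i₀ σ ε t l s x) (I₀ := I₀) ?_ hη0 hEl
    (G := 2 ^ m * C * (4 * (K + m + 1)) ^ α * η ^ (α / m)) (by positivity) ?_ hy hρ
    (by linarith) hI hsup).trans_eq ?_)
  · rintro x ⟨hx, a, ha, hle⟩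
    refine ⟨hx, a, ha, fun o => ?_⟩
    rw [scaled, ← Matrix.mulVec_mulVec, Matrix.mulVec_diagonal, abs_mul,
      abs_of_pos (by positivity)]
    have e1 : Real.exp (-bnd r i₀ σ t l o - s) =
        (Real.exp (bnd r i₀ σ t l o))⁻¹ * Real.exp (-s) := by
      rw [sub_eq_add_neg, Real.exp_add, Real.exp_neg (bnd _ _ _ _ _ _)]
    calc _ ≤ ε⁻¹ * Real.exp (-bnd r i₀ σ t l o - s) *
          (E * (ε * Real.exp (bnd r i₀ σ t l o))) := by gcongr; exact hle o
      _ = E * Real.exp (-s) := by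
          rw [e1]
          field_simp
      _ < η / Fintype.card (Option I) := by
          rw [hη, lt_div_iff₀ hκ]
          have : 0 < E * Real.exp (-s) * Fintype.card (Option I) := by positivity
          linarith
  · intro o p
    simp only [scaled, Matrix.diagonal_mul]
    exact (hcont o p).const_mul _
  · intro j v f z hz w hw hw1 hzI hex
    obtain ⟨g, hg0, hg, A, k, hk, hA⟩ :=
      hmin (fun o => ε⁻¹ * Real.exp (-bnd r i₀ σ t l o - s)) j v f
    have := h.measure_sublevel_le hm hk hK hz hw (by linarith) hη0
      (fun i x hx => hg i x (hzI hx)) (fun x hx => hA x (hzI hx)) (by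
        simp only [hg0]
        exact hex)
    simp only [hg0] at this
    exact this
  · congr 1
    rw [dangerConst, hη, Real.mul_rpow (by positivity) (Real.exp_pos _).le, ← Real.exp_mul]
    ring_nf

end Measure

/-! ### A Cantor type construction -/

section Cantor

/-- One step of the construction: the children whose balls avoid the next bad set. -/
noncomputable def survivors (Ch : ℕ → ℝ → Finset ℝ) (ρ : ℕ → ℝ) (Bad : ℕ → Set ℝ) (x₀ : ℝ) :
    ℕ → Finset ℝ
  | 0 => {x₀}
  | q + 1 => by
    classical
    exact (survivors Ch ρ Bad x₀ q).biUnion fun x =>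
      (Ch q x).filter fun z => Disjoint (Metric.closedBall z (ρ (q + 1))) (Bad (q + 1))

variable {S : Set ℝ} {ρ : ℕ → ℝ} {Ch : ℕ → ℝ → Finset ℝ} {Bad : ℕ → Set ℝ} {x₀ M : ℝ}

theorem mem_survivors_succ {q : ℕ} {z : ℝ} : z ∈ survivors Ch ρ Bad x₀ (q + 1) ↔
    ∃ x ∈ survivors Ch ρ Bad x₀ q, z ∈ Ch q x ∧
      Disjoint (Metric.closedBall z (ρ (q + 1))) (Bad (q + 1)) := by
  classical
  simp [survivors]

/-- The requirements on the tree of balls. -/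
structure IsTree (S : Set ℝ) (ρ : ℕ → ℝ) (Ch : ℕ → ℝ → Finset ℝ) (M : ℝ) : Prop where
  ρ_pos : ∀ q, 0 < ρ q
  mem : ∀ q, ∀ x ∈ S, ∀ z ∈ Ch q x, z ∈ S
  sub : ∀ q, ∀ x ∈ S, ∀ z ∈ Ch q x,
    Metric.closedBall z (ρ (q + 1)) ⊆ Metric.closedBall x (ρ q)
  disj : ∀ q, ∀ x ∈ S, (Ch q x : Set ℝ).Pairwise fun z w =>
    Disjoint (Metric.closedBall z (ρ (q + 1))) (Metric.closedBall w (ρ (q + 1)))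
  card : ∀ q, ∀ x ∈ S, M ≤ (Ch q x).card

theorem IsTree.survivors_mem (h : IsTree S ρ Ch M) (hx₀ : x₀ ∈ S) (q : ℕ) :
    ∀ x ∈ survivors Ch ρ Bad x₀ q, x ∈ S := by
  induction q with
  | zero => simpa [survivors] using hx₀
  | succ q ih =>
    intro z hz
    obtain ⟨x, hx, hz, -⟩ := mem_survivors_succ.1 hz
    exact h.mem q x (ih x hx) z hz

theorem IsTree.exists_ancestor (h : IsTree S ρ Ch M) (hx₀ : x₀ ∈ S) {p q : ℕ} (hpq : p ≤ q) :
    ∀ z ∈ survivors Ch ρ Bad x₀ q, ∃ x ∈ survivors Ch ρ Bad x₀ p,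
      Metric.closedBall z (ρ q) ⊆ Metric.closedBall x (ρ p) := by
  induction q, hpq using Nat.le_induction with
  | base => exact fun z hz => ⟨z, hz, subset_rfl⟩
  | succ q hq ih =>
    intro z hz
    obtain ⟨x, hx, hz, -⟩ := mem_survivors_succ.1 hz
    obtain ⟨y, hy, hxy⟩ := ih x hx
    exact ⟨y, hy, (h.sub q x (h.survivors_mem hx₀ q x hx) z hz).trans hxy⟩

theorem survivors_disjoint_bad {q : ℕ} (hq : 1 ≤ q) :
    ∀ z ∈ survivors Ch ρ Bad x₀ q, Disjoint (Metric.closedBall z (ρ q)) (Bad q) := by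
  obtain ⟨q, rfl⟩ : ∃ p, q = p + 1 := ⟨q - 1, by omega⟩
  intro z hz
  obtain ⟨x, hx, hz, hd⟩ := mem_survivors_succ.1 hz
  exact hd

theorem IsTree.children_disjoint (h : IsTree S ρ Ch M) {q : ℕ} {T : Finset ℝ}
    (hT : ∀ x ∈ T, x ∈ S) (hd : (T : Set ℝ).Pairwise fun z w =>
      Disjoint (Metric.closedBall z (ρ q)) (Metric.closedBall w (ρ q)))
    {x x' z z' : ℝ} (hx : x ∈ T) (hx' : x' ∈ T) (hz : z ∈ Ch q x) (hz' : z' ∈ Ch q x')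
    (hne : z ≠ z') :
    Disjoint (Metric.closedBall z (ρ (q + 1))) (Metric.closedBall z' (ρ (q + 1))) := by
  by_cases hxx : x = x'
  · subst hxx
    exact h.disj q x (hT x hx) hz hz' hne
  · exact (hd hx hx' hxx).mono (h.sub q x (hT x hx) z hz) (h.sub q x' (hT x' hx') z' hz')

theorem IsTree.survivors_disjoint (h : IsTree S ρ Ch M) (hx₀ : x₀ ∈ S) (q : ℕ) :
    (survivors Ch ρ Bad x₀ q : Set ℝ).Pairwise fun z w =>
      Disjoint (Metric.closedBall z (ρ q)) (Metric.closedBall w (ρ q)) := by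
  induction q with
  | zero => simp [survivors]
  | succ q ih =>
    intro z hz w hw hne
    obtain ⟨x, hx, hz, -⟩ := mem_survivors_succ.1 hz
    obtain ⟨x', hx', hw, -⟩ := mem_survivors_succ.1 hw
    exact h.children_disjoint (h.survivors_mem hx₀ q) ih hx hx' hz hw hne

variable {ι : Type*} {J : ℕ → Finset ι} {B : ℕ → ι → Set ℝ} {p : ℕ → ι → ℕ} {ν : ℕ → ι → ℝ}

theorem IsTree.card_survivors (h : IsTree S ρ Ch M) (hx₀ : x₀ ∈ S) (hM : 0 < M)
    (hBad : ∀ q, Bad (q + 1) ⊆ ⋃ i ∈ J (q + 1), B (q + 1) i)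
    (hp : ∀ q, ∀ i ∈ J (q + 1), p (q + 1) i ≤ q)
    (hν0 : ∀ q, ∀ i ∈ J (q + 1), 0 ≤ ν (q + 1) i)
    (hν : ∀ q, ∀ i ∈ J (q + 1), ∀ x ∈ S,
      Metric.closedBall x (ρ (p (q + 1) i)) ⊆ Metric.closedBall x₀ (ρ 0) →
      (∀ p', 1 ≤ p' → p' ≤ p (q + 1) i →
        Disjoint (Metric.closedBall x (ρ (p (q + 1) i))) (Bad p')) →
      ∀ F : Finset ℝ, (∀ z ∈ F, z ∈ S ∧
        Metric.closedBall z (ρ (q + 1)) ⊆ Metric.closedBall x (ρ (p (q + 1) i)) ∧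
        ¬ Disjoint (Metric.closedBall z (ρ (q + 1))) (B (q + 1) i)) →
      ((F : Set ℝ).Pairwise fun z w =>
        Disjoint (Metric.closedBall z (ρ (q + 1))) (Metric.closedBall w (ρ (q + 1)))) →
      (F.card : ℝ) ≤ ν (q + 1) i)
    (hsum : ∀ q, ∑ i ∈ J (q + 1), ν (q + 1) i * (2 / M) ^ (q - p (q + 1) i) ≤ M / 2) (q : ℕ) :
    ∀ j ≤ q, ((survivors Ch ρ Bad x₀ j).card : ℝ) ≤
      (2 / M) ^ (q - j) * (survivors Ch ρ Bad x₀ q).card := by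
  classical
  induction q with
  | zero =>
    intro j hj
    obtain rfl : j = 0 := by omega
    simp
  | succ q ih =>
    set T := survivors Ch ρ Bad x₀ with hT
    have hTS := h.survivors_mem (Bad := Bad) hx₀ q
    have hTd := h.survivors_disjoint (Bad := Bad) hx₀ q
    suffices hstep : M / 2 * (T q).card ≤ (T (q + 1)).card by
      intro j hj
      rcases Nat.lt_or_ge q j with hlt | hle
      · obtain rfl : j = q + 1 := by omega
        simp
      · refine (ih j hle).trans ?_
        have e : q + 1 - j = (q - j) + 1 := by omega
        rw [e, pow_succ, mul_assoc]
        have : ((T q).card : ℝ) ≤ 2 / M * (T (q + 1)).card := by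
          rw [div_mul_eq_mul_div, le_div_iff₀ hM]
          linarith
        gcongr
    let all := (T q).biUnion (Ch q)
    have hall : M * (T q).card ≤ all.card := by
      rw [Finset.card_biUnion]
      · push_cast
        rw [mul_comm, ← nsmul_eq_mul]
        exact Finset.card_nsmul_le_sum _ _ _ fun x hx => h.card q x (hTS x hx)
      · intro x hx x' hx' hne
        refine Finset.disjoint_left.2 fun z hz hz' => ?_
        have h1 := h.sub q x (hTS x hx) z hz (Metric.mem_closedBall_self (h.ρ_pos _).le)
        have h2 := h.sub q x' (hTS x' hx') z hz' (Metric.mem_closedBall_self (h.ρ_pos _).le)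
        exact Set.disjoint_left.1 (hTd hx hx' hne) h1 h2
    let hit : ι → Finset ℝ := fun i => all.filter fun z =>
      ¬ Disjoint (Metric.closedBall z (ρ (q + 1))) (B (q + 1) i)
    have hcover : all ⊆ T (q + 1) ∪ (J (q + 1)).biUnion hit := by
      intro z hz
      obtain ⟨x, hx, hzx⟩ := Finset.mem_biUnion.1 hz
      by_cases hd : Disjoint (Metric.closedBall z (ρ (q + 1))) (Bad (q + 1))
      · exact Finset.mem_union_left _ (mem_survivors_succ.2 ⟨x, hx, hzx, hd⟩)
      · obtain ⟨w, hw, hwB⟩ := Set.not_disjoint_iff.1 hd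
        obtain ⟨i, hi, hwi⟩ := mem_iUnion₂.1 (hBad q hwB)
        exact Finset.mem_union_right _ (Finset.mem_biUnion.2 ⟨i, hi, Finset.mem_filter.2
          ⟨hz, Set.not_disjoint_iff.2 ⟨w, hw, hwi⟩⟩⟩)
    have hhit : ∀ i ∈ J (q + 1), ((hit i).card : ℝ) ≤
        ν (q + 1) i * (2 / M) ^ (q - p (q + 1) i) * (T q).card := by
      intro i hi
      set k := p (q + 1) i with hk
      let sub : ℝ → Finset ℝ := fun x => (hit i).filter fun z =>
        Metric.closedBall z (ρ (q + 1)) ⊆ Metric.closedBall x (ρ k)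
      have hsub : hit i ⊆ (T k).biUnion sub := by
        intro z hz
        obtain ⟨x, hx, hzx⟩ := Finset.mem_biUnion.1 (Finset.mem_filter.1 hz).1
        obtain ⟨y, hy, hxy⟩ := h.exists_ancestor hx₀ (hp q i hi) x hx
        exact Finset.mem_biUnion.2 ⟨y, hy, Finset.mem_filter.2
          ⟨hz, (h.sub q x (hTS x hx) z hzx).trans hxy⟩⟩
      have hcard : ∀ x ∈ T k, ((sub x).card : ℝ) ≤ ν (q + 1) i := by
        intro x hx
        refine hν q i hi x (h.survivors_mem hx₀ k x hx) ?_ ?_ _ ?_ ?_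
        · obtain ⟨y, hy, hxy⟩ := h.exists_ancestor hx₀ (Nat.zero_le k) x hx
          obtain rfl : y = x₀ := by simpa [survivors] using hy
          exact hxy
        · intro p' hp1 hp2
          obtain ⟨y, hy, hxy⟩ := h.exists_ancestor hx₀ hp2 x hx
          exact (survivors_disjoint_bad hp1 y hy).mono_left hxy
        · intro z hz
          obtain ⟨hz1, hz2⟩ := Finset.mem_filter.1 hz
          obtain ⟨hz3, hz4⟩ := Finset.mem_filter.1 hz1
          obtain ⟨y, hy, hzy⟩ := Finset.mem_biUnion.1 hz3
          exact ⟨h.mem q y (hTS y hy) z hzy, hz2, hz4⟩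
        · intro z hz w hw hne
          obtain ⟨y, hy, hzy⟩ := Finset.mem_biUnion.1
            (Finset.mem_filter.1 (Finset.mem_filter.1 hz).1).1
          obtain ⟨y', hy', hwy⟩ := Finset.mem_biUnion.1
            (Finset.mem_filter.1 (Finset.mem_filter.1 hw).1).1
          exact h.children_disjoint hTS hTd hy hy' hzy hwy hne
      have hν1 := hν0 q i hi
      calc ((hit i).card : ℝ) ≤ ∑ x ∈ T k, ((sub x).card : ℝ) := by
            exact_mod_cast (Finset.card_le_card hsub).trans Finset.card_biUnion_le
        _ ≤ (T k).card * ν (q + 1) i := by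
            rw [← nsmul_eq_mul]
            exact Finset.sum_le_card_nsmul _ _ _ hcard
        _ ≤ ((2 / M) ^ (q - k) * (T q).card) * ν (q + 1) i := by
            gcongr
            exact ih k (hp q i hi)
        _ = _ := by ring
    have h1 : (all.card : ℝ) ≤ (T (q + 1)).card + ∑ i ∈ J (q + 1), ((hit i).card : ℝ) := by
      exact_mod_cast (Finset.card_le_card hcover).trans ((Finset.card_union_le _ _).trans
        (Nat.add_le_add_left Finset.card_biUnion_le _))
    have h2 : ∑ i ∈ J (q + 1), ((hit i).card : ℝ) ≤ M / 2 * (T q).card := by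
      refine (Finset.sum_le_sum hhit).trans ?_
      rw [← Finset.sum_mul]
      gcongr
      exact hsum q
    linarith

theorem IsTree.exists_avoiding (h : IsTree S ρ Ch M) (hS : IsClosed S) (hx₀ : x₀ ∈ S)
    (hcard : ∀ q, ∀ j ≤ q, ((survivors Ch ρ Bad x₀ j).card : ℝ) ≤
      (2 / M) ^ (q - j) * (survivors Ch ρ Bad x₀ q).card) :
    ∃ x ∈ S, x ∈ Metric.closedBall x₀ (ρ 0) ∧ ∀ q, 1 ≤ q → ∃ z ∈ S,
      x ∈ Metric.closedBall z (ρ q) ∧ Disjoint (Metric.closedBall z (ρ q)) (Bad q) := by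
  set T := survivors Ch ρ Bad x₀ with hT
  have hne : ∀ q, (T q).Nonempty := by
    intro q
    rw [← Finset.card_pos, Nat.pos_iff_ne_zero]
    intro h0
    have := hcard q 0 (Nat.zero_le q)
    rw [h0] at this
    norm_num [hT, survivors] at this
  let Z : ℕ → Set ℝ := fun q => S ∩ ⋃ x ∈ T q, Metric.closedBall x (ρ q)
  have hZc : ∀ q, IsCompact (Z q) := fun q =>
    ((T q).isCompact_biUnion fun x _ => isCompact_closedBall x (ρ q)).inter_left hS
  obtain ⟨x, hx⟩ := IsCompact.nonempty_iInter_of_sequence_nonempty_isCompact_isClosed Z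
    (by
      rintro q x ⟨hxS, hx⟩
      refine ⟨hxS, ?_⟩
      obtain ⟨z, hz, hxz⟩ := mem_iUnion₂.1 hx
      obtain ⟨y, hy, hzy⟩ := h.exists_ancestor hx₀ (Nat.le_succ q) z hz
      exact mem_iUnion₂.2 ⟨y, hy, hzy hxz⟩)
    (by
      intro q
      obtain ⟨z, hz⟩ := hne q
      exact ⟨z, h.survivors_mem hx₀ q z hz,
        mem_iUnion₂.2 ⟨z, hz, Metric.mem_closedBall_self (h.ρ_pos q).le⟩⟩)
    (hZc 0) (fun q => (hZc q).isClosed)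
  rw [mem_iInter] at hx
  refine ⟨x, (hx 0).1, ?_, fun q hq => ?_⟩
  · obtain ⟨z, hz, hxz⟩ := mem_iUnion₂.1 (hx 0).2
    obtain rfl : z = x₀ := by simpa [hT, survivors] using hz
    exact hxz
  · obtain ⟨z, hz, hxz⟩ := mem_iUnion₂.1 (hx q).2
    exact ⟨z, h.survivors_mem hx₀ q z hz, hxz, survivors_disjoint_bad hq z hz⟩

end Cantor

/-! ### Trees of balls in the support of an Ahlfors regular measure -/

section AhlforsTree

variable {μ : Measure ℝ} {S : Set ℝ} {α c C ρ₁ : ℝ}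

theorem AhlforsOn.card_mul_le (h : AhlforsOn μ S α c C ρ₁) {F : Finset ℝ} {ρ V : ℝ} {E : Set ℝ}
    (hρ : 0 < ρ) (hρ₁ : ρ ≤ ρ₁) (hV : 0 ≤ V) (hF : ∀ z ∈ F, z ∈ S ∧ Metric.closedBall z ρ ⊆ E)
    (hd : (F : Set ℝ).Pairwise fun z w =>
      Disjoint (Metric.closedBall z ρ) (Metric.closedBall w ρ))
    (hE : μ E ≤ ENNReal.ofReal V) : F.card * (c * ρ ^ α) ≤ V := by
  have hc := h.c_pos
  rw [← ENNReal.ofReal_le_ofReal_iff hV]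
  calc ENNReal.ofReal (F.card * (c * ρ ^ α))
      = ∑ _z ∈ F, ENNReal.ofReal (c * ρ ^ α) := by
        rw [Finset.sum_const, nsmul_eq_mul, ENNReal.ofReal_mul (Nat.cast_nonneg _),
          ENNReal.ofReal_natCast]
    _ ≤ ∑ z ∈ F, μ (Metric.closedBall z ρ) :=
        Finset.sum_le_sum fun z hz => h.lower z (hF z hz).1 ρ hρ hρ₁
    _ = μ (⋃ z ∈ F, Metric.closedBall z ρ) :=
        (measure_biUnion_finset hd fun z _ => Metric.isClosed_closedBall.measurableSet).symm
    _ ≤ μ E := measure_mono (iUnion₂_subset fun z hz => (hF z hz).2)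
    _ ≤ _ := hE

theorem AhlforsOn.le_of_mem (h : AhlforsOn μ S α c C ρ₁) {x : ℝ} (hx : x ∈ S) : c ≤ C := by
  have hC := h.C_pos
  have hρ := h.ρ₁_pos
  have h1 := (h.lower x hx ρ₁ hρ le_rfl).trans (h.upper x hx ρ₁ hρ le_rfl)
  rw [ENNReal.ofReal_le_ofReal_iff (by positivity)] at h1
  exact le_of_mul_le_mul_right h1 (by positivity)

theorem AhlforsOn.exists_children (h : AhlforsOn μ S α c C ρ₁) {R ρ : ℝ} (hR : 2 ≤ R)
    (hρ : 0 < ρ) (hρ₁ : ρ ≤ ρ₁) {x : ℝ} (hx : x ∈ S) :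
    ∃ F : Finset ℝ, (∀ z ∈ F, z ∈ S ∧
        Metric.closedBall z (ρ / R) ⊆ Metric.closedBall x ρ) ∧
      ((F : Set ℝ).Pairwise fun z w =>
        Disjoint (Metric.closedBall z (ρ / R)) (Metric.closedBall w (ρ / R))) ∧
      c / C * (R / 4) ^ α ≤ F.card := by
  have hc := h.c_pos
  have hC := h.C_pos
  have hR0 : 0 < R := by linarith
  have hρR : ρ / R ≤ ρ / 2 := by gcongr
  have hpos : 0 < ρ / R := by positivity
  rcases exists_separated_or_cover (Metric.closedBall x (ρ / 2) ∩ S)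
    (show 0 < 2 * (ρ / R) by positivity) ⌈c / C * (R / 4) ^ α⌉₊ with
    ⟨F, hF, hcard, hs⟩ | ⟨F, hF, hcard, hs, hcov⟩
  · refine ⟨F, fun z hz => ⟨(hF hz).2, ?_⟩, fun z hz w hw hne => ?_, ?_⟩
    · refine Metric.closedBall_subset_closedBall' ?_
      have := Metric.mem_closedBall.1 (hF hz).1
      linarith
    · refine Metric.closedBall_disjoint_closedBall ?_
      have := hs hz hw hne
      rw [Real.dist_eq]
      linarith
    · rw [hcard]
      exact Nat.le_ceil _
  · exfalso
    have h1 := h.lower x hx (ρ / 2) (by positivity) (by linarith)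
    have hsub : Metric.closedBall x (ρ / 2) ∩ S ⊆ ⋃ z ∈ F, Metric.closedBall z (2 * (ρ / R)) := by
      intro z hz
      obtain ⟨w, hw, hzw⟩ := hcov z hz
      exact mem_biUnion hw (by rwa [Metric.mem_closedBall, Real.dist_eq])
    have h2 : μ (Metric.closedBall x (ρ / 2)) ≤
        ENNReal.ofReal (F.card * (C * (2 * (ρ / R)) ^ α)) := by
      rw [← h.measure_inter]
      refine (measure_mono hsub).trans ((measure_biUnion_finset_le _ _).trans ?_)
      refine (Finset.sum_le_sum fun z hz =>
        h.upper z (hF hz).2 _ (by positivity) (by linarith)).trans ?_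
      rw [Finset.sum_const, nsmul_eq_mul, ENNReal.ofReal_mul (Nat.cast_nonneg _),
        ENNReal.ofReal_natCast]
    have h3 := h1.trans h2
    rw [ENNReal.ofReal_le_ofReal_iff (by positivity)] at h3
    have h4 : (F.card : ℝ) < c / C * (R / 4) ^ α := by
      by_contra! hle
      exact absurd hcard (not_lt.2 (Nat.ceil_le.2 hle))
    have e : (ρ / 2) ^ α = (R / 4) ^ α * (2 * (ρ / R)) ^ α := by
      rw [← Real.mul_rpow (by positivity) (by positivity)]
      congr 1
      field_simp
      norm_num
    have h5 : F.card * (C * (2 * (ρ / R)) ^ α) <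
        c / C * (R / 4) ^ α * (C * (2 * (ρ / R)) ^ α) := by gcongr
    have h6 : c / C * (R / 4) ^ α * (C * (2 * (ρ / R)) ^ α) = c * (ρ / 2) ^ α := by
      rw [e]
      field_simp
    linarith

theorem AhlforsOn.exists_isTree (h : AhlforsOn μ S α c C ρ₁) {R : ℝ} (hR : 2 ≤ R) {ρ : ℕ → ℝ}
    (hρ : ∀ q, 0 < ρ q) (hρ₁ : ∀ q, ρ q ≤ ρ₁) (hρR : ∀ q, ρ (q + 1) = ρ q / R) :
    ∃ Ch, IsTree S ρ Ch (c / C * (R / 4) ^ α) := by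
  have hex : ∀ q x, ∃ F : Finset ℝ, x ∈ S → (∀ z ∈ F, z ∈ S ∧
        Metric.closedBall z (ρ (q + 1)) ⊆ Metric.closedBall x (ρ q)) ∧
      ((F : Set ℝ).Pairwise fun z w =>
        Disjoint (Metric.closedBall z (ρ (q + 1))) (Metric.closedBall w (ρ (q + 1)))) ∧
      c / C * (R / 4) ^ α ≤ F.card := by
    intro q x
    by_cases hx : x ∈ S
    · obtain ⟨F, hF⟩ := h.exists_children hR (hρ q) (hρ₁ q) hx
      rw [← hρR] at hF
      exact ⟨F, fun _ => hF⟩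
    · exact ⟨∅, fun h => absurd h hx⟩
  choose Ch hCh using hex
  exact ⟨Ch, hρ, fun q x hx z hz => ((hCh q x hx).1 z hz).1,
    fun q x hx z hz => ((hCh q x hx).1 z hz).2, fun q x hx => (hCh q x hx).2.1,
    fun q x hx => (hCh q x hx).2.2⟩

end AhlforsTree

/-! ### Counting dangerous balls -/

section Count

variable {I : Type*} [Fintype I]

/-- The requirements on the parameters of the construction. -/
structure Scale (I : Type*) [Fintype I] (r₀ δ B b ν α c C ρ₁ K c₁ : ℝ) (m : ℕ)
    (σ τ T ℓ₀ ε : ℝ) (N : ℕ) : Prop where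
  ε_pos : 0 < ε
  ε_le_one : ε ≤ 1
  ε_le_b : ε ≤ b
  ε_le : ε ≤ c₁ * ℓ₀ ^ m
  σ_eq : σ = ν / (4 * Fintype.card (Option I))
  τ_pos : 0 < τ
  T_eq : T = (1 + r₀) * τ
  ℓ_pos : 0 < ℓ₀
  ℓ_le_one : ℓ₀ ≤ 1
  ℓ_le_ρ₁ : 4 * (5 ^ Fintype.card (Option I) * ℓ₀) ≤ ρ₁
  ℓ_le_δ : ℓ₀ + 5 ^ Fintype.card (Option I) * ℓ₀ ≤ δ
  one_le_N : 1 ≤ N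
  big₀ : 2 * Fintype.card (Option I) * enlargeConst I B b * Real.exp (-(σ * (N * T) / 2)) ≤ 1
  big₁ : localConst I B b ℓ₀ <
    (1 / (Fintype.card (Option I) : ℝ)) ^ Fintype.card (Option I) * Real.exp (σ * (N * T) / 2)
  big₂ : Fintype.card (Option I) * localConst I B b ℓ₀ * Real.exp (2 * τ) <
    ((1 / (Fintype.card (Option I) : ℝ)) ^ Fintype.card (Option I)) ^ 2 *
      Real.exp (σ * (N * T))
  step : Real.exp (-(α / m * (σ / 2) * T)) * (2 / (c / C / 4 ^ α)) ^ 15 ≤ 1 / 2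
  tail : 4 * (dangerConst I α c C m K (enlargeConst I B b) / c) * (1 / 2) ^ N ≤ 1
  two_le : 2 ≤ Real.exp T
  inh : C / c * 4 ^ α ≤ c / C / 4 ^ α * Real.exp (α * T) / 4

/-- The radii of the balls in the construction. -/
noncomputable def rad (ℓ₀ T : ℝ) (q : ℕ) : ℝ := ℓ₀ * Real.exp (-(T * q))

theorem rad_pos {ℓ₀ T : ℝ} (hℓ : 0 < ℓ₀) (q : ℕ) : 0 < rad ℓ₀ T q := by
  unfold rad
  positivity

theorem rad_le {ℓ₀ T : ℝ} (hℓ : 0 < ℓ₀) (hT : 0 ≤ T) (q : ℕ) : rad ℓ₀ T q ≤ ℓ₀ := by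
  unfold rad
  refine mul_le_of_le_one_right hℓ.le ?_
  rw [Real.exp_le_one_iff, neg_nonpos]
  positivity

theorem rad_succ {ℓ₀ T : ℝ} (q : ℕ) : rad ℓ₀ T (q + 1) = rad ℓ₀ T q / Real.exp T := by
  unfold rad
  rw [mul_div_assoc, ← Real.exp_sub]
  push_cast
  ring_nf

theorem rad_zero {ℓ₀ T : ℝ} : rad ℓ₀ T 0 = ℓ₀ := by simp [rad]

variable {φ : I → ℝ → ℝ} {r : I → ℝ} {i₀ : I} {μ : Measure ℝ} {S : Set ℝ}
  {x₀ δ B b ν α c C ρ₁ K c₁ : ℝ} {m : ℕ} {σ τ T ℓ₀ ε : ℝ} {N : ℕ}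

theorem CurveBounds.one_le_enlargeConst {I₀ : Set ℝ} (h : CurveBounds r i₀ φ I₀ B b ν) :
    1 ≤ enlargeConst I B b := by
  have := h.one_le_B
  have := h.one_le_coeffConst
  unfold enlargeConst
  have : 0 ≤ 4 * Fintype.card (Option I) * B * coeffConst I B b := by positivity
  linarith

theorem Scale.card_mul_σ (hS : Scale I (r i₀) δ B b ν α c C ρ₁ K c₁ m σ τ T ℓ₀ ε N) :
    Fintype.card (Option I) * σ = ν / 4 := by
  have : (Fintype.card (Option I) : ℝ) ≠ 0 := by exact_mod_cast Fintype.card_ne_zero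
  rw [hS.σ_eq]
  field_simp

theorem Scale.closedBall_subset
    (hS : Scale I (r i₀) δ B b ν α c C ρ₁ K c₁ m σ τ T ℓ₀ ε N) :
    Metric.closedBall x₀ ℓ₀ ⊆ Metric.closedBall x₀ δ := by
  refine Metric.closedBall_subset_closedBall ?_
  have := hS.ℓ_pos
  have : 0 ≤ 5 ^ Fintype.card (Option I) * ℓ₀ := by positivity
  linarith [hS.ℓ_le_δ]

variable [DecidableEq I]

/-- The local setting: a curve near `x₀`, and an Ahlfors regular measure. -/
structure Frame (φ : I → ℝ → ℝ) (r : I → ℝ) (i₀ : I) (μ : Measure ℝ) (S : Set ℝ)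
    (x₀ δ B b ν α c C ρ₁ K c₁ : ℝ) (m : ℕ) : Prop where
  bounds : CurveBounds r i₀ φ (Metric.closedBall x₀ δ) B b ν
  sum_r : ∑ i, r i = 1
  ahlfors : AhlforsOn μ S α c C ρ₁
  mem : x₀ ∈ S
  δ_pos : 0 < δ
  one_le_m : 1 ≤ m
  one_le_K : 1 ≤ K
  minors : MinorsComparable φ i₀ m K (Metric.closedBall x₀ δ)
  cont : ∀ o p, ContinuousOn (fun x => curveMat φ i₀ x o p) (Metric.closedBall x₀ δ)
  c₁_pos : 0 < c₁
  lower : ∀ c : Option I → ℝ, (∃ p, 1 ≤ |c p|) → ∀ y ρ : ℝ, 0 < ρ → ρ ≤ 1 →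
    Metric.closedBall y ρ ⊆ Metric.closedBall x₀ δ →
    ∃ x ∈ Metric.closedBall y ρ, c₁ * ρ ^ m ≤ |hatComb φ c x|

theorem Frame.T_pos (hF : Frame φ r i₀ μ S x₀ δ B b ν α c C ρ₁ K c₁ m)
    (hS : Scale I (r i₀) δ B b ν α c C ρ₁ K c₁ m σ τ T ℓ₀ ε N) : 0 < T := by
  rw [hS.T_eq]
  have := hF.bounds.r_pos i₀
  have := hS.τ_pos
  positivity

theorem Frame.ν_le_one (hF : Frame φ r i₀ μ S x₀ δ B b ν α c C ρ₁ K c₁ m) : ν ≤ 1 := by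
  refine (hF.bounds.le_r i₀).trans ?_
  rw [← hF.sum_r]
  exact Finset.single_le_sum (fun i _ => (hF.bounds.r_pos i).le) (Finset.mem_univ i₀)

theorem Frame.σ_pos (hF : Frame φ r i₀ μ S x₀ δ B b ν α c C ρ₁ K c₁ m)
    (hS : Scale I (r i₀) δ B b ν α c C ρ₁ K c₁ m σ τ T ℓ₀ ε N) : 0 < σ := by
  rw [hS.σ_eq]
  have := hF.bounds.ν_pos
  have : 0 < (Fintype.card (Option I) : ℝ) := by exact_mod_cast Fintype.card_pos
  positivity

theorem Frame.closedBall_subset (hF : Frame φ r i₀ μ S x₀ δ B b ν α c C ρ₁ K c₁ m)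
    (hS : Scale I (r i₀) δ B b ν α c C ρ₁ K c₁ m σ τ T ℓ₀ ε N) {p : ℕ} {x : ℝ}
    (hx : Metric.closedBall x (rad ℓ₀ T p) ⊆ Metric.closedBall x₀ ℓ₀) :
    Metric.closedBall x (5 ^ Fintype.card (Option I) * rad ℓ₀ T p) ⊆
      Metric.closedBall x₀ δ := by
  have h1 := Metric.mem_closedBall.1 (hx (Metric.mem_closedBall_self (rad_pos hS.ℓ_pos p).le))
  have h2 := rad_le hS.ℓ_pos (hF.T_pos hS).le p
  refine Metric.closedBall_subset_closedBall' ?_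
  have : 5 ^ Fintype.card (Option I) * rad ℓ₀ T p ≤ 5 ^ Fintype.card (Option I) * ℓ₀ := by gcongr
  linarith [hS.ℓ_le_δ]

theorem Frame.card_danger_le (hF : Frame φ r i₀ μ S x₀ δ B b ν α c C ρ₁ K c₁ m)
    (hS : Scale I (r i₀) δ B b ν α c C ρ₁ K c₁ m σ τ T ℓ₀ ε N) {q a p : ℕ} (ha : N ≤ a)
    (haq : 3 * a ≤ q) {x : ℝ} (hx : x ∈ S)
    (hxb : Metric.closedBall x (rad ℓ₀ T p) ⊆ Metric.closedBall x₀ ℓ₀)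
    (hsup : ∀ (j : ℕ) (v : Fin j → Option I → ℤ), 1 ≤ j → (∃ f, mnr (intMat v) f ≠ 0) →
      ∃ z ∈ Metric.closedBall x (rad ℓ₀ T p), ∃ f,
        1 ≤ |mnr (scaled φ r i₀ σ ε ((q + a) * τ) (a * T) (σ * (a * T) / 2) z * intMat v) f|)
    {F : Finset ℝ} (hFS : ∀ z ∈ F, z ∈ S ∧
      Metric.closedBall z (rad ℓ₀ T q) ⊆ Metric.closedBall x (rad ℓ₀ T p) ∧
      ¬ Disjoint (Metric.closedBall z (rad ℓ₀ T q))
        {w | Danger φ r i₀ σ ε ((q + a) * τ) (a * T) w})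
    (hd : (F : Set ℝ).Pairwise fun z w =>
      Disjoint (Metric.closedBall z (rad ℓ₀ T q)) (Metric.closedBall w (rad ℓ₀ T q))) :
    (F.card : ℝ) ≤ dangerConst I α c C m K (enlargeConst I B b) / c *
      Real.exp (-(α / m * (σ / 2) * T) * a) * Real.exp (α * T * (q - p)) := by
  have hA := hF.ahlfors
  have hc := hA.c_pos
  have hT := hF.T_pos hS
  have hσ := hF.σ_pos hS
  have hE := hF.bounds.one_le_enlargeConst
  have hℓ := hS.ℓ_pos
  have hτ := hS.τ_pos
  have hr0 := hF.bounds.r_pos i₀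
  have haN : (N : ℝ) ≤ a := by exact_mod_cast ha
  have haq' : 3 * (a : ℝ) ≤ q := by exact_mod_cast haq
  have hκ5 : (1 : ℝ) ≤ 5 ^ Fintype.card (Option I) := one_le_pow₀ (by norm_num)
  have hD0 : 0 ≤ dangerConst I α c C m K (enlargeConst I B b) :=
    dangerConst_nonneg hc hA.C_pos hF.one_le_K (by linarith)
  have hle : ∀ q, rad ℓ₀ T q ≤ ρ₁ := by
    intro q
    have := rad_le hℓ hT.le q
    have := hS.ℓ_le_ρ₁
    nlinarith
  have hmeas := hA.measure_enlarged_danger_le (r := r) (t := (q + a) * τ) hF.one_le_m hF.one_le_K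
    hF.minors hF.cont hS.ε_pos hE (σ := σ) (l := a * T)
    (le_trans (by gcongr) hS.big₀) hx (rad_pos hℓ p)
    (by
      have := rad_le hℓ hT.le p
      refine le_trans ?_ hS.ℓ_le_ρ₁
      gcongr) (hF.closedBall_subset hS hxb) hsup
  have hcard := hA.card_mul_le (rad_pos hℓ q) (hle q)
    (mul_nonneg (mul_nonneg hD0 (Real.exp_pos _).le)
      (Real.rpow_nonneg (rad_pos hℓ p).le _)) (F := F) ?_ hd hmeas
  · have e : rad ℓ₀ T p ^ α = rad ℓ₀ T q ^ α * Real.exp (α * T * (q - p)) := by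
      have : rad ℓ₀ T p = rad ℓ₀ T q * Real.exp (T * (q - p)) := by
        unfold rad
        rw [mul_assoc, ← Real.exp_add]
        ring_nf
      rw [this, Real.mul_rpow (rad_pos hℓ q).le (Real.exp_pos _).le, ← Real.exp_mul]
      ring_nf
    have hq : 0 < rad ℓ₀ T q ^ α := Real.rpow_pos_of_pos (rad_pos hℓ q) _
    rw [e] at hcard
    have e2 : -(α / m * (σ * (a * T) / 2)) = -(α / m * (σ / 2) * T) * a := by ring
    rw [e2] at hcard
    refine le_of_mul_le_mul_right (hcard.trans_eq ?_) (show 0 < c * rad ℓ₀ T q ^ α by positivity)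
    field_simp
  · intro z hz
    obtain ⟨hzS, hzsub, hmeet⟩ := hFS z hz
    refine ⟨hzS, fun w hw => ⟨hzsub hw, ?_⟩⟩
    obtain ⟨w', hw', d, hd0, hd⟩ := Set.not_disjoint_iff.1 hmeet
    refine ⟨d, hd0, fun o => ?_⟩
    refine hF.bounds.enlarge hS.ε_pos (by positivity) (by positivity) ?_
      ((hzsub.trans hxb).trans (hS.closedBall_subset)) ?_ hw' hw (fun o => (hd o).le) o
    · rw [hS.T_eq]
      have h1 : (0 : ℝ) ≤ (1 + r i₀) * τ := by positivity
      nlinarith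
    · refine (mul_le_of_le_one_left (Real.exp_pos _).le hS.ℓ_le_one).trans_eq ?_
      rw [hS.T_eq]
      ring_nf

end Count

/-! ### Points avoiding the dangerous sets -/

section Avoid

variable {I : Type*} [Fintype I] [DecidableEq I]
  {φ : I → ℝ → ℝ} {r : I → ℝ} {i₀ : I} {μ : Measure ℝ} {S : Set ℝ}
  {x₀ δ B b ν α c C ρ₁ K c₁ : ℝ} {m : ℕ} {σ τ T ℓ₀ ε : ℝ} {N : ℕ}

theorem Frame.r_le_one (hF : Frame φ r i₀ μ S x₀ δ B b ν α c C ρ₁ K c₁ m) : r i₀ ≤ 1 := by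
  rw [← hF.sum_r]
  exact Finset.single_le_sum (fun i _ => (hF.bounds.r_pos i).le) (Finset.mem_univ i₀)

theorem Frame.exists_one_le_scaled (hF : Frame φ r i₀ μ S x₀ δ B b ν α c C ρ₁ K c₁ m)
    (hS : Scale I (r i₀) δ B b ν α c C ρ₁ K c₁ m σ τ T ℓ₀ ε N) {q a p : ℕ}
    (haq : 3 * a ≤ q) (hp : (p : ℝ) * (4 * m / r i₀) ≤ q + a) {x : ℝ}
    (hxb : Metric.closedBall x (rad ℓ₀ T p) ⊆ Metric.closedBall x₀ ℓ₀)
    {j : ℕ} {v : Fin j → Option I → ℤ} (hj : 1 ≤ j) (hv : ∃ f, mnr (intMat v) f ≠ 0) :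
    ∃ z ∈ Metric.closedBall x (rad ℓ₀ T p), ∃ f,
      1 ≤ |mnr (scaled φ r i₀ σ ε ((q + a) * τ) (a * T) (σ * (a * T) / 2) z * intMat v) f| := by
  have hr0 := hF.bounds.r_pos i₀
  have hr1 := hF.r_le_one
  have hν := hF.bounds.ν_pos
  have hνr := hF.bounds.le_r i₀
  have hν1 := hF.ν_le_one
  have hτ := hS.τ_pos
  have hT := hF.T_pos hS
  have hT' := hS.T_eq
  have hσ := hF.σ_pos hS
  have hκσ := hS.card_mul_σ
  have hℓ := hS.ℓ_pos
  have haq' : 3 * (a : ℝ) ≤ q := by exact_mod_cast haq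
  have haT : 0 ≤ a * T := by positivity
  have hl : 3 / 2 * (Fintype.card (Option I) * σ * (a * T)) = 3 / 8 * ν * (a * T) := by
    rw [hκσ]
    ring
  have hsub := hxb.trans hS.closedBall_subset
  refine exists_one_le_scaled_of_lower hF.bounds hF.sum_r (c₁ := c₁) (m := m)
    (fun c hc => hF.lower c hc x _ (rad_pos hℓ p) ((rad_le hℓ hT.le p).trans hS.ℓ_le_one) hsub)
    hS.ε_pos hS.ε_le_one hS.ε_le_b (by positivity) haT hσ.le ?_ ?_ (rad_pos hℓ p) hsub ?_ hj hv
  · rw [hl]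
    nlinarith
  · rw [hl, hT']
    have h1 : a * ((1 + r i₀) * τ) ≤ (q + a) * τ := by
      have : a * (1 + r i₀) ≤ (q : ℝ) + a := by nlinarith
      nlinarith
    have h2 : 0 ≤ (q + a) * τ := by positivity
    have h3 : 3 / 8 * ν * (a * ((1 + r i₀) * τ)) ≤ 3 / 8 * ν * ((q + a) * τ) := by gcongr
    have h4 : 3 / 8 * ν * ((q + a) * τ) ≤ 3 / 8 * r i₀ * ((q + a) * τ) := by gcongr
    nlinarith
  · have e : rad ℓ₀ T p ^ m = ℓ₀ ^ m * Real.exp (-(T * (p * m))) := by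
      rw [rad, mul_pow, ← Real.exp_nat_mul]
      ring_nf
    rw [e]
    have h1 : (p : ℝ) * m ≤ r i₀ * (q + a) / 4 := by
      have : (p : ℝ) * (4 * m / r i₀) * r i₀ ≤ (q + a) * r i₀ := by gcongr
      have e : (p : ℝ) * (4 * m / r i₀) * r i₀ = 4 * (p * m) := by field_simp
      linarith
    have h2 : T ≤ 2 * τ := by
      rw [hT']
      gcongr
      linarith
    have h3 : T * (p * m) ≤ 2 * τ * (r i₀ * (q + a) / 4) := by gcongr
    have := hS.ε_le
    have h5 := hF.c₁_pos
    refine le_trans ?_ (mul_assoc _ _ _).le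
    exact mul_le_mul this (Real.exp_le_exp.2 (by linarith)) (Real.exp_pos _).le (by positivity)

theorem Frame.local (hF : Frame φ r i₀ μ S x₀ δ B b ν α c C ρ₁ K c₁ m)
    (hS : Scale I (r i₀) δ B b ν α c C ρ₁ K c₁ m σ τ T ℓ₀ ε N) {q a p : ℕ} (ha : N ≤ a)
    (haq : 15 * a < q) (hp : p + a = q) {x : ℝ}
    (hxb : Metric.closedBall x (rad ℓ₀ T p) ⊆ Metric.closedBall x₀ ℓ₀)
    (hsafe : ∀ a', N ≤ a' → 3 * a' ≤ p → ¬ Danger φ r i₀ σ ε ((p + a') * τ) (a' * T) x)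
    {j : ℕ} {v : Fin j → Option I → ℤ} (hj : 1 ≤ j) (hv : ∃ f, mnr (intMat v) f ≠ 0) :
    ∃ z ∈ Metric.closedBall x (rad ℓ₀ T p), ∃ f,
      1 ≤ |mnr (scaled φ r i₀ σ ε ((q + a) * τ) (a * T) (σ * (a * T) / 2) z * intMat v) f| := by
  have hr0 := hF.bounds.r_pos i₀
  have hr1 := hF.r_le_one
  have hτ := hS.τ_pos
  have hT := hF.T_pos hS
  have hT' := hS.T_eq
  have hσ := hF.σ_pos hS
  have hκσ := hS.card_mul_σ
  have hℓ := hS.ℓ_pos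
  have hκ : 0 < (Fintype.card (Option I) : ℝ) := by exact_mod_cast Fintype.card_pos
  have hpq : (p : ℝ) + a = q := by exact_mod_cast hp
  have haq' : 15 * (a : ℝ) < q := by exact_mod_cast haq
  have haN : (N : ℝ) ≤ a := by exact_mod_cast ha
  have hexp : Real.exp (σ * (N * T) / 2) ≤ Real.exp (σ * (a * T) / 2) := by gcongr
  have hexp' : Real.exp (σ * (N * T)) ≤ Real.exp (σ * (a * T)) := by gcongr
  refine exists_one_le_scaled_of_local (τ := τ) (N := a) (ℓ₀ := ℓ₀) hF.bounds hF.sum_r hS.ε_pos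
    hS.ε_le_one hS.ε_le_b hσ.le hτ.le (by linarith [hF.bounds.ν_pos]) (by rw [hT']; ring) hℓ
    hS.ℓ_le_one ?_ ?_ (hxb.trans hS.closedBall_subset) ?_ rfl (hS.big₁.trans_le (by gcongr))
    (hS.big₂.trans_le (by gcongr)) hj hv
  · rw [rad, hT', ← hpq]
    ring_nf
  · rw [hT']
    have : 0 ≤ (1 + r i₀) * τ := by positivity
    nlinarith
  · intro β hβ
    have hβ' : (β : ℝ) ≤ a := by exact_mod_cast hβ
    have h1 := hsafe (2 * a - β) (by omega) (by omega)
    rw [Nat.cast_sub (by omega)] at h1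
    push_cast at h1
    rw [← hpq]
    have e1 : ((p : ℝ) + a + a) * τ - β * τ = (p + (2 * a - β)) * τ := by ring
    have e2 : 2 * (a * T) - (1 + r i₀) * (β * τ) = (2 * a - β) * T := by
      rw [hT']
      ring
    rw [e1, e2]
    exact h1

theorem sum_half_pow_le {N : ℕ} (s : Finset ℕ) (hs : ∀ a ∈ s, N ≤ a) :
    ∑ a ∈ s, (1 / 2 : ℝ) ^ a ≤ 2 * (1 / 2) ^ N := by
  calc ∑ a ∈ s, (1 / 2 : ℝ) ^ a = (1 / 2) ^ N * ∑ a ∈ s, (1 / 2 : ℝ) ^ (a - N) := by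
        rw [Finset.mul_sum]
        refine Finset.sum_congr rfl fun a ha => ?_
        rw [← pow_add, Nat.add_sub_cancel' (hs a ha)]
    _ = (1 / 2) ^ N * ∑ a ∈ s.image (fun a => a - N), (1 / 2 : ℝ) ^ a := by
        rw [Finset.sum_image]
        intro a ha b hb hab
        have := hs a ha
        have := hs b hb
        simp only at hab
        omega
    _ ≤ (1 / 2) ^ N * 2 := by
        gcongr
        exact (summable_geometric_two.sum_le_tsum _ fun _ _ => by positivity).trans_eq
          tsum_geometric_two
    _ = _ := by ring

theorem sum_term_le {c₂ X D g : ℝ} (hc₂ : 0 < c₂) (hc₂1 : c₂ ≤ 1) (hX : 0 < X) (hD : 0 ≤ D)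
    (hg : 0 < g) (hstep : g * (2 / c₂) ^ 15 ≤ 1 / 2) {a d : ℕ} (hd : 1 ≤ d) (hda : d ≤ 15 * a) :
    D * g ^ a * X ^ d * (2 / (c₂ * X)) ^ (d - 1) ≤ c₂ * X / 2 * D * (1 / 2) ^ a := by
  obtain ⟨e, rfl⟩ : ∃ e, d = e + 1 := ⟨d - 1, by omega⟩
  have h1 : 1 ≤ 2 / c₂ := by
    rw [le_div_iff₀ hc₂]
    linarith
  have e1 : D * g ^ a * X ^ (e + 1) * (2 / (c₂ * X)) ^ (e + 1 - 1) =
      c₂ * X / 2 * D * (g ^ a * (2 / c₂) ^ (e + 1)) := by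
    rw [Nat.add_sub_cancel, div_pow, div_pow, mul_pow, pow_succ X, pow_succ 2, pow_succ c₂]
    field_simp
  rw [e1]
  have h2 : g ^ a * (2 / c₂) ^ (e + 1) ≤ (1 / 2) ^ a := by
    calc g ^ a * (2 / c₂) ^ (e + 1) ≤ g ^ a * (2 / c₂) ^ (15 * a) := by gcongr
      _ = (g * (2 / c₂) ^ 15) ^ a := by rw [mul_pow, ← pow_mul]
      _ ≤ _ := by gcongr
  gcongr

/-- The ancestor level used to control the dangerous sets of level `q`. -/
noncomputable def ancestor (m : ℕ) (r₀ : ℝ) (q a : ℕ) : ℕ :=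
  if 15 * a < q then q - a else (q + a) / ⌈4 * m / r₀⌉₊

theorem Frame.exists_avoiding (hF : Frame φ r i₀ μ S x₀ δ B b ν α c C ρ₁ K c₁ m)
    (hS : Scale I (r i₀) δ B b ν α c C ρ₁ K c₁ m σ τ T ℓ₀ ε N) {Inh : ℕ → Set ℝ}
    (hInh : ∀ q, ∀ x ∈ S, Metric.closedBall x (rad ℓ₀ T q) ⊆ Metric.closedBall x₀ ℓ₀ →
      (∀ p, 1 ≤ p → p ≤ q → ∀ a, N ≤ a → 3 * a ≤ p → ∀ w ∈ Metric.closedBall x (rad ℓ₀ T q),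
        ¬ Danger φ r i₀ σ ε ((p + a) * τ) (a * T) w) →
      ∀ w ∈ Inh (q + 1) ∩ Metric.closedBall x (rad ℓ₀ T q),
        ∀ w' ∈ Inh (q + 1) ∩ Metric.closedBall x (rad ℓ₀ T q), |w - w'| ≤ rad ℓ₀ T (q + 1)) :
    ∃ x ∈ S, x ∈ Metric.closedBall x₀ ℓ₀ ∧ ∀ q, 1 ≤ q → x ∉ Inh q := by
  have hA := hF.ahlfors
  have hα := hA.α_pos
  have hc := hA.c_pos
  have hC := hA.C_pos
  have hT := hF.T_pos hS
  have hℓ := hS.ℓ_pos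
  have hr0 := hF.bounds.r_pos i₀
  have hr1 := hF.r_le_one
  have hE := hF.bounds.one_le_enlargeConst
  have hκ5 : (1 : ℝ) ≤ 5 ^ Fintype.card (Option I) := one_le_pow₀ (by norm_num)
  have hD0 : 0 ≤ dangerConst I α c C m K (enlargeConst I B b) / c :=
    div_nonneg (dangerConst_nonneg hc hC hF.one_le_K (by linarith)) hc.le
  have hℓρ : 4 * ℓ₀ ≤ ρ₁ := by
    have := hS.ℓ_le_ρ₁
    nlinarith
  set M := c / C * (Real.exp T / 4) ^ α with hM
  have hMeq : M = c / C / 4 ^ α * Real.exp (α * T) := by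
    rw [hM, Real.div_rpow (Real.exp_pos _).le (by norm_num), ← Real.exp_mul, mul_comm T]
    field_simp
  have hM0 : 0 < M := by positivity
  obtain ⟨Ch, hCh⟩ := hA.exists_isTree hS.two_le (ρ := rad ℓ₀ T) (rad_pos hℓ)
    (fun q => (rad_le hℓ hT.le q).trans (by linarith)) rad_succ
  set D := dangerConst I α c C m K (enlargeConst I B b) / c with hD
  set g := Real.exp (-(α / m * (σ / 2) * T)) with hg
  let J : ℕ → Finset (Option ℕ) := fun q => Finset.insertNone (Finset.Icc N (q / 3))
  let Bd : ℕ → Option ℕ → Set ℝ := fun q o =>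
    o.elim (Inh q) fun a => {w | Danger φ r i₀ σ ε ((q + a) * τ) (a * T) w}
  let p : ℕ → Option ℕ → ℕ := fun q o => o.elim (q - 1) fun a => ancestor m (r i₀) q a
  let nu : ℕ → Option ℕ → ℝ := fun q o =>
    o.elim (C / c * 4 ^ α) fun a => D * g ^ a * Real.exp (α * T) ^ (q - ancestor m (r i₀) q a)
  let Bad : ℕ → Set ℝ := fun q => ⋃ i ∈ J q, Bd q i
  have hm4 : 4 ≤ ⌈4 * m / r i₀⌉₊ := by
    have h1 : (4 : ℝ) ≤ 4 * m / r i₀ := by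
      rw [le_div_iff₀ hr0]
      have : (1 : ℝ) ≤ m := by exact_mod_cast hF.one_le_m
      linarith
    exact_mod_cast h1.trans (Nat.le_ceil _)
  have hanc : ∀ q a, N ≤ a → 3 * a ≤ q → ancestor m (r i₀) q a + 1 ≤ q ∧
      q ≤ ancestor m (r i₀) q a + 15 * a := by
    intro q a ha haq
    have hN := hS.one_le_N
    unfold ancestor
    split_ifs with h
    · omega
    · have : (q + a) / ⌈4 * m / r i₀⌉₊ ≤ (q + a) / 4 := Nat.div_le_div_left hm4 (by norm_num)
      generalize (q + a) / ⌈4 * m / r i₀⌉₊ = k at this ⊢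
      constructor <;> omega
  have hBadD : ∀ q a, N ≤ a → 3 * a ≤ q →
      {w | Danger φ r i₀ σ ε ((q + a) * τ) (a * T) w} ⊆ Bad q := by
    intro q a ha haq
    exact fun w hw => mem_iUnion₂.2
      ⟨some a, Finset.some_mem_insertNone.2 (Finset.mem_Icc.2 ⟨ha, by omega⟩), hw⟩
  have hsafe : ∀ q x, (∀ p', 1 ≤ p' → p' ≤ q →
      Disjoint (Metric.closedBall x (rad ℓ₀ T q)) (Bad p')) →
      ∀ p, 1 ≤ p → p ≤ q → ∀ a, N ≤ a → 3 * a ≤ p → ∀ w ∈ Metric.closedBall x (rad ℓ₀ T q),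
        ¬ Danger φ r i₀ σ ε ((p + a) * τ) (a * T) w := by
    intro q x h p hp1 hp2 a ha hap w hw hdan
    exact Set.disjoint_left.1 (h p hp1 hp2) hw (hBadD p a ha hap hdan)
  have hcard := hCh.card_survivors (Bad := Bad) (x₀ := x₀) (J := J) (B := Bd) (p := p) (ν := nu)
    hF.mem hM0 (fun q => subset_rfl) ?_ ?_ ?_ ?_
  · obtain ⟨x, hxS, hx0, hx⟩ := hCh.exists_avoiding hA.closed hF.mem hcard
    rw [rad_zero] at hx0
    refine ⟨x, hxS, hx0, fun q hq hxI => ?_⟩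
    obtain ⟨z, -, hxz, hz⟩ := hx q hq
    refine Set.disjoint_left.1 hz hxz (mem_iUnion₂.2 ⟨none, ?_, hxI⟩)
    simp [J]
  · intro q i hi
    cases i with
    | none => simp [p]
    | some a =>
      have ha := Finset.mem_Icc.1 (Finset.some_mem_insertNone.1 hi)
      have := (hanc (q + 1) a ha.1 (by omega)).1
      simp only [p, Option.elim_some]
      omega
  · intro q i hi
    cases i with
    | none =>
      simp only [nu, Option.elim_none]
      positivity
    | some a =>
      simp only [nu, Option.elim_some]
      positivity
  · intro q i hi x hx hxb hdis F hF1 hF2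
    rw [rad_zero] at hxb
    cases i with
    | none =>
      simp only [p, Option.elim_none, Nat.add_sub_cancel, nu, Bd] at *
      have hI := hInh q x hx hxb (hsafe q x hdis)
      rcases F.eq_empty_or_nonempty with rfl | ⟨z₀, hz₀⟩
      · simp only [Finset.card_empty, Nat.cast_zero]
        positivity
      · have hrp := rad_pos (T := T) hℓ (q + 1)
        have hrl := rad_le hℓ hT.le (q + 1)
        have h4 := hA.card_mul_le hrp (by linarith) (V := C * (4 * rad ℓ₀ T (q + 1)) ^ α)
          (by positivity) (F := F) (E := Metric.closedBall z₀ (4 * rad ℓ₀ T (q + 1))) ?_ hF2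
          (hA.upper z₀ (hF1 z₀ hz₀).1 _ (by positivity) (by linarith))
        · rw [Real.mul_rpow (by norm_num) hrp.le] at h4
          have : 0 < rad ℓ₀ T (q + 1) ^ α := by positivity
          refine le_of_mul_le_mul_right (h4.trans_eq ?_)
            (show 0 < c * rad ℓ₀ T (q + 1) ^ α by positivity)
          field_simp
        · intro z hz
          obtain ⟨hzS, hzsub, hmeet⟩ := hF1 z hz
          obtain ⟨-, hzsub₀, hmeet₀⟩ := hF1 z₀ hz₀
          obtain ⟨w, hw, hwI⟩ := Set.not_disjoint_iff.1 hmeet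
          obtain ⟨w₀, hw₀, hwI₀⟩ := Set.not_disjoint_iff.1 hmeet₀
          have h5 := hI w ⟨hwI, hzsub hw⟩ w₀ ⟨hwI₀, hzsub₀ hw₀⟩
          refine ⟨hzS, Metric.closedBall_subset_closedBall' ?_⟩
          have h6 := Metric.mem_closedBall.1 hw
          have h7 := Metric.mem_closedBall.1 hw₀
          have h8 := dist_triangle4 z w w₀ z₀
          rw [dist_comm z w, Real.dist_eq w w₀] at h8
          linarith
    | some a =>
      have ha := Finset.mem_Icc.1 (Finset.some_mem_insertNone.1 hi)
      obtain ⟨h1, h2⟩ := hanc (q + 1) a ha.1 (by omega)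
      simp only [p, Option.elim_some, nu, Bd] at *
      have h3 := hF.card_danger_le hS (q := q + 1) (a := a) ha.1 (by omega) hx hxb ?_ hF1 hF2
      · refine h3.trans_eq ?_
        rw [← Nat.cast_sub (by omega), ← Real.exp_nat_mul, ← Real.exp_nat_mul,
          mul_comm (α * T), mul_comm (-(α / m * (σ / 2) * T))]
      · intro j v hj hv
        by_cases hloc : 15 * a < q + 1
        · have hanc' : ancestor m (r i₀) (q + 1) a = q + 1 - a := if_pos hloc
          refine hF.local hS ha.1 hloc (by omega) hxb (fun a' ha' hap => ?_) hj hv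
          have hN := hS.one_le_N
          exact hsafe _ x hdis _ (by omega) le_rfl a' ha' hap x
            (Metric.mem_closedBall_self (rad_pos hℓ _).le)
        · have hanc' : ancestor m (r i₀) (q + 1) a = (q + 1 + a) / ⌈4 * m / r i₀⌉₊ := if_neg hloc
          refine hF.exists_one_le_scaled hS (by omega) ?_ hxb hj hv
          have h4 : ancestor m (r i₀) (q + 1) a * ⌈4 * m / r i₀⌉₊ ≤ q + 1 + a := by
            rw [hanc']
            exact Nat.div_mul_le_self _ _
          have h5 : (ancestor m (r i₀) (q + 1) a : ℝ) * ⌈4 * m / r i₀⌉₊ ≤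
              ((q + 1 : ℕ) : ℝ) + a := by exact_mod_cast h4
          refine le_trans ?_ h5
          gcongr
          exact Nat.le_ceil _
  · intro q
    simp only [J, Finset.sum_insertNone]
    have h1 : nu (q + 1) none * (2 / M) ^ (q - p (q + 1) none) ≤ M / 4 := by
      simp only [nu, p, Option.elim_none, Nat.add_sub_cancel, Nat.sub_self, pow_zero, mul_one]
      rw [hMeq]
      exact hS.inh
    have hc₂ : c / C / 4 ^ α ≤ 1 := by
      have h4 : (1 : ℝ) ≤ 4 ^ α := Real.one_le_rpow (by norm_num) hα.le
      have h5 : c / C ≤ 1 := (div_le_one hC).2 (hA.le_of_mem hF.mem)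
      exact (div_le_one (by positivity)).2 (h5.trans h4)
    have h2 : ∀ a ∈ Finset.Icc N ((q + 1) / 3),
        nu (q + 1) (some a) * (2 / M) ^ (q - p (q + 1) (some a)) ≤ M / 2 * D * (1 / 2) ^ a := by
      intro a ha
      rw [Finset.mem_Icc] at ha
      obtain ⟨h3, h4⟩ := hanc (q + 1) a ha.1 (by omega)
      simp only [nu, p, Option.elim_some]
      have e : q - ancestor m (r i₀) (q + 1) a = q + 1 - ancestor m (r i₀) (q + 1) a - 1 := by
        omega
      rw [e, hMeq]
      exact sum_term_le (by positivity) hc₂ (Real.exp_pos _) hD0 (Real.exp_pos _) hS.step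
        (by omega) (by omega)
    have h3 : ∑ a ∈ Finset.Icc N ((q + 1) / 3), nu (q + 1) (some a) *
        (2 / M) ^ (q - p (q + 1) (some a)) ≤ M / 4 := by
      refine (Finset.sum_le_sum h2).trans ?_
      rw [← Finset.mul_sum]
      have h4 := sum_half_pow_le (N := N) (Finset.Icc N ((q + 1) / 3))
        fun a ha => (Finset.mem_Icc.1 ha).1
      have h5 : M / 2 * D * ∑ a ∈ Finset.Icc N ((q + 1) / 3), (1 / 2 : ℝ) ^ a ≤
          M / 2 * D * (2 * (1 / 2) ^ N) := by gcongr
      have h6 := hS.tail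
      rw [← hD] at h6
      nlinarith
    linarith

end Avoid

/-! ### Choosing the parameters -/

section Choose

variable {I : Type*} [Fintype I] [DecidableEq I]
  {φ : I → ℝ → ℝ} {r : I → ℝ} {i₀ : I} {μ : Measure ℝ} {S : Set ℝ}
  {x₀ δ B b ν α c C ρ₁ K c₁ : ℝ} {m : ℕ}

theorem eventually_le_mul_exp {A A' β : ℝ} (hA : 0 < A) (hβ : 0 < β) :
    ∀ᶠ t : ℝ in atTop, A' < A * Real.exp (β * t) :=
  ((Real.tendsto_exp_atTop.comp (tendsto_id.const_mul_atTop hβ)).const_mul_atTop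
    hA).eventually_gt_atTop A'

theorem Frame.exists_scale (hF : Frame φ r i₀ μ S x₀ δ B b ν α c C ρ₁ K c₁ m) :
    ∃ σ τ T ℓ₀ ε N, Scale I (r i₀) δ B b ν α c C ρ₁ K c₁ m σ τ T ℓ₀ ε N := by
  have hα := hF.ahlfors.α_pos
  have hc := hF.ahlfors.c_pos
  have hC := hF.ahlfors.C_pos
  have hρ₁ := hF.ahlfors.ρ₁_pos
  have hδ := hF.δ_pos
  have hc₁ := hF.c₁_pos
  have hr0 := hF.bounds.r_pos i₀
  have hν := hF.bounds.ν_pos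
  have hb := hF.bounds.b_pos
  have hm : (0 : ℝ) < m := by exact_mod_cast hF.one_le_m
  have hκ : 0 < (Fintype.card (Option I) : ℝ) := by exact_mod_cast Fintype.card_pos
  set κ := Fintype.card (Option I)
  obtain ⟨σ, hσ⟩ : ∃ σ, σ = ν / (4 * κ) := ⟨_, rfl⟩
  have hσ0 : 0 < σ := by
    rw [hσ]
    positivity
  have h5 : (0 : ℝ) < 5 ^ κ := by positivity
  obtain ⟨ℓ₀, hℓ⟩ : ∃ ℓ₀, ℓ₀ = min 1 (min (ρ₁ / (4 * 5 ^ κ)) (δ / (1 + 5 ^ κ))) := ⟨_, rfl⟩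
  have hℓ0 : 0 < ℓ₀ := by
    rw [hℓ]
    positivity
  have hℓ1 : ℓ₀ ≤ 1 := hℓ.trans_le (min_le_left _ _)
  have hℓ2 : ℓ₀ ≤ ρ₁ / (4 * 5 ^ κ) := hℓ.trans_le ((min_le_right _ _).trans (min_le_left _ _))
  have hℓ3 : ℓ₀ ≤ δ / (1 + 5 ^ κ) := hℓ.trans_le ((min_le_right _ _).trans (min_le_right _ _))
  rw [le_div_iff₀ (by positivity)] at hℓ2 hℓ3
  obtain ⟨T, hT0, hT1, hT2, hT3⟩ :=
    ((eventually_gt_atTop (0 : ℝ)).and ((eventually_le_mul_exp (A := 1)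
      (A' := 2 * (2 / (c / C / 4 ^ α)) ^ 15) one_pos
      (show 0 < α / m * (σ / 2) by positivity)).and
      ((eventually_le_mul_exp (A := 1) (A' := 2) one_pos one_pos).and
      (eventually_le_mul_exp (A := c / C / 4 ^ α / 4) (A' := C / c * 4 ^ α)
        (by positivity) hα)))).exists
  have hst : 0 < σ * T / 2 := by positivity
  obtain ⟨N, hN0, hN1, hN2, hN3, hN4⟩ :=
    ((eventually_ge_atTop 1).and ((tendsto_natCast_atTop_atTop.eventually
      (eventually_le_mul_exp (A := 1) (A' := 2 * κ * enlargeConst I B b) one_pos hst)).and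
      ((tendsto_natCast_atTop_atTop.eventually
      (eventually_le_mul_exp (A := (1 / (κ : ℝ)) ^ κ) (A' := localConst I B b ℓ₀)
        (by positivity) hst)).and
      ((tendsto_natCast_atTop_atTop.eventually
      (eventually_le_mul_exp (A := ((1 / (κ : ℝ)) ^ κ) ^ 2)
        (A' := κ * localConst I B b ℓ₀ * Real.exp (2 * (T / (1 + r i₀))))
        (by positivity) (show 0 < σ * T by positivity))).and
      (((tendsto_pow_atTop_nhds_zero_of_lt_one (r := (1 / 2 : ℝ)) (by norm_num)
        (by norm_num)).const_mul
        (4 * (dangerConst I α c C m K (enlargeConst I B b) / c))).eventually_le_const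
        (show _ < (1 : ℝ) by rw [mul_zero]; exact one_pos)))))).exists
  refine ⟨σ, T / (1 + r i₀), T, ℓ₀, min 1 (min b (c₁ * ℓ₀ ^ m)), N, ?_⟩
  constructor
  · positivity
  · exact min_le_left _ _
  · exact (min_le_right _ _).trans (min_le_left _ _)
  · exact (min_le_right _ _).trans (min_le_right _ _)
  · exact hσ
  · positivity
  · field_simp
  · exact hℓ0
  · exact hℓ1
  · linarith
  · linarith
  · exact hN0
  · have e : σ * (N * T) / 2 = σ * T / 2 * N := by ring
    rw [e, Real.exp_neg, ← div_eq_mul_inv, div_le_one (Real.exp_pos _)]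
    linarith
  · have e : σ * (N * T) / 2 = σ * T / 2 * N := by ring
    rw [e]
    exact hN2
  · have e : σ * (N * T) = σ * T * N := by ring
    rw [e]
    exact hN3
  · rw [Real.exp_neg, inv_mul_le_iff₀ (Real.exp_pos _)]
    linarith
  · exact hN4
  · rw [one_mul, one_mul] at hT2
    exact hT2.le
  · linarith

end Choose

/-! ### Simultaneous approximation at points outside the dangerous sets -/

section Transference

variable {I : Type*} [Fintype I]

theorem exists_int_dvd_sum {m : ℤ} (hm : m ≠ 0) (p : I → ℤ) {r : I → ℝ} (hr : ∑ i, r i = 1) :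
    ∃ a : I → ℤ, a ≠ 0 ∧ (∀ i, |(a i : ℝ)| ≤ |(m : ℝ)| ^ r i) ∧ m ∣ ∑ i, a i * p i := by
  classical
  have hI : (Finset.univ : Finset I).Nonempty := by
    by_contra h
    rw [Finset.not_nonempty_iff_eq_empty] at h
    rw [h, Finset.sum_empty] at hr
    exact zero_ne_one hr
  have hM : 0 < |(m : ℝ)| := abs_pos.2 (by exact_mod_cast hm)
  let s : Finset (I → ℕ) := Fintype.piFinset fun i => Finset.range (⌊|(m : ℝ)| ^ r i⌋₊ + 1)
  have hlt : (Finset.Ico 0 |m|).card < s.card := by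
    have h1 : |(m : ℝ)| < ∏ i, ((⌊|(m : ℝ)| ^ r i⌋₊ : ℝ) + 1) := by
      calc |(m : ℝ)| = ∏ i, |(m : ℝ)| ^ r i := by
            rw [← Real.rpow_sum_of_pos hM, hr, Real.rpow_one]
        _ < _ := Finset.prod_lt_prod_of_nonempty (fun i _ => by positivity)
            (fun i _ => Nat.lt_floor_add_one _) hI
    rw [Fintype.card_piFinset, Int.card_Ico, sub_zero]
    simp only [Finset.card_range]
    have h2 : ((|m|.toNat : ℤ) : ℝ) = |(m : ℝ)| := by
      rw [Int.toNat_of_nonneg (abs_nonneg m), Int.cast_abs]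
    have h3 : ((|m|.toNat : ℕ) : ℝ) < ((∏ i, (⌊|(m : ℝ)| ^ r i⌋₊ + 1) : ℕ) : ℝ) := by
      push_cast at h2 ⊢
      linarith
    exact_mod_cast h3
  obtain ⟨x, hx, y, hy, hxy, hf⟩ := Finset.exists_ne_map_eq_of_card_lt_of_maps_to hlt
    (f := fun b : I → ℕ => (∑ i, (b i : ℤ) * p i) % m) fun b _ =>
      Finset.mem_coe.2 (Finset.mem_Ico.2 ⟨Int.emod_nonneg _ hm, Int.emod_lt_abs _ hm⟩)
  have hle : ∀ z ∈ s, ∀ i, (z i : ℝ) ≤ |(m : ℝ)| ^ r i := by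
    intro z hz i
    have := Finset.mem_range.1 (Fintype.mem_piFinset.1 hz i)
    exact (Nat.le_floor_iff (by positivity)).1 (by omega)
  refine ⟨fun i => (x i : ℤ) - y i, fun h => hxy ?_, fun i => ?_, ?_⟩
  · ext i
    have := congrFun h i
    simp only [Pi.zero_apply] at this
    omega
  · push_cast
    have h1 := hle x hx i
    have h2 := hle y hy i
    rw [abs_le]
    constructor <;> linarith [Nat.cast_nonneg (α := ℝ) (x i), Nat.cast_nonneg (α := ℝ) (y i)]
  · have : ∑ i, ((x i : ℤ) - y i) * p i = ∑ i, (x i : ℤ) * p i - ∑ i, (y i : ℤ) * p i := by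
      rw [← Finset.sum_sub_distrib]
      simp [sub_mul]
    rw [this]
    exact Int.ModEq.dvd hf.symm

variable [DecidableEq I]
  {φ : I → ℝ → ℝ} {r : I → ℝ} {i₀ : I} {I₀ : Set ℝ} {B b ν σ τ T ε : ℝ} {N : ℕ}

theorem CurveBounds.danger_of_approx (h : CurveBounds r i₀ φ I₀ B b ν) (hr : ∑ i, r i = 1)
    {s l t η w : ℝ} (hε : 0 < ε) (hσl : 0 ≤ σ * l) (hw : w ∈ I₀)
    (hs1 : 1 < ε * Real.exp (ν * s))
    (hs2 : Fintype.card I * B * Real.exp l < ε * Real.exp (ν * s)) {m : ℤ} (hm : m ≠ 0)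
    (hη : Fintype.card I * η * Real.exp (t - Real.log |(m : ℝ)|) < ε) (hs0 : 0 ≤ s)
    (hst : s ≤ t - Real.log |(m : ℝ)|) {p : I → ℤ}
    (hp : ∀ i, |m * φ i w - p i| < η * |(m : ℝ)| ^ (-r i)) : Danger φ r i₀ σ ε t l w := by
  obtain ⟨a, ha0, ha, k, hk⟩ := exists_int_dvd_sum hm p hr
  have hm' : (m : ℝ) ≠ 0 := by exact_mod_cast hm
  have hM : 0 < |(m : ℝ)| := abs_pos.2 hm'
  have hB := h.one_le_B
  set M := |(m : ℝ)|
  have hMr : ∀ i, M ^ r i = Real.exp (r i * Real.log M) := fun i => by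
    rw [Real.rpow_def_of_pos hM, mul_comm]
  have hexp : ∀ i, ε * Real.exp (ν * s) * M ^ r i ≤ ε * Real.exp (r i * t) := by
    intro i
    rw [hMr, mul_assoc, ← Real.exp_add]
    have h1 : ν * s ≤ r i * s := mul_le_mul_of_nonneg_right (h.le_r i) hs0
    have h2 : r i * s ≤ r i * (t - Real.log M) := mul_le_mul_of_nonneg_left hst (h.r_pos i).le
    gcongr
    linarith
  refine ⟨fun o => o.elim (-k) a, fun h0 => ha0 ?_, fun o => ?_⟩
  · ext i
    exact congrFun h0 (some i)
  · by_cases ho : o = some i₀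
    · subst ho
      rw [mulVec_curveMat_self]
      have h1 : |hatComb' φ (fun o => ((o.elim (-k) a : ℤ) : ℝ)) w| ≤
          Fintype.card I * B * M ^ r i₀ := by
        have e : hatComb' φ (fun o => ((o.elim (-k) a : ℤ) : ℝ)) w =
            ∑ i, deriv (φ i) w * a i := by
          rw [hatComb', Fintype.sum_option, deriv_hatFun_none, zero_mul, zero_add]
          rfl
        rw [e]
        refine (Finset.abs_sum_le_sum_abs _ _).trans ?_
        have h2 : ∀ i ∈ Finset.univ, |deriv (φ i) w * a i| ≤ B * M ^ r i₀ := by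
          intro i _
          rw [abs_mul]
          have h3 : M ^ r i ≤ M ^ r i₀ := by
            refine Real.rpow_le_rpow_of_exponent_le ?_ (h.r_le i)
            have : (1 : ℤ) ≤ |m| := Int.one_le_abs hm
            simp only [M, ← Int.cast_abs]
            exact_mod_cast this
          exact mul_le_mul (h.deriv_le i w hw) ((ha i).trans h3) (abs_nonneg _) (by linarith)
        refine (Finset.sum_le_sum h2).trans_eq ?_
        rw [Finset.sum_const, Finset.card_univ, nsmul_eq_mul, mul_assoc]
      refine h1.trans_lt ?_
      have h2 : ε * Real.exp (r i₀ * t) * Real.exp (-l) ≤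
          ε * Real.exp (bnd r i₀ σ t l (some i₀)) := by
        rw [mul_assoc, ← Real.exp_add]
        simp only [bnd, wt, if_true, Option.elim_some]
        gcongr
        linarith
      refine lt_of_lt_of_le ?_ h2
      have h3 := hexp i₀
      have h4 : Fintype.card I * B * Real.exp l * M ^ r i₀ <
          ε * Real.exp (ν * s) * M ^ r i₀ := by gcongr
      have h5 : Fintype.card I * B * M ^ r i₀ =
          Fintype.card I * B * Real.exp l * M ^ r i₀ * Real.exp (-l) := by
        rw [Real.exp_neg]
        field_simp
      rw [h5]
      exact mul_lt_mul_of_pos_right (h4.trans_le h3) (Real.exp_pos _)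
    · cases o with
      | none =>
        rw [mulVec_curveMat_none]
        have e : hatComb φ (fun o => ((o.elim (-k) a : ℤ) : ℝ)) w =
            (∑ i, a i * (m * φ i w - p i)) / m := by
          rw [hatComb, Fintype.sum_option]
          have hk' : ∑ i, (a i : ℝ) * p i = m * k := by exact_mod_cast hk
          simp only [mul_sub, Finset.sum_sub_distrib, hk']
          rw [sub_div, mul_div_cancel_left₀ _ hm', Finset.sum_div]
          simp only [hatFun, Option.elim_none, Option.elim_some, one_mul]
          push_cast
          rw [add_comm, ← sub_eq_add_neg]
          congr 1
          refine Finset.sum_congr rfl fun i _ => ?_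
          field_simp
        rw [e, abs_div]
        have h1 : |∑ i, a i * (m * φ i w - p i)| ≤ Fintype.card I * η := by
          refine (Finset.abs_sum_le_sum_abs _ _).trans ?_
          have h2 : ∀ i ∈ Finset.univ, |a i * (m * φ i w - p i)| ≤ η := by
            intro i _
            rw [abs_mul]
            refine (mul_le_mul (ha i) (hp i).le (abs_nonneg _) (by positivity)).trans_eq ?_
            rw [Real.rpow_neg hM.le]
            have : 0 < M ^ r i := by positivity
            field_simp
          refine (Finset.sum_le_sum h2).trans_eq ?_
          rw [Finset.sum_const, Finset.card_univ, nsmul_eq_mul]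
        have h2 : ε * Real.exp (-t) ≤ ε * Real.exp (bnd r i₀ σ t l none) := by
          simp only [bnd, wt]
          gcongr
          simp
          linarith
        refine lt_of_lt_of_le ?_ h2
        rw [div_lt_iff₀ hM]
        refine h1.trans_lt ?_
        rw [Real.exp_sub, Real.exp_log hM] at hη
        rw [Real.exp_neg, mul_assoc, inv_mul_eq_div, ← div_lt_iff₀ (by positivity)]
        refine lt_of_eq_of_lt ?_ hη
        field_simp
      | some i =>
        rw [mulVec_curveMat_other _ _ (by simp) ho]
        have h2 : ε * Real.exp (r i * t) ≤ ε * Real.exp (bnd r i₀ σ t l (some i)) := by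
          simp only [bnd, wt, if_neg ho, Option.elim_some]
          gcongr
          linarith
        refine lt_of_lt_of_le ?_ ((hexp i).trans h2)
        have : 0 < M ^ r i := by positivity
        refine (ha i).trans_lt ?_
        exact lt_mul_of_one_lt_left this hs1

end Transference

/-! ### Inhomogeneous approximation -/

section Inhomogeneous

variable {I : Type*} [Fintype I] [DecidableEq I]
  {φ : I → ℝ → ℝ} {r : I → ℝ} {i₀ : I} {μ : Measure ℝ} {S : Set ℝ}
  {x₀ δ B b ν α c C ρ₁ K c₁ : ℝ} {m : ℕ} {σ τ T ℓ₀ ε : ℝ} {N : ℕ}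

theorem Frame.exists_le_of_not_danger (hF : Frame φ r i₀ μ S x₀ δ B b ν α c C ρ₁ K c₁ m)
    (hS : Scale I (r i₀) δ B b ν α c C ρ₁ K c₁ m σ τ T ℓ₀ ε N) {s η : ℝ}
    (hs : 4 * N * τ ≤ s) (hs1 : 1 < ε * Real.exp (ν * s))
    (hs2 : Fintype.card I * B * Real.exp (N * T) < ε * Real.exp (ν * s)) (hη0 : 0 < η)
    (hη : Fintype.card I * η * Real.exp (s + τ) < ε) {q : ℕ} {w : ℝ}
    (hw : w ∈ Metric.closedBall x₀ ℓ₀)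
    (hsafe : ∀ p, 1 ≤ p → p ≤ q → ∀ a, N ≤ a → 3 * a ≤ p →
      ¬ Danger φ r i₀ σ ε ((p + a) * τ) (a * T) w)
    {k : ℤ} (hk : k ≠ 0) (hkq : Real.log |(k : ℝ)| ≤ q * τ - s - τ) (p : I → ℤ) :
    ∃ i, η * |(k : ℝ)| ^ (-r i) ≤ |k * φ i w - p i| := by
  by_contra! hp
  have hτ := hS.τ_pos
  have hN := hS.one_le_N
  have hT := hF.T_pos hS
  have hσ := hF.σ_pos hS
  have hlog : 0 ≤ Real.log |(k : ℝ)| := by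
    refine Real.log_nonneg ?_
    have : (1 : ℤ) ≤ |k| := Int.one_le_abs hk
    rw [← Int.cast_abs]
    exact_mod_cast this
  have hs0 : 0 ≤ s := le_trans (by positivity) hs
  set j := ⌈(Real.log |(k : ℝ)| + s) / τ⌉₊ with hj
  have h1 : (Real.log |(k : ℝ)| + s) / τ ≤ j := Nat.le_ceil _
  have h2 : (j : ℝ) < (Real.log |(k : ℝ)| + s) / τ + 1 := Nat.ceil_lt_add_one (by positivity)
  rw [div_le_iff₀ hτ] at h1
  have h2' : (j : ℝ) * τ < Real.log |(k : ℝ)| + s + τ := by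
    have := mul_lt_mul_of_pos_right h2 hτ
    rwa [add_mul, div_mul_cancel₀ _ hτ.ne', one_mul] at this
  have hj4 : 4 * N ≤ j := by
    have : (4 * N : ℝ) * τ ≤ j * τ := by linarith
    exact_mod_cast le_of_mul_le_mul_right this hτ
  have hjq : j ≤ q := by
    have : (j : ℝ) * τ ≤ q * τ := by linarith
    exact_mod_cast le_of_mul_le_mul_right this hτ
  refine hsafe (j - N) (by omega) (by omega) N le_rfl (by omega) ?_
  rw [Nat.cast_sub (by omega), sub_add_cancel]
  have hn : 0 ≤ Fintype.card I * η := by positivity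
  refine hF.bounds.danger_of_approx hF.sum_r hS.ε_pos (by positivity)
    (hS.closedBall_subset hw) hs1 hs2 hk (lt_of_le_of_lt ?_ hη) hs0 (by linarith) hp
  gcongr
  linarith

/-- The points close to an inhomogeneous rational point of complexity of level `q`. -/
def inhSet (φ ϑ : I → ℝ → ℝ) (r : I → ℝ) (τ lam η M₀ : ℝ) (q : ℕ) : Set ℝ :=
  {x | ∃ k : ℤ, M₀ ≤ |(k : ℝ)| ∧ (q - 1) * τ - lam < Real.log |(k : ℝ)| ∧
    Real.log |(k : ℝ)| ≤ q * τ - lam ∧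
    ∃ p : I → ℤ, ∀ i, |k * φ i x - ϑ i x - p i| < η * |(k : ℝ)| ^ (-r i)}

theorem Frame.abs_sub_le_of_bounds (hF : Frame φ r i₀ μ S x₀ δ B b ν α c C ρ₁ K c₁ m)
    {x y : ℝ} (hx : x ∈ Metric.closedBall x₀ δ) (hy : y ∈ Metric.closedBall x₀ δ) (i : I) :
    |φ i x - φ i y| ≤ B * |x - y| := by
  have := (convex_closedBall x₀ δ).norm_image_sub_le_of_norm_deriv_le
    (fun z hz => hF.bounds.differentiable i z hz) (fun z hz => hF.bounds.deriv_le i z hz) hy hx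
  simpa [Real.norm_eq_abs] using this

theorem Frame.le_abs_sub (hF : Frame φ r i₀ μ S x₀ δ B b ν α c C ρ₁ K c₁ m)
    {x y : ℝ} (hx : x ∈ Metric.closedBall x₀ δ) (hy : y ∈ Metric.closedBall x₀ δ) :
    b * |x - y| ≤ |φ i₀ x - φ i₀ y| := by
  wlog h : x < y generalizing x y
  · rcases (not_lt.1 h).eq_or_lt with rfl | h'
    · simp
    · rw [abs_sub_comm x, abs_sub_comm (φ i₀ x)]
      exact this hy hx h'
  have hsub : Icc x y ⊆ Metric.closedBall x₀ δ :=
    (convex_closedBall x₀ δ).ordConnected.out hx hy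
  obtain ⟨z, hz, hd⟩ := exists_deriv_eq_slope (φ i₀) h
    (fun z hz => (hF.bounds.differentiable i₀ z (hsub hz)).continuousAt.continuousWithinAt)
    (fun z hz => (hF.bounds.differentiable i₀ z
      (hsub (Ioo_subset_Icc_self hz))).differentiableWithinAt)
  have h1 := hF.bounds.lower z (hsub (Ioo_subset_Icc_self hz))
  rw [hd, abs_div, le_div_iff₀ (abs_pos.2 (by linarith))] at h1
  rwa [abs_sub_comm x, abs_sub_comm (φ i₀ x)]

end Inhomogeneous

section InhomogeneousUnique

variable {I : Type*}

theorem rpow_neg_eq_exp {M : ℝ} (hM : 0 < M) (s : ℝ) : M ^ (-s) = Real.exp (-(s * Real.log M)) := by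
  rw [Real.rpow_def_of_pos hM]
  ring_nf

theorem inhomogeneous_eq {φ ϑ r : I → ℝ} {φ' ϑ' : I → ℝ} {r₀ Q s τ lam η ζ B L d : ℝ}
    (hr0 : ∀ i, 0 ≤ r i) (hr : ∀ i, r i ≤ r₀) (hr1 : r₀ ≤ 1) (hQ : 0 ≤ Q) (hτ : 0 ≤ τ)
    (hs : 0 ≤ s) (hlam : s + 2 * τ + 1 ≤ lam) (hη : 0 < η) (hη1 : η ≤ 1) (hζ0 : 0 ≤ ζ)
    (hζ : 8 * ζ * Real.exp τ ≤ η) (hB : 0 ≤ B) (hL : 0 ≤ L)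
    (hBL : 8 * (B + L) * Real.exp (τ - lam) ≤ η)
    (hd : d ≤ 2 * Real.exp (-((1 + r₀) * Q)))
    (hφ : ∀ i, |φ i - φ' i| ≤ B * d) (hϑ : ∀ i, |ϑ i - ϑ' i| ≤ L * d)
    (hsafe : ∀ k : ℤ, k ≠ 0 → Real.log |(k : ℝ)| ≤ Q - s - τ → ∀ p : I → ℤ,
      ∃ i, η * |(k : ℝ)| ^ (-r i) ≤ |k * φ i - p i|)
    {k k' : ℤ} (hk : 1 ≤ |(k : ℝ)|) (hk' : 1 ≤ |(k' : ℝ)|)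
    (hkl : Q - lam < Real.log |(k : ℝ)|) (hkl' : Q - lam < Real.log |(k' : ℝ)|)
    (hku : Real.log |(k : ℝ)| ≤ Q + τ - lam) (hku' : Real.log |(k' : ℝ)| ≤ Q + τ - lam)
    {p p' : I → ℤ} (hp : ∀ i, |k * φ i - ϑ i - p i| < ζ * |(k : ℝ)| ^ (-r i))
    (hp' : ∀ i, |k' * φ' i - ϑ' i - p' i| < ζ * |(k' : ℝ)| ^ (-r i)) : k = k' ∧ p = p' := by
  have hX : 0 ≤ Q + τ - lam := (Real.log_nonneg hk).trans hku
  have habs : ∀ k : ℤ, 1 ≤ |(k : ℝ)| → Real.log |(k : ℝ)| ≤ Q + τ - lam →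
      |(k : ℝ)| ≤ Real.exp (Q + τ - lam) := fun k h1 h2 => by
    rwa [← Real.log_le_iff_le_exp (by linarith)]
  have hsmall : ∀ k : ℤ, 1 ≤ |(k : ℝ)| → Q - lam < Real.log |(k : ℝ)| → ∀ i,
      ζ * |(k : ℝ)| ^ (-r i) ≤ η / 8 * Real.exp (-(r i * (Q + τ - lam))) := by
    intro k h1 h2 i
    rw [rpow_neg_eq_exp (by linarith)]
    have h3 : Real.exp (-(r i * Real.log |(k : ℝ)|)) ≤
        Real.exp τ * Real.exp (-(r i * (Q + τ - lam))) := by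
      rw [← Real.exp_add, Real.exp_le_exp]
      have h4 : r i * (Q - lam) ≤ r i * Real.log |(k : ℝ)| :=
        mul_le_mul_of_nonneg_left h2.le (hr0 i)
      have h5 : r i * τ ≤ 1 * τ := mul_le_mul_of_nonneg_right ((hr i).trans hr1) hτ
      linarith
    calc ζ * Real.exp (-(r i * Real.log |(k : ℝ)|)) ≤
          ζ * (Real.exp τ * Real.exp (-(r i * (Q + τ - lam)))) := by gcongr
      _ = ζ * Real.exp τ * Real.exp (-(r i * (Q + τ - lam))) := by ring
      _ ≤ _ := by
        gcongr
        linarith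
  have hmove : ∀ i, (|(k' : ℝ)| * B + L) * d ≤ η / 4 * Real.exp (-(r i * (Q + τ - lam))) := by
    intro i
    have h1 : |(k' : ℝ)| * B + L ≤ (B + L) * Real.exp (Q + τ - lam) := by
      have h2 := mul_le_mul_of_nonneg_right (habs k' hk' hku') hB
      have h3 := mul_le_mul_of_nonneg_left (Real.one_le_exp hX) hL
      linarith
    have h4 : Real.exp (Q + τ - lam) * Real.exp (-((1 + r₀) * Q)) =
        Real.exp (τ - lam) * Real.exp (-(r₀ * Q)) := by
      rw [← Real.exp_add, ← Real.exp_add]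
      ring_nf
    have h5 : Real.exp (-(r₀ * Q)) ≤ Real.exp (-(r i * (Q + τ - lam))) := by
      rw [Real.exp_le_exp, neg_le_neg_iff]
      have h6 : r i * (Q + τ - lam) ≤ r i * Q :=
        mul_le_mul_of_nonneg_left (by linarith) (hr0 i)
      have h7 : r i * Q ≤ r₀ * Q := mul_le_mul_of_nonneg_right (hr i) hQ
      linarith
    calc (|(k' : ℝ)| * B + L) * d ≤
          (|(k' : ℝ)| * B + L) * (2 * Real.exp (-((1 + r₀) * Q))) := by gcongr
      _ ≤ (B + L) * Real.exp (Q + τ - lam) * (2 * Real.exp (-((1 + r₀) * Q))) := by gcongr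
      _ = 2 * (B + L) * (Real.exp (Q + τ - lam) * Real.exp (-((1 + r₀) * Q))) := by ring
      _ = 2 * (B + L) * Real.exp (τ - lam) * Real.exp (-(r₀ * Q)) := by
        rw [h4]
        ring
      _ ≤ η / 4 * Real.exp (-(r i * (Q + τ - lam))) :=
        mul_le_mul (by linarith) h5 (Real.exp_pos _).le (by positivity)
  have hdiff : ∀ i, |((k - k' : ℤ) : ℝ) * φ i - ((p i - p' i : ℤ) : ℝ)| <
      η / 2 * Real.exp (-(r i * (Q + τ - lam))) := by
    intro i
    have e : ((k - k' : ℤ) : ℝ) * φ i - ((p i - p' i : ℤ) : ℝ) =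
        (k * φ i - ϑ i - p i) - (k' * φ' i - ϑ' i - p' i) - (k' * (φ i - φ' i)) +
          (ϑ i - ϑ' i) := by
      push_cast
      ring
    have h1 : |k' * (φ i - φ' i)| ≤ |(k' : ℝ)| * (B * d) := by
      rw [abs_mul]
      exact mul_le_mul_of_nonneg_left (hφ i) (abs_nonneg _)
    have h2 := abs_add_le ((k * φ i - ϑ i - p i) - (k' * φ' i - ϑ' i - p' i) -
      (k' * (φ i - φ' i))) (ϑ i - ϑ' i)
    have h3 := abs_sub ((k * φ i - ϑ i - p i) - (k' * φ' i - ϑ' i - p' i)) (k' * (φ i - φ' i))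
    have h4 := abs_sub (k * φ i - ϑ i - p i) (k' * φ' i - ϑ' i - p' i)
    rw [e]
    linarith [hp i, hp' i, hsmall k hk hkl i, hsmall k' hk' hkl' i, hmove i, hϑ i]
  have hkk : k = k' := by
    by_contra hne
    have hne' : k - k' ≠ 0 := sub_ne_zero.2 hne
    have hpos : 0 < |((k - k' : ℤ) : ℝ)| := abs_pos.2 (by exact_mod_cast hne')
    have hle : Real.log |((k - k' : ℤ) : ℝ)| ≤ Real.log 2 + (Q + τ - lam) := by
      rw [Real.log_le_iff_le_exp hpos, Real.exp_add, Real.exp_log two_pos]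
      push_cast
      linarith [abs_sub (k : ℝ) k', habs k hk hku, habs k' hk' hku']
    have h2 : Real.log 2 ≤ 1 := by linarith [Real.log_two_lt_d9]
    obtain ⟨i, hi⟩ := hsafe (k - k') hne' (by linarith) (fun i => p i - p' i)
    have h3 := hi.trans_lt (hdiff i)
    rw [rpow_neg_eq_exp hpos] at h3
    have h4 : Real.exp (-Real.log 2) * Real.exp (-(r i * (Q + τ - lam))) ≤
        Real.exp (-(r i * Real.log |((k - k' : ℤ) : ℝ)|)) := by
      rw [← Real.exp_add, Real.exp_le_exp]
      have h5 := mul_le_mul_of_nonneg_left hle (hr0 i)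
      have h6 : r i * Real.log 2 ≤ 1 * Real.log 2 :=
        mul_le_mul_of_nonneg_right ((hr i).trans hr1) (Real.log_nonneg (by norm_num))
      linarith
    rw [Real.exp_neg, Real.exp_log two_pos] at h4
    have h7 := mul_le_mul_of_nonneg_left h4 hη.le
    linarith
  refine ⟨hkk, funext fun i => ?_⟩
  have h1 := hdiff i
  rw [hkk, sub_self, Int.cast_zero, zero_mul, zero_sub, abs_neg] at h1
  have h2 : Real.exp (-(r i * (Q + τ - lam))) ≤ 1 := by
    rw [Real.exp_le_one_iff, neg_nonpos]
    exact mul_nonneg (hr0 i) hX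
  have h3 : |((p i - p' i : ℤ) : ℝ)| < 1 := by nlinarith
  rw [← Int.cast_abs] at h3
  have h4 : |p i - p' i| < 1 := by exact_mod_cast h3
  exact sub_eq_zero.1 (Int.abs_lt_one_iff.1 h4)

end InhomogeneousUnique

section InhomogeneousBad

variable {I : Type*} [Fintype I] [DecidableEq I]
  {φ : I → ℝ → ℝ} {r : I → ℝ} {i₀ : I} {μ : Measure ℝ} {S : Set ℝ}
  {x₀ δ B b ν α c C ρ₁ K c₁ : ℝ} {m : ℕ}

theorem abs_sub_le_of_inhomogeneous {φ φ' ϑ ϑ' d L b ζ k p s : ℝ} (hb : 0 < b)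
    (hk : 1 ≤ |k|) (hkb : 2 * L ≤ b * |k|) (hd : 0 ≤ d)
    (hφ : b * d ≤ |φ - φ'|) (hϑ : |ϑ - ϑ'| ≤ L * d)
    (h : |k * φ - ϑ - p| < ζ * |k| ^ (-s)) (h' : |k * φ' - ϑ' - p| < ζ * |k| ^ (-s)) :
    d ≤ 4 * ζ / b * Real.exp (-((1 + s) * Real.log |k|)) := by
  have hk0 : 0 < |k| := by linarith
  have h1 : |k| * |φ - φ'| ≤ 2 * (ζ * |k| ^ (-s)) + L * d := by
    rw [← abs_mul]
    have e : k * (φ - φ') = (k * φ - ϑ - p) - (k * φ' - ϑ' - p) + (ϑ - ϑ') := by ring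
    have h2 := abs_add_le ((k * φ - ϑ - p) - (k * φ' - ϑ' - p)) (ϑ - ϑ')
    have h3 := abs_sub (k * φ - ϑ - p) (k * φ' - ϑ' - p)
    rw [e]
    linarith
  have h2 : |k| * (b * d) ≤ |k| * |φ - φ'| := by gcongr
  have h3 : 2 * L * d ≤ b * |k| * d := by gcongr
  have e : 4 * ζ / b * Real.exp (-((1 + s) * Real.log |k|)) =
      4 * (ζ * |k| ^ (-s)) / (b * |k|) := by
    rw [rpow_neg_eq_exp hk0, add_mul, one_mul, neg_add, Real.exp_add, Real.exp_neg (Real.log _),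
      Real.exp_log hk0]
    field_simp
  rw [e, le_div_iff₀ (by positivity)]
  linarith

theorem Frame.exists_bad (hF : Frame φ r i₀ μ S x₀ δ B b ν α c C ρ₁ K c₁ m)
    {ϑ : I → ℝ → ℝ} {L : ℝ} (hL : 0 ≤ L)
    (hϑ : ∀ i, ∀ x ∈ Metric.closedBall x₀ δ, ∀ y ∈ Metric.closedBall x₀ δ,
      |ϑ i x - ϑ i y| ≤ L * |x - y|) :
    ∃ x ∈ S, x ∈ Metric.closedBall x₀ δ ∧ ∃ ζ > 0, ∃ M₀ : ℝ, ∀ k : ℤ, M₀ ≤ |(k : ℝ)| →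
      ∀ p : I → ℤ, ∃ i, ζ * |(k : ℝ)| ^ (-r i) ≤ |k * φ i x - ϑ i x - p i| := by
  obtain ⟨σ, τ, T, ℓ₀, ε, N, hS⟩ := hF.exists_scale
  have hν := hF.bounds.ν_pos
  have hb := hF.bounds.b_pos
  have hB := hF.bounds.one_le_B
  have hr0 := hF.bounds.r_pos i₀
  have hr1 := hF.r_le_one
  have hε := hS.ε_pos
  have hτ := hS.τ_pos
  have hT := hF.T_pos hS
  have hℓ := hS.ℓ_pos
  obtain ⟨s, hs, hs1, hs2⟩ := ((eventually_ge_atTop (4 * N * τ)).and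
    ((eventually_le_mul_exp (A' := 1) hε hν).and
    (eventually_le_mul_exp (A' := Fintype.card I * B * Real.exp (N * T)) hε hν))).exists
  have hs0 : 0 ≤ s := le_trans (by positivity) hs
  obtain ⟨η, hηd⟩ : ∃ η, η = min 1 (ε / ((Fintype.card I + 1) * Real.exp (s + τ))) := ⟨_, rfl⟩
  have hη0 : 0 < η := by
    rw [hηd]
    positivity
  have hη1 : η ≤ 1 := hηd.trans_le (min_le_left _ _)
  have hη : Fintype.card I * η * Real.exp (s + τ) < ε := by
    have h1 : η ≤ ε / ((Fintype.card I + 1) * Real.exp (s + τ)) :=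
      hηd.trans_le (min_le_right _ _)
    rw [le_div_iff₀ (by positivity)] at h1
    have : 0 < η * Real.exp (s + τ) := by positivity
    linarith
  obtain ⟨lam, hlam, hBL⟩ := ((eventually_ge_atTop (s + 2 * τ + 1)).and
    (eventually_le_mul_exp (A' := 8 * (B + L) * Real.exp τ) hη0 one_pos)).exists
  have hBL' : 8 * (B + L) * Real.exp (τ - lam) ≤ η := by
    rw [one_mul] at hBL
    rw [Real.exp_sub, mul_div_assoc', div_le_iff₀ (Real.exp_pos _)]
    exact hBL.le
  obtain ⟨ζ, hζd⟩ : ∃ ζ, ζ = min (η / (8 * Real.exp τ))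
    (b * ℓ₀ / (4 * Real.exp (2 * (τ + lam)))) := ⟨_, rfl⟩
  have hζ0 : 0 < ζ := by
    rw [hζd]
    positivity
  have hζ1 : 8 * ζ * Real.exp τ ≤ η := by
    have h1 := hζd.trans_le (min_le_left _ _)
    rw [le_div_iff₀ (by positivity)] at h1
    linarith
  have hζ2 : 4 * ζ / b * Real.exp (2 * (τ + lam)) ≤ ℓ₀ := by
    have h1 := hζd.trans_le (min_le_right _ _)
    rw [le_div_iff₀ (by positivity)] at h1
    rw [div_mul_eq_mul_div, div_le_iff₀ hb]
    linarith
  set M₀ := max 1 (2 * L / b)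
  obtain ⟨x, hxS, hx0, hx⟩ := hF.exists_avoiding hS
    (Inh := inhSet φ ϑ r τ lam ζ M₀) (by
    rintro q x hxS hxb hdan w ⟨⟨k, hkM, hkl, hku, p, hp⟩, hw⟩
      w' ⟨⟨k', hkM', hkl', hku', p', hp'⟩, hw'⟩
    have hw0 := hS.closedBall_subset (hxb hw)
    have hw0' := hS.closedBall_subset (hxb hw')
    push_cast at hkl hku hkl' hku'
    rw [add_sub_cancel_right] at hkl hkl'
    rw [add_mul, one_mul] at hku hku'
    have hk1 : 1 ≤ |(k : ℝ)| := (le_max_left _ _).trans hkM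
    have hk1' : 1 ≤ |(k' : ℝ)| := (le_max_left _ _).trans hkM'
    have hd : |w - w'| ≤ 2 * Real.exp (-((1 + r i₀) * (q * τ))) := by
      have h1 := dist_triangle_right w w' x
      rw [Real.dist_eq w w'] at h1
      have h2 := Metric.mem_closedBall.1 hw
      have h3 := Metric.mem_closedBall.1 hw'
      have h4 : rad ℓ₀ T q ≤ Real.exp (-((1 + r i₀) * (q * τ))) := by
        refine (mul_le_of_le_one_left (Real.exp_pos _).le hS.ℓ_le_one).trans_eq ?_
        rw [hS.T_eq]
        ring_nf
      linarith
    obtain ⟨rfl, rfl⟩ := inhomogeneous_eq (φ := fun i => φ i w) (ϑ := fun i => ϑ i w)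
      (fun i => (hF.bounds.r_pos i).le) hF.bounds.r_le hr1 (by positivity) hτ.le hs0 hlam hη0 hη1
      hζ0.le hζ1 (by linarith) hL hBL' hd (fun i => hF.abs_sub_le_of_bounds hw0 hw0' i)
      (fun i => hϑ i w hw0 w' hw0')
      (fun k hk hkq p => hF.exists_le_of_not_danger hS hs hs1 hs2 hη0 hη (hxb hw)
        (fun j hj1 hjq a ha haj => hdan j hj1 hjq a ha haj w hw) hk hkq p)
      hk1 hk1' hkl hkl' hku hku' hp hp'
    have hkb : 2 * L ≤ b * |(k : ℝ)| := by
      have := (le_max_right _ _).trans hkM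
      rw [div_le_iff₀ hb] at this
      linarith
    refine (abs_sub_le_of_inhomogeneous hb hk1 hkb (abs_nonneg _) (hF.le_abs_sub hw0 hw0')
      (hϑ i₀ w hw0 w' hw0') (hp i₀) (hp' i₀)).trans ?_
    have h1 : Real.exp (-((1 + r i₀) * Real.log |(k : ℝ)|)) ≤
        Real.exp (2 * (τ + lam)) * Real.exp (-(T * (q + 1 : ℕ))) := by
      rw [← Real.exp_add, Real.exp_le_exp, hS.T_eq]
      have h2 := mul_le_mul_of_nonneg_left hkl.le (show 0 ≤ 1 + r i₀ by linarith)
      have h3 : (1 + r i₀) * (τ + lam) ≤ 2 * (τ + lam) :=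
        mul_le_mul_of_nonneg_right (by linarith) (by linarith)
      push_cast
      linarith
    calc 4 * ζ / b * Real.exp (-((1 + r i₀) * Real.log |(k : ℝ)|)) ≤
          4 * ζ / b * (Real.exp (2 * (τ + lam)) * Real.exp (-(T * (q + 1 : ℕ)))) := by gcongr
      _ = 4 * ζ / b * Real.exp (2 * (τ + lam)) * Real.exp (-(T * (q + 1 : ℕ))) := by ring
      _ ≤ _ := by
        unfold rad
        gcongr)
  refine ⟨x, hxS, hS.closedBall_subset hx0, ζ, hζ0, M₀, fun k hk p => ?_⟩
  by_contra! hp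
  have hk1 : 1 ≤ |(k : ℝ)| := (le_max_left _ _).trans hk
  have hpos : 0 < (Real.log |(k : ℝ)| + lam) / τ := by
    have := Real.log_nonneg hk1
    have : 0 < lam := by linarith
    positivity
  have h1 := Nat.le_ceil ((Real.log |(k : ℝ)| + lam) / τ)
  have h2 := Nat.ceil_lt_add_one hpos.le
  rw [div_le_iff₀ hτ] at h1
  rw [← sub_lt_iff_lt_add, lt_div_iff₀ hτ] at h2
  exact hx _ (Nat.one_le_iff_ne_zero.2 (Nat.ceil_pos.2 hpos).ne')
    ⟨k, hk, by linarith, by linarith, p, hp⟩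

end InhomogeneousBad

/-! ### Existence of the local setting -/

section FrameExists

theorem AnalyticOnNhd.exists_abs_deriv_le {f : ℝ → ℝ} {U : Set ℝ} (hf : AnalyticOnNhd ℝ f U)
    {x δ : ℝ} (h : Metric.closedBall x δ ⊆ U) :
    ∃ B, ∀ y ∈ Metric.closedBall x δ, |deriv f y| ≤ B :=
  (isCompact_closedBall x δ).exists_bound_of_continuousOn (hf.deriv.continuousOn.mono h)

theorem AnalyticOnNhd.exists_lipschitz {f : ℝ → ℝ} {U : Set ℝ} (hf : AnalyticOnNhd ℝ f U)
    {x δ : ℝ} (h : Metric.closedBall x δ ⊆ U) :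
    ∃ B, ∀ y ∈ Metric.closedBall x δ, ∀ z ∈ Metric.closedBall x δ,
      |f y - f z| ≤ B * |y - z| := by
  obtain ⟨B, hB⟩ := hf.exists_abs_deriv_le h
  exact ⟨B, fun y hy z hz => (convex_closedBall x δ).norm_image_sub_le_of_norm_deriv_le
    (fun w hw => (hf w (h hw)).differentiableAt) hB hz hy⟩

theorem exists_forall_le_of_forall_exists {I : Type*} [Finite I] {P : I → ℝ → Prop}
    (hP : ∀ i x y, x ≤ y → P i x → P i y) (h : ∀ i, ∃ B, P i B) : ∃ B, 1 ≤ B ∧ ∀ i, P i B := by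
  choose B hB using h
  obtain ⟨D, hD⟩ := (finite_range B).bddAbove
  exact ⟨max 1 D, le_max_left _ _, fun i =>
    hP i _ _ ((hD (mem_range_self i)).trans (le_max_right _ _)) (hB i)⟩

theorem AhlforsOn.exists_ne {μ : Measure ℝ} {S : Set ℝ} {α c C ρ₁ : ℝ}
    (h : AhlforsOn μ S α c C ρ₁) {y ρ : ℝ} (hy : y ∈ S) (hρ : 0 < ρ) :
    ∃ x ∈ S, x ∈ Metric.closedBall y ρ ∧ x ≠ y := by
  by_contra! hne
  have hsing : μ {y} = 0 := by
    have h0 : Tendsto (fun ρ : ℝ => ENNReal.ofReal (C * ρ ^ α)) (nhdsWithin 0 (Ioi 0))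
        (nhds 0) := by
      have h1 : Tendsto (fun ρ : ℝ => C * ρ ^ α) (nhds 0) (nhds (C * 0 ^ α)) :=
        ((Real.continuousAt_rpow_const 0 α (Or.inr h.α_pos.le)).tendsto).const_mul C
      rw [Real.zero_rpow h.α_pos.ne', mul_zero] at h1
      simpa using ENNReal.tendsto_ofReal (h1.mono_left nhdsWithin_le_nhds)
    refine le_antisymm (ge_of_tendsto h0 ?_) bot_le
    filter_upwards [Ioo_mem_nhdsGT h.ρ₁_pos] with t ht
    exact (measure_mono (singleton_subset_iff.2 (Metric.mem_closedBall_self ht.1.le))).trans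
      (h.upper y hy t ht.1 ht.2.le)
  have hzero : μ (Metric.closedBall y (min ρ ρ₁)) = 0 := by
    refine measure_mono_null (t := {y} ∪ Sᶜ) (fun z hz => ?_)
      (measure_union_null hsing h.compl)
    by_cases hzS : z ∈ S
    · exact Or.inl (hne z hzS (Metric.closedBall_subset_closedBall (min_le_left _ _) hz))
    · exact Or.inr hzS
  have hlow := h.lower y hy _ (lt_min hρ h.ρ₁_pos) (min_le_right _ _)
  rw [hzero, nonpos_iff_eq_zero, ENNReal.ofReal_eq_zero] at hlow
  have := Real.rpow_pos_of_pos (lt_min hρ h.ρ₁_pos) α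
  have := mul_pos h.c_pos this
  linarith

theorem AhlforsOn.exists_ne_zero {μ : Measure ℝ} {S : Set ℝ} {α c C ρ₁ : ℝ}
    (h : AhlforsOn μ S α c C ρ₁) {U : Set ℝ} (hU : IsOpen U) (hUc : IsPreconnected U)
    {f : ℝ → ℝ} (hf : AnalyticOnNhd ℝ f U) (hf0 : ¬ EqOn f 0 U) (hUS : (U ∩ S).Nonempty) :
    ∃ x ∈ U ∩ S, f x ≠ 0 := by
  obtain ⟨y, hyU, hyS⟩ := hUS
  rcases (hf y hyU).eventually_eq_zero_or_eventually_ne_zero with h0 | h0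
  · exact absurd (hf.eqOn_zero_of_preconnected_of_eventuallyEq_zero hUc hyU h0) hf0
  · have h1 : ∀ᶠ z in nhds y, z ≠ y → f z ≠ 0 := by
      rwa [eventually_nhdsWithin_iff] at h0
    obtain ⟨ρ, hρ, hsub⟩ := Metric.nhds_basis_closedBall.mem_iff.1
      (h1.and (hU.mem_nhds hyU))
    obtain ⟨x, hxS, hxb, hxy⟩ := h.exists_ne hyS hρ
    exact ⟨x, ⟨(hsub hxb).2, hxS⟩, (hsub hxb).1 hxy⟩

variable {I : Type*} [Fintype I] [DecidableEq I] {φ : I → ℝ → ℝ} {r : I → ℝ} {μ : Measure ℝ}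
  {S : Set ℝ} {α c C ρ₁ : ℝ}

theorem AhlforsOn.exists_frame (hA : AhlforsOn μ S α c C ρ₁) {U : Set ℝ} (hU : IsOpen U)
    (hUc : IsPreconnected U) (hUS : (U ∩ S).Nonempty) (hφ : ∀ i, AnalyticOnNhd ℝ (φ i) U)
    (hnd : ∀ c : Option I → ℝ, (∀ x ∈ U, hatComb φ c x = 0) → c = 0)
    (hr : ∀ i, 0 < r i) (hr1 : ∑ i, r i = 1) :
    ∃ i₀ x₀ δ B b ν K c₁ m, Frame φ r i₀ μ S x₀ δ B b ν α c C ρ₁ K c₁ m ∧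
      Metric.closedBall x₀ δ ⊆ U := by
  have hI : Nonempty I := by
    by_contra h
    rw [not_nonempty_iff] at h
    rw [Finset.univ_eq_empty, Finset.sum_empty] at hr1
    exact zero_ne_one hr1
  obtain ⟨i₀, hi₀⟩ := Finite.exists_max r
  obtain ⟨i₁, hi₁⟩ := Finite.exists_min r
  obtain ⟨x₀, ⟨hx₀, hx₀S⟩, hd0⟩ := hA.exists_ne_zero hU hUc (hφ i₀).deriv (by
    intro h0
    obtain ⟨a, ha⟩ := hU.exists_is_const_of_deriv_eq_zero hUc
      (fun x hx => (hφ i₀ x hx).differentiableAt.differentiableWithinAt) h0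
    have h1 := hnd (fun p => p.elim (-a) (Pi.single i₀ 1)) fun x hx => by
      rw [hatComb, Fintype.sum_option]
      simp [hatFun, Pi.single_apply, ha x hx]
    have := congrFun h1 (some i₀)
    simp at this) hUS
  obtain ⟨m₁, δ₁, K, hδ₁, hK, -, hmin⟩ := exists_minor_comparable hφ hU hUc hx₀ i₀
  obtain ⟨m₂, δ₂, c₁, hδ₂, hc₁, hδ₂U, hlow⟩ := exists_hatComb_lower hφ hU hUc hx₀ hnd
  have hev : ∀ᶠ x in nhds x₀, |deriv (φ i₀) x₀| / 2 < |deriv (φ i₀) x| :=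
    ((hφ i₀).deriv x₀ hx₀).continuousAt.abs.eventually_const_lt
      (half_lt_self (abs_pos.2 hd0))
  obtain ⟨δ₃, hδ₃, hsub₃⟩ := Metric.nhds_basis_closedBall.mem_iff.1 hev
  set δ := min δ₁ (min δ₂ δ₃)
  have hδ : 0 < δ := lt_min hδ₁ (lt_min hδ₂ hδ₃)
  have hs₁ : Metric.closedBall x₀ δ ⊆ Metric.closedBall x₀ δ₁ :=
    Metric.closedBall_subset_closedBall (min_le_left _ _)
  have hs₂ : Metric.closedBall x₀ δ ⊆ Metric.closedBall x₀ δ₂ :=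
    Metric.closedBall_subset_closedBall ((min_le_right _ _).trans (min_le_left _ _))
  have hs₃ : Metric.closedBall x₀ δ ⊆ Metric.closedBall x₀ δ₃ :=
    Metric.closedBall_subset_closedBall ((min_le_right _ _).trans (min_le_right _ _))
  have hsU := hs₂.trans hδ₂U
  obtain ⟨B₁, hB₁, hdB⟩ := exists_forall_le_of_forall_exists
    (P := fun i B => ∀ y ∈ Metric.closedBall x₀ δ, |deriv (φ i) y| ≤ B)
    (fun i x y hxy h z hz => (h z hz).trans hxy) fun i => (hφ i).exists_abs_deriv_le hsU
  obtain ⟨B₂, -, hdL⟩ := exists_forall_le_of_forall_exists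
    (P := fun i B => ∀ y ∈ Metric.closedBall x₀ δ, ∀ z ∈ Metric.closedBall x₀ δ,
      |deriv (φ i) y - deriv (φ i) z| ≤ B * |y - z|)
    (fun i x y hxy h z hz w hw => (h z hz w hw).trans (by gcongr))
    fun i => (hφ i).deriv.exists_lipschitz hsU
  refine ⟨i₀, x₀, δ, max B₁ B₂, |deriv (φ i₀) x₀| / 2, r i₁, K, c₁, max 1 (max m₁ m₂),
    ⟨⟨hi₀, hr i₁, hi₁, hB₁.trans (le_max_left _ _), half_pos (abs_pos.2 hd0), ?_, ?_, ?_, ?_⟩,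
      hr1, hA, hx₀S, hδ, le_max_left _ _, hK, ?_, ?_, hc₁, ?_⟩, hsU⟩
  · exact fun i x hx => (hφ i x (hsU hx)).differentiableAt
  · exact fun i x hx => (hdB i x hx).trans (le_max_left _ _)
  · exact fun i x hx y hy => (hdL i x hx y hy).trans (by gcongr; exact le_max_right _ _)
  · exact fun x hx => (hsub₃ (hs₃ hx)).le
  · intro d j v f
    obtain ⟨g, h0, h1, A, k, hk, h2⟩ := hmin d j v f
    exact ⟨g, h0, fun i x hx => h1 i x (hs₁ hx), A, k,
      hk.trans ((le_max_left _ _).trans (le_max_right _ _)), fun x hx => h2 x (hs₁ hx)⟩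
  · exact fun o p => (analyticOnNhd_curveMat hφ o p).continuousOn.mono hsU
  · intro d hd y ρ hρ hρ1 hsub
    obtain ⟨x, hx, h⟩ := hlow d hd y ρ hρ hρ1 (hsub.trans hs₂)
    refine ⟨x, hx, le_trans ?_ h⟩
    have : ρ ^ max 1 (max m₁ m₂) ≤ ρ ^ m₂ :=
      pow_le_pow_of_le_one hρ.le hρ1 ((le_max_right _ _).trans (le_max_right _ _))
    gcongr

end FrameExists

/-! ### The main theorem -/

theorem msupport_eq_support (μ : Measure ℝ) : msupport μ = μ.support := by
  ext x
  rw [Metric.nhds_basis_ball.mem_measureSupport]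
  rfl

theorem ahlforsOn_msupport {μ : Measure ℝ} {C α ρ₀ : ℝ} (hC : 1 ≤ C) (hα : 0 < α) (hρ₀ : 0 < ρ₀)
    (h : ∀ x ∈ msupport μ, ∀ ρ : ℝ, 0 < ρ → ρ ≤ ρ₀ →
      ENNReal.ofReal (C⁻¹ * ρ ^ α) ≤ μ (Metric.ball x ρ) ∧
        μ (Metric.ball x ρ) ≤ ENNReal.ofReal (C * ρ ^ α)) :
    AhlforsOn μ (msupport μ) α C⁻¹ (C * 2 ^ α) (ρ₀ / 2) := by
  have hC0 : 0 < C := by linarith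
  refine ⟨hα, by positivity, by positivity, by positivity, ?_, ?_, ?_, ?_⟩
  · rw [msupport_eq_support]
    exact Measure.isClosed_support
  · rw [msupport_eq_support]
    exact Measure.measure_compl_support
  · exact fun x hx ρ hρ hρ₁ => ((h x hx ρ hρ (by linarith)).1).trans
      (measure_mono Metric.ball_subset_closedBall)
  · intro x hx ρ hρ hρ₁
    have h1 := (h x hx (2 * ρ) (by positivity) (by linarith)).2
    rw [Real.mul_rpow two_pos.le hρ.le, ← mul_assoc] at h1
    exact (measure_mono (Metric.closedBall_subset_ball (by linarith))).trans h1

theorem badLiminf_pos {n : ℕ} {r y θv : Fin n → ℝ} {ζ M₀ : ℝ} (hζ : 0 < ζ)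
    (h : ∀ k : ℤ, M₀ ≤ |(k : ℝ)| → ∃ i, 0 < r i ∧
      ζ * |(k : ℝ)| ^ (-r i) ≤ distInt (k * y i - θv i)) : 0 < badLiminf r y θv := by
  have hn : Nonempty (Fin n) := by
    obtain ⟨i, -⟩ := h ⌈M₀⌉ ((Int.le_ceil M₀).trans (le_abs_self _))
    exact ⟨i⟩
  obtain ⟨j, hj⟩ := Finite.exists_min fun i => ζ ^ (1 / r i)
  have hpos : 0 < ζ ^ (1 / r j) := by positivity
  refine (ENNReal.ofReal_pos.2 hpos).trans_le (le_liminf_of_le (by isBoundedDefault) ?_)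
  refine eventually_comap.2 ((eventually_ge_atTop (max 1 ⌈M₀⌉)).mono ?_)
  rintro _ ha q rfl
  have hq1 : (1 : ℝ) ≤ |(q : ℝ)| := by
    rw [← Int.cast_abs]
    exact_mod_cast (le_max_left _ _).trans ha
  have hqM : M₀ ≤ |(q : ℝ)| := by
    rw [← Int.cast_abs]
    exact (Int.le_ceil M₀).trans (by exact_mod_cast (le_max_right _ _).trans ha)
  have hq0 : 0 < |(q : ℝ)| := by linarith
  obtain ⟨i, hi, hdist⟩ := h q hqM
  refine ENNReal.ofReal_le_ofReal ?_
  have h1 : ζ ^ (1 / r i) * |(q : ℝ)|⁻¹ ≤ wpow (distInt (q * y i - θv i)) (r i) := by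
    rw [wpow, if_neg hi.ne']
    have h2 := Real.rpow_le_rpow (by positivity) hdist (show 0 ≤ 1 / r i by positivity)
    rw [Real.mul_rpow hζ.le (by positivity), ← Real.rpow_mul hq0.le] at h2
    have e : -r i * (1 / r i) = -1 := by field_simp
    rwa [e, Real.rpow_neg_one] at h2
  have h2 := le_ciSup (f := fun i => wpow (distInt ((q : ℝ) * y i - θv i)) (r i))
    (finite_range _).bddAbove i
  calc ζ ^ (1 / r j) ≤ ζ ^ (1 / r i) := hj i
    _ = ζ ^ (1 / r i) * |(q : ℝ)|⁻¹ * |(q : ℝ)| := by field_simp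
    _ ≤ _ := by
      gcongr
      exact h1.trans h2

theorem stmt0 {n : ℕ} (hn : 1 ≤ n) (r : Fin n → ℝ)
    (hr_nonneg : ∀ i, 0 ≤ r i) (hr_sum : ∑ i, r i = 1)
    (U : Set ℝ) (hU_open : IsOpen U) (hU_conn : U.OrdConnected)
    (φ : ℝ → Fin n → ℝ)
    (hφ_an : AnalyticOnNhd ℝ φ U)
    -- nondegeneracy: `1, φ₁, …, φₙ` are linearly independent over `ℝ`
    (hφ_nd : ∀ (a : ℝ) (b : Fin n → ℝ),
      (∀ x ∈ U, a + ∑ i, b i * φ x i = 0) → a = 0 ∧ b = 0)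
    (θ : Fin n → (Fin n → ℝ) → ℝ)
    -- each `θᵢ` is Lipschitz on `φ(U)` (the sup norm is the norm of `Fin n → ℝ`)
    (hθ_lip : ∀ i, ∃ d > 0, ∀ z ∈ φ '' U, ∀ w ∈ φ '' U,
      |θ i z - θ i w| ≤ d * ‖z - w‖)
    (C α : ℝ) (hC : 1 ≤ C) (hα : 0 < α)
    (μ : Measure ℝ)
    -- `μ` is `(C,α)`-Ahlfors regular
    (hμ_reg : ∃ ρ₀ > 0, ∀ x ∈ msupport μ, ∀ ρ : ℝ, 0 < ρ → ρ ≤ ρ₀ →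
      ENNReal.ofReal (C⁻¹ * ρ ^ α) ≤ μ (Metric.ball x ρ) ∧
        μ (Metric.ball x ρ) ≤ ENNReal.ofReal (C * ρ ^ α))
    (hUμ : (U ∩ msupport μ).Nonempty) :
    ({x ∈ U | 0 < badLiminf r (φ x) (fun i => θ i (φ x))} ∩ msupport μ).Nonempty := by
  classical
  obtain ⟨ρ₀, hρ₀, hreg⟩ := hμ_reg
  have hA := ahlforsOn_msupport hC hα hρ₀ hreg
  have hφi : ∀ i, AnalyticOnNhd ℝ (fun x => φ x i) U := fun i x hx =>
    analyticAt_pi_iff.1 (hφ_an x hx) i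
  let I := {i : Fin n // 0 < r i}
  have hsum : ∀ f : Fin n → ℝ, (∀ i, ¬ 0 < r i → f i = 0) → ∑ i : I, f i = ∑ i, f i :=
    fun f hf => Fintype.sum_of_injective Subtype.val Subtype.val_injective _ _
      (fun i hi => hf i fun h => hi ⟨⟨i, h⟩, rfl⟩) fun _ => rfl
  obtain ⟨i₀, x₀, δ, B, b, ν, K, c₁, m, hF, hsub⟩ := hA.exists_frame (I := I)
    (φ := fun i x => φ x i) (r := fun i => r i) hU_open hU_conn.isPreconnected hUμ
    (fun i => hφi i) (fun c hc => by
      have h0 := hφ_nd (c none) (fun i => if h : 0 < r i then c (some ⟨i, h⟩) else 0)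
        fun x hx => by
          refine Eq.trans ?_ (hc x hx)
          rw [hatComb, Fintype.sum_option, ← hsum _ fun i hi => by simp [hi]]
          congr 1
          · simp [hatFun]
          · refine Finset.sum_congr rfl fun i _ => ?_
            simp [hatFun, i.2, mul_comm]
      ext p
      cases p with
      | none => exact h0.1
      | some i => simpa [i.2] using congrFun h0.2 i) (fun i => i.2)
    ((hsum r fun i hi => le_antisymm (not_lt.1 hi) (hr_nonneg i)).trans hr_sum)
  obtain ⟨B', hB', hlip⟩ := exists_forall_le_of_forall_exists
    (P := fun i B => ∀ y ∈ Metric.closedBall x₀ δ, ∀ z ∈ Metric.closedBall x₀ δ,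
      |φ y i - φ z i| ≤ B * |y - z|)
    (fun i x y hxy h z hz w hw => (h z hz w hw).trans (by gcongr))
    fun i => (hφi i).exists_lipschitz hsub
  obtain ⟨L, hL, hθ⟩ := exists_forall_le_of_forall_exists
    (P := fun i L => ∀ y ∈ Metric.closedBall x₀ δ, ∀ z ∈ Metric.closedBall x₀ δ,
      |θ i (φ y) - θ i (φ z)| ≤ L * |y - z|)
    (fun i x y hxy h z hz w hw => (h z hz w hw).trans (by gcongr))
    fun i => by
      obtain ⟨d, hd, h⟩ := hθ_lip i
      refine ⟨d * B', fun y hy z hz => (h _ (mem_image_of_mem φ (hsub hy)) _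
        (mem_image_of_mem φ (hsub hz))).trans ?_⟩
      rw [mul_assoc]
      gcongr
      exact (pi_norm_le_iff_of_nonneg (by positivity)).2 fun i => hlip i y hy z hz
  obtain ⟨x, hxS, hx, ζ, hζ, M₀, hbad⟩ := hF.exists_bad (ϑ := fun i x => θ i (φ x))
    (by linarith : 0 ≤ L) fun i => hθ i
  refine ⟨x, ⟨hsub hx, badLiminf_pos (M₀ := M₀) hζ fun k hk => ?_⟩, hxS⟩
  obtain ⟨i, hi⟩ := hbad k hk fun i => round (k * φ x i - θ i (φ x))
  exact ⟨i, i.2, hi⟩
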